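/- arXiv:0704.1914 — 4 statements merged into one kernel-verified Lean document; each statement's English description precedes it below -/
import Mathlib

section
/- For every n ≥ 5 and every r with r < n, every group homomorphism from K_n into the symmetric group S_r (permutations of Fin r) is trivial. -/
def braidRels (n : ℕ) : Set (FreeGroup (Fin (n - 1))) :=
  {r | (∃ i j : Fin (n - 1), 2 ≤ |(i : ℤ) - (j : ℤ)| ∧
        r = FreeGroup.of i * FreeGroup.of j * (FreeGroup.of i)⁻¹ * (FreeGroup.of j)⁻¹) ∨
       (∃ i j : Fin (n - 1), |(i : ℤ) - (j : ℤ)| = 1 ∧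
        r = FreeGroup.of i * FreeGroup.of j * FreeGroup.of i *
            (FreeGroup.of j)⁻¹ * (FreeGroup.of i)⁻¹ * (FreeGroup.of j)⁻¹)}

/-- The braid group `B n` on `n` strands, presented with generators `σ_1, …, σ_{n-1}`. -/
abbrev BraidGroup (n : ℕ) : Type := PresentedGroup (braidRels n)

/-- The generator `σ_{i+1}` of the braid group. -/
def braidGen {n : ℕ} (i : Fin (n - 1)) : BraidGroup n := PresentedGroup.of i


namespace KnAux

/-- Generators indexed by naturals, with junk value `1`. -/
def s (n : ℕ) (i : ℕ) : BraidGroup n := if h : i < n - 1 then braidGen ⟨i, h⟩ else 1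

theorem s_comm (n : ℕ) {i j : ℕ} (hij : i + 2 ≤ j) : Commute (s n i) (s n j) := by
  unfold s
  split_ifs with h1 h2
  · have := PresentedGroup.one_of_mem (rels := braidRels n)
      (x := FreeGroup.of ⟨i, h1⟩ * FreeGroup.of ⟨j, h2⟩ * (FreeGroup.of ⟨i, h1⟩)⁻¹ * (FreeGroup.of ⟨j, h2⟩)⁻¹)
      (Or.inl ⟨_, _, by
        simp only
        rw [abs_sub_comm, le_abs]; left; omega, rfl⟩)
    simp only [map_mul, map_inv] at this
    rw [mul_inv_eq_one, mul_inv_eq_iff_eq_mul] at this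
    exact this
  all_goals simp

theorem s_braid (n : ℕ) {i : ℕ} (hi : i + 2 < n) :
    s n i * s n (i + 1) * s n i = s n (i + 1) * s n i * s n (i + 1) := by
  have h1 : i < n - 1 := by omega
  have h2 : i + 1 < n - 1 := by omega
  have := PresentedGroup.one_of_mem (rels := braidRels n)
      (x := FreeGroup.of ⟨i, h1⟩ * FreeGroup.of ⟨i+1, h2⟩ * FreeGroup.of ⟨i, h1⟩ *
        (FreeGroup.of ⟨i+1, h2⟩)⁻¹ * (FreeGroup.of ⟨i, h1⟩)⁻¹ * (FreeGroup.of ⟨i+1, h2⟩)⁻¹)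
      (Or.inr ⟨_, _, by simp, rfl⟩)
  simp only [map_mul, map_inv] at this
  rw [mul_inv_eq_one, mul_inv_eq_iff_eq_mul, mul_inv_eq_iff_eq_mul] at this
  simp only [s, h1, h2, dif_pos]
  exact this

theorem s_closure (n : ℕ) : Subgroup.closure (Set.range (s n)) = ⊤ := by
  rw [eq_top_iff, ← PresentedGroup.closure_range_of (braidRels n)]
  apply Subgroup.closure_mono
  rintro _ ⟨i, rfl⟩
  exact ⟨i, by simp [s, braidGen]⟩

theorem mem_zpowers_of_eq {n : ℕ} {Q : Type*} [Group Q] (π : BraidGroup n →* Q) (a : Q)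
    (h : ∀ i, i + 1 < n → π (s n i) = a) (g : BraidGroup n) : π g ∈ Subgroup.zpowers a := by
  have : (⊤ : Subgroup (BraidGroup n)) ≤ (Subgroup.zpowers a).comap π := by
    rw [← s_closure, Subgroup.closure_le]
    rintro _ ⟨i, rfl⟩
    by_cases hi : i + 1 < n
    · simp [h i hi]
    · have : s n i = 1 := by
        unfold s; rw [dif_neg]; omega
      simp [this]
  exact this (Subgroup.mem_top g)

theorem braid_eq_of_comm {G : Type*} [Group G] {a b : G} (h : a * b * a = b * a * b)
    (hc : a * b = b * a) : a = b := by
  rw [hc] at h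
  exact mul_left_cancel h

theorem all_eq {n : ℕ} {Q : Type*} [Group Q] (π : BraidGroup n →* Q) {k : ℕ} (hk : k + 2 < n)
    (h : π (s n k) = π (s n (k + 1))) : ∀ i, i + 1 < n → π (s n i) = π (s n k) := by
  have br : ∀ i, i + 2 < n → π (s n i) * π (s n (i+1)) * π (s n i) =
      π (s n (i+1)) * π (s n i) * π (s n (i+1)) := fun i hi => by
    simpa using congrArg π (s_braid n hi)
  have cm : ∀ i j, i + 2 ≤ j → π (s n i) * π (s n j) = π (s n j) * π (s n i) := fun i j hij => by
    simpa using congrArg π (s_comm n hij).eq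
  have up : ∀ m, k + m + 2 < n → π (s n (k + m)) = π (s n (k + m + 1)) := by
    intro m
    induction m with
    | zero => intro _; exact h
    | succ m ih =>
      intro hm
      have e := ih (by omega)
      have := cm (k + m) (k + m + 2) (by omega)
      rw [e] at this
      exact braid_eq_of_comm (br (k + m + 1) (by omega)) this
  have up' : ∀ m, k + m + 1 < n → π (s n (k + m)) = π (s n k) := by
    intro m
    induction m with
    | zero => intro _; rfl
    | succ m ih => intro hm; rw [← ih (by omega)]; exact (up m (by omega)).symm
  have down : ∀ m, m ≤ k → π (s n (k - m)) = π (s n (k - m + 1)) := by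
    intro m
    induction m with
    | zero => intro _; exact h
    | succ m ih =>
      intro hm
      have e := ih (by omega)
      obtain ⟨j, hj⟩ : ∃ j, k = j + (m + 1) := ⟨k - (m+1), by omega⟩
      have e1 : k - m = j + 1 := by omega
      have e2 : k - (m + 1) = j := by omega
      rw [e1] at e
      rw [e2]
      have := cm j (j + 2) (by omega)
      rw [show j + 2 = j + 1 + 1 from rfl, ← e] at this
      exact braid_eq_of_comm (br j (by omega)) this
  have down' : ∀ m, m ≤ k → π (s n (k - m)) = π (s n k) := by
    intro m
    induction m with
    | zero => intro _; rfl
    | succ m ih =>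
      intro hm; rw [← ih (by omega), down (m+1) hm]
      congr 2; omega
  intro i hi
  rcases le_total k i with h' | h'
  · obtain ⟨m, rfl⟩ := Nat.exists_eq_add_of_le h'
    exact up' m hi
  · have := down' (k - i) (by omega)
    rwa [show k - (k - i) = i by omega] at this

theorem ab_eq {n : ℕ} (hn : 2 < n) {Q : Type*} [CommGroup Q] (π : BraidGroup n →* Q) :
    ∀ i, i + 1 < n → π (s n i) = π (s n 0) := by
  apply all_eq π (by omega)
  apply braid_eq_of_comm _ (mul_comm _ _)
  simpa using congrArg π (s_braid n (i := 0) (by omega))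

abbrev K (n : ℕ) : Subgroup (BraidGroup n) := commutator (BraidGroup n)

theorem mem_K_iff {n : ℕ} (g : BraidGroup n) : g ∈ K n ↔ Abelianization.of g = 1 := by
  rw [← MonoidHom.mem_ker, Abelianization.ker_of]

theorem exists_adjust {n : ℕ} (hn : 2 < n) {i : ℕ} (hi : i + 1 < n) (g : BraidGroup n) :
    ∃ j : ℤ, g * s n i ^ j ∈ K n := by
  obtain ⟨j, hj⟩ := mem_zpowers_of_eq (Abelianization.of (G := BraidGroup n)) _ (ab_eq hn _) g
  refine ⟨-j, ?_⟩
  rw [mem_K_iff, map_mul, map_zpow, ← hj, ab_eq hn _ i hi]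
  simp

theorem div_mem {n : ℕ} (hn : 2 < n) {i j : ℕ} (hi : i + 1 < n) (hj : j + 1 < n) :
    s n i * (s n j)⁻¹ ∈ K n := by
  rw [mem_K_iff, map_mul, map_inv, ab_eq hn _ i hi, ab_eq hn _ j hj, mul_inv_cancel]

theorem K_le_of_all_eq {n : ℕ} {Q : Type*} [Group Q] (π : BraidGroup n →* Q) (a : Q)
    (h : ∀ i, i + 1 < n → π (s n i) = a) : K n ≤ π.ker := by
  rw [K, commutator_def, Subgroup.commutator_le]
  intro g _ g' _
  obtain ⟨j, hj⟩ := mem_zpowers_of_eq π a h g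
  obtain ⟨j', hj'⟩ := mem_zpowers_of_eq π a h g'
  rw [MonoidHom.mem_ker, map_commutatorElement, commutatorElement_eq_one_iff_mul_comm, ← hj, ← hj']
  exact (Commute.zpow_zpow_self a j j').eq

theorem kill {n : ℕ} (hn : 2 < n) {G : Type*} [Group G] (f : K n →* G) (w : K n)
    {i : ℕ} (hi : i + 1 < n) (hw : Commute (s n i) w) (hf : f w = 1)
    (hall : ∀ (Q : Type) [Group Q] (π : BraidGroup n →* Q), π w = 1 →
      ∃ k, k + 2 < n ∧ π (s n k) = π (s n (k + 1))) : ∀ x, f x = 1 := by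
  set N := Subgroup.normalClosure {(w : BraidGroup n)} with hN
  have h1 : N ≤ f.ker.map (K n).subtype := by
    rw [hN, Subgroup.normalClosure, Subgroup.closure_le]
    intro y hy
    rw [Group.mem_conjugatesOfSet_iff] at hy
    obtain ⟨a, ha, hc⟩ := hy
    rw [Set.mem_singleton_iff] at ha
    subst ha
    obtain ⟨g, rfl⟩ := isConj_iff.1 hc
    obtain ⟨j, hj⟩ := exists_adjust hn hi g
    have e : g * w * g⁻¹ = (g * s n i ^ j) * w * (g * s n i ^ j)⁻¹ := by
      have := (hw.zpow_left j).eq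
      rw [mul_assoc g (s n i ^ j), this]; group
    refine ⟨⟨g * s n i ^ j, hj⟩ * w * ⟨g * s n i ^ j, hj⟩⁻¹, ?_, ?_⟩
    · simp [MonoidHom.mem_ker, hf]
    · rw [e]; rfl
  have h2 : K n ≤ N := by
    obtain ⟨k, hk, he⟩ := hall _ (QuotientGroup.mk' N) (by
      rw [← MonoidHom.mem_ker, QuotientGroup.ker_mk']
      exact Subgroup.subset_normalClosure rfl)
    have := K_le_of_all_eq _ _ (all_eq _ hk he)
    rwa [QuotientGroup.ker_mk'] at this
  intro x
  obtain ⟨y, hy, hxy⟩ := h1 (h2 x.2)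
  have : y = x := Subtype.ext hxy
  rw [← this]; exact hy

/-- The element `σ_i σ_j⁻¹` of `K_n`. -/
def d {n : ℕ} (hn : 2 < n) (i j : ℕ) (hi : i + 1 < n) (hj : j + 1 < n) : K n :=
  ⟨s n i * (s n j)⁻¹, div_mem hn hi hj⟩

theorem kill_adj {n : ℕ} (hn : 5 ≤ n) {G : Type*} [Group G] (f : K n →* G) {k l : ℕ}
    (hk : k + 2 < n) (hl : l + 1 < n) (hkl : l + 2 ≤ k ∨ k + 3 ≤ l)
    (hf : f (d (by omega) k (k+1) (by omega) (by omega)) = 1) : ∀ x, f x = 1 := by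
  refine kill (by omega) f _ hl ?_ hf ?_
  · rcases hkl with h | h
    · exact (s_comm n h).mul_right (s_comm n (by omega)).inv_right
    · exact (s_comm n (i := k) (by omega)).symm.mul_right (s_comm n (by omega)).symm.inv_right
  · intro Q _ π h
    refine ⟨k, hk, ?_⟩
    simpa [d, mul_inv_eq_one] using h

/-- killing `σ_3σ_1⁻¹` (zero-based: `s 2`, `s 0`). -/
theorem kill_20 {n : ℕ} (hn : 5 ≤ n) {G : Type*} [Group G] (f : K n →* G)
    (hf : f (d (by omega) 2 0 (by omega) (by omega)) = 1) : ∀ x, f x = 1 := by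
  refine kill (by omega) f _ (i := 0) (by omega) ?_ hf ?_
  · exact (s_comm n (by omega)).mul_right (Commute.refl _).inv_right
  · intro Q _ π h
    have h' : π (s n 2) = π (s n 0) := by simpa [d, mul_inv_eq_one] using h
    refine ⟨2, by omega, ?_⟩
    refine braid_eq_of_comm (by simpa using congrArg π (s_braid n (i := 2) (by omega))) ?_
    rw [h']
    simpa using congrArg π (s_comm n (i := 0) (j := 3) (by omega)).eq

/-- The braid relation for `c_i = σ_i σ_1⁻¹`. -/
theorem c_braid {n : ℕ} (hn : 2 < n) {i : ℕ} (h2 : 2 ≤ i) (hi : i + 2 < n) :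
    d hn i 0 (by omega) (by omega) * d hn (i+1) 0 (by omega) (by omega) *
      d hn i 0 (by omega) (by omega) =
    d hn (i+1) 0 (by omega) (by omega) * d hn i 0 (by omega) (by omega) *
      d hn (i+1) 0 (by omega) (by omega) := by
  apply Subtype.ext
  simp only [d, Subgroup.coe_mul]
  have c1 := (s_comm n (i := 0) (j := i) (by omega)).inv_left
  have c2 := (s_comm n (i := 0) (j := i+1) (by omega)).inv_left
  have b := s_braid n hi
  set x := s n i
  set y := s n (i+1)
  set z := (s n 0)⁻¹
  have e1 : x * z * (y * z) * (x * z) = x * y * x * z * z * z := by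
    have c1' := c1.eq
    have c2' := c2.eq
    calc x * z * (y * z) * (x * z) = x * (z * y) * (z * x) * z := by group
      _ = x * y * (z * x) * z * z := by rw [c2', c1']; simp only [mul_assoc]; rw [← mul_assoc z x, c1']; simp only [mul_assoc]
      _ = x * y * x * z * z * z := by rw [c1']; group
  have e2 : y * z * (x * z) * (y * z) = y * x * y * z * z * z := by
    have c1' := c1.eq
    have c2' := c2.eq
    calc y * z * (x * z) * (y * z) = y * (z * x) * (z * y) * z := by group
      _ = y * x * (z * y) * z * z := by rw [c2', c1']; simp only [mul_assoc]; rw [← mul_assoc z y, c2']; simp only [mul_assoc]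
      _ = y * x * y * z * z * z := by rw [c2']; group
  rw [e1, e2, b]

theorem c_comm {n : ℕ} (hn : 2 < n) {i j : ℕ} (h2 : 2 ≤ i) (hij : i + 2 ≤ j) (hj : j + 1 < n) :
    Commute (d hn i 0 (by omega) (by omega)) (d hn j 0 (by omega) (by omega)) := by
  apply Subtype.ext
  simp only [d, Subgroup.coe_mul]
  have c1 := (s_comm n (i := 0) (j := i) (by omega)).inv_left.symm
  have c2 := (s_comm n (i := 0) (j := j) (by omega)).inv_left
  have b := s_comm n hij
  exact ((b.mul_right c1).mul_left (c2.mul_right (Commute.refl _))).eq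

theorem perfect {n : ℕ} (hn : 5 ≤ n) {G : Type*} [CommGroup G] (f : K n →* G) :
    ∀ x, f x = 1 := by
  have b := congrArg f (c_braid (n := n) (by omega) (i := 2) (by omega) (by omega))
  simp only [map_mul] at b
  have e := braid_eq_of_comm b (mul_comm _ _)
  refine kill_adj hn f (k := 2) (l := 0) (by omega) (by omega) (by omega) ?_
  have : d (n := n) (by omega) 2 (2+1) (by omega) (by omega) =
      d (n := n) (by omega) 2 0 (by omega) (by omega) *
      (d (n := n) (by omega) (2+1) 0 (by omega) (by omega))⁻¹ := by
    apply Subtype.ext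
    simp [d]
  rw [this, map_mul, map_inv, e, mul_inv_cancel]

theorem perfect_top {n : ℕ} (hn : 5 ≤ n) : commutator (K n) = ⊤ := by
  rw [eq_top_iff, ← Abelianization.ker_of]
  intro x _
  exact perfect hn _ x


/-! ### Finite checks -/

def all5 (k : ℕ → Bool) : Bool := k 0 && (k 1 && (k 2 && (k 3 && k 4)))
def all6 (k : ℕ → Bool) : Bool := k 0 && (k 1 && (k 2 && (k 3 && (k 4 && k 5))))

theorem all5_spec {k : ℕ → Bool} (h : all5 k = true) (i : Fin 5) : k i = true := by
  simp only [all5, Bool.and_eq_true] at h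
  obtain ⟨h0, h1, h2, h3, h4⟩ := h
  fin_cases i <;> assumption

theorem all6_spec {k : ℕ → Bool} (h : all6 k = true) (i : Fin 6) : k i = true := by
  simp only [all6, Bool.and_eq_true] at h
  obtain ⟨h0, h1, h2, h3, h4, h5⟩ := h
  fin_cases i <;> assumption

/-- apply a list as a function -/
def ap (l : List ℕ) (i : ℕ) : ℕ := l.getD i 0
def cmpL (x y : List ℕ) : List ℕ := y.map (ap x)
def eqL : List ℕ → List ℕ → Bool
  | [], [] => true
  | a :: l, b :: m => a.beq b && eqL l m
  | _, _ => false
def fresh (a : ℕ) : List ℕ → Bool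
  | [] => true
  | b :: l => !(a.beq b) && fresh a l
def fixAux (k : ℕ) : List ℕ → ℕ
  | [] => 0
  | a :: l => bif a.beq k then (fixAux (k + 1) l).succ else fixAux (k + 1) l
def fixN (l : List ℕ) : ℕ := fixAux 0 l

theorem eqL_iff (l m : List ℕ) : eqL l m = true ↔ l = m := by
  induction l generalizing m with
  | nil => cases m <;> simp [eqL]
  | cons a l ih => cases m <;> simp [eqL, ih]

theorem fresh_iff (a : ℕ) (l : List ℕ) : fresh a l = true ↔ a ∉ l := by
  induction l with
  | nil => simp [fresh]
  | cons b l ih =>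
    have : (a.beq b = false) ↔ ¬ a = b := by
      rw [← Nat.beq_eq, Bool.not_eq_true]
    simp [fresh, ih, this]

def id6 : List ℕ := [0, 1, 2, 3, 4, 5]
def id5 : List ℕ := [0, 1, 2, 3, 4]

def powChk (x y : List ℕ) : Bool :=
  eqL y id6 || (eqL y x || (let x2 := cmpL x x; eqL y x2 || (let x3 := cmpL x x2; eqL y x3 ||
    (let x4 := cmpL x x3; eqL y x4 || eqL y (cmpL x x4)))))

def leafC (x y : List ℕ) : Bool :=
  !(eqL (cmpL x y) (cmpL y x)) || (!((fixN x).beq (fixN y)) || (!((fixN x).beq (fixN (cmpL x y))) ||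
    (!((fixN (cmpL x (cmpL x x))).beq (fixN (cmpL y (cmpL y y)))) || powChk x y)))

def chkC : Bool :=
  all6 fun x2 => !(fresh x2 [1, 2]) || all6 fun x3 => !(fresh x3 [1, 2, x2]) ||
  all6 fun x4 => !(fresh x4 [1, 2, x2, x3]) || all6 fun x5 => !(fresh x5 [1, 2, x2, x3, x4]) ||
  all6 fun y0 => all6 fun y1 => !(y1.beq (ap [1, 2, x2, x3, x4, x5] y0)) ||
  all6 fun y2 => !(y2.beq (ap [1, 2, x2, x3, x4, x5] y1)) ||
  all6 fun y3 => !(fresh y3 [y0, y1, y2]) || all6 fun y4 => !(fresh y4 [y0, y1, y2, y3]) ||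
  all6 fun y5 => !(fresh y5 [y0, y1, y2, y3, y4]) ||
    leafC [1, 2, x2, x3, x4, x5] [y0, y1, y2, y3, y4, y5]

theorem chkC_true : chkC = true := by decide +kernel

def chkD6 : Bool :=
  all6 fun x3 => !(fresh x3 [1, 2, 0]) ||
  all6 fun x4 => !(fresh x4 [1, 2, 0, x3]) || all6 fun x5 => !(fresh x5 [1, 2, 0, x3, x4]) ||
  !(eqL (cmpL [1, 2, 0, x3, x4, x5] (cmpL [1, 2, 0, x3, x4, x5] [1, 2, 0, x3, x4, x5])) id6) ||
  all6 fun y0 => all6 fun y1 => !(y1.beq (ap [1, 2, 0, x3, x4, x5] y0)) ||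
  all6 fun y2 => !(y2.beq (ap [1, 2, 0, x3, x4, x5] y1)) ||
  all6 fun y3 => !(fresh y3 [y0, y1, y2]) || all6 fun y4 => !(fresh y4 [y0, y1, y2, y3]) ||
  all6 fun y5 => !(fresh y5 [y0, y1, y2, y3, y4]) ||
    (!(eqL (cmpL [1, 2, 0, x3, x4, x5] [y0, y1, y2, y3, y4, y5])
        (cmpL [y0, y1, y2, y3, y4, y5] [1, 2, 0, x3, x4, x5])) ||
     (!(eqL (cmpL [y0, y1, y2, y3, y4, y5] [y0, y1, y2, y3, y4, y5]) id6) ||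
      !((fixN [y0, y1, y2, y3, y4, y5]).beq 2)))

theorem chkD6_true : chkD6 = true := by decide +kernel

/-- quantify over involutions of five points -/
def allInv5 (k : List ℕ → Bool) : Bool :=
  all5 fun x0 => all5 fun x1 => !(fresh x1 [x0]) || all5 fun x2 => !(fresh x2 [x0, x1]) ||
  all5 fun x3 => !(fresh x3 [x0, x1, x2]) || all5 fun x4 => !(fresh x4 [x0, x1, x2, x3]) ||
  !(eqL (cmpL [x0, x1, x2, x3, x4] [x0, x1, x2, x3, x4]) id5) || k [x0, x1, x2, x3, x4]

def chkD5 : Bool :=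
  allInv5 fun u => !((fixN u).beq 1) ||
  allInv5 fun w => !(eqL (cmpL u w) (cmpL w u)) || (eqL u w ||
  allInv5 fun v => !(eqL (cmpL u (cmpL v u)) (cmpL v (cmpL u v))) ||
    !(eqL (cmpL w (cmpL v w)) (cmpL v (cmpL w v))))

theorem chkD5_true : chkD5 = true := by decide +kernel


def enc {N : ℕ} (p : Equiv.Perm (Fin N)) : List ℕ := List.ofFn (fun i => (p i : ℕ))

theorem ap_enc {N : ℕ} (p : Equiv.Perm (Fin N)) (i : Fin N) : ap (enc p) i = p i := by
  simp [ap, enc, List.getD]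

theorem enc_mul {N : ℕ} (p q : Equiv.Perm (Fin N)) : enc (p * q) = cmpL (enc p) (enc q) := by
  rw [cmpL, enc, show enc q = List.ofFn (fun i => (q i : ℕ)) from rfl, List.map_ofFn]
  congr 1
  funext i
  exact (ap_enc p (q i)).symm

theorem enc_inj {N : ℕ} {p q : Equiv.Perm (Fin N)} (h : enc p = enc q) : p = q := by
  ext i
  rw [← ap_enc, h, ap_enc]

theorem enc6 (p : Equiv.Perm (Fin 6)) :
    enc p = [(p 0 : ℕ), (p 1 : ℕ), (p 2 : ℕ), (p 3 : ℕ), (p 4 : ℕ), (p 5 : ℕ)] := by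
  simp [enc, List.ofFn_succ]

theorem enc5 (p : Equiv.Perm (Fin 5)) :
    enc p = [(p 0 : ℕ), (p 1 : ℕ), (p 2 : ℕ), (p 3 : ℕ), (p 4 : ℕ)] := by
  simp [enc, List.ofFn_succ]

theorem enc_one6 : enc (1 : Equiv.Perm (Fin 6)) = id6 := by rw [enc6]; rfl
theorem enc_one5 : enc (1 : Equiv.Perm (Fin 5)) = id5 := by rw [enc5]; rfl

theorem fixAux_cons (k a : ℕ) (l : List ℕ) :
    fixAux k (a :: l) = (if a = k then 1 else 0) + fixAux (k + 1) l := by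
  rw [fixAux]
  by_cases h : a = k
  · subst h; simp [Nat.add_comm]
  · have : a.beq k = false := by rw [← Bool.not_eq_true, Nat.beq_eq]; exact h
    simp [this, h]

theorem fix6 (p : Equiv.Perm (Fin 6)) : fixN (enc p) + p.support.card = 6 := by
  have h1 : fixN (enc p) = (Finset.univ.filter fun i => p i = i).card := by
    rw [Finset.card_filter, Fin.sum_univ_six, enc6, fixN]
    simp only [fixAux_cons, Fin.ext_iff]
    simp [fixAux, add_assoc]
  have h2 : p.support = Finset.univ.filter fun i => ¬ p i = i := by ext; simp
  rw [h1, h2, Finset.card_filter_add_card_filter_not]; rfl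

theorem fix5 (p : Equiv.Perm (Fin 5)) : fixN (enc p) + p.support.card = 5 := by
  have h1 : fixN (enc p) = (Finset.univ.filter fun i => p i = i).card := by
    rw [Finset.card_filter, Fin.sum_univ_five, enc5, fixN]
    simp only [fixAux_cons, Fin.ext_iff]
    simp [fixAux, add_assoc]
  have h2 : p.support = Finset.univ.filter fun i => ¬ p i = i := by ext; simp
  rw [h1, h2, Finset.card_filter_add_card_filter_not]; rfl

theorem or_res {a b : Bool} (h : (!a || b) = true) (ha : a = true) : b = true := by
  subst ha; simpa using h

theorem fr {N : ℕ} (p : Equiv.Perm (Fin N)) (i : Fin N) (l : List (Fin N)) (hi : i ∉ l) :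
    fresh (p i : ℕ) (l.map fun j => (p j : ℕ)) = true := by
  rw [fresh_iff]
  simp only [List.mem_map, not_exists, not_and]
  intro j hj e
  have := p.injective (Fin.ext e)
  exact hi (this ▸ hj)

theorem commC0 (x y : Equiv.Perm (Fin 6)) (h0 : x 0 = 1) (h1 : x 1 = 2) (hc : x * y = y * x)
    (f1 : x.support.card = y.support.card) (f2 : x.support.card = (x * y).support.card)
    (f3 : (x * (x * x)).support.card = (y * (y * y)).support.card) : ∃ k : ℕ, y = x ^ k := by
  have ex : enc x = [1, 2, (x 2 : ℕ), (x 3 : ℕ), (x 4 : ℕ), (x 5 : ℕ)] := by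
    rw [enc6, h0, h1]; rfl
  have ey := enc6 y
  have v0 : ((x 0 : Fin 6) : ℕ) = 1 := by rw [h0]; rfl
  have v1 : ((x 1 : Fin 6) : ℕ) = 2 := by rw [h1]; rfl
  have y1 : y 1 = x (y 0) := by
    have := congrArg (fun g => g 0) hc
    simp only [Equiv.Perm.mul_apply, h0] at this
    exact this.symm
  have y2 : y 2 = x (y 1) := by
    have := congrArg (fun g => g 1) hc
    simp only [Equiv.Perm.mul_apply, h1] at this
    exact this.symm
  have h := chkC_true
  unfold chkC at h
  replace h := or_res (all6_spec h (x 2)) (by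
    have := fr x 2 [0, 1] (by decide); simpa only [List.map, v0, v1] using this)
  replace h := or_res (all6_spec h (x 3)) (by
    have := fr x 3 [0, 1, 2] (by decide); simpa only [List.map, v0, v1] using this)
  replace h := or_res (all6_spec h (x 4)) (by
    have := fr x 4 [0, 1, 2, 3] (by decide); simpa only [List.map, v0, v1] using this)
  replace h := or_res (all6_spec h (x 5)) (by
    have := fr x 5 [0, 1, 2, 3, 4] (by decide); simpa only [List.map, v0, v1] using this)
  rw [← ex] at h
  replace h := or_res (all6_spec (all6_spec h (y 0)) (y 1)) (by
    rw [Nat.beq_eq, ap_enc, y1])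
  replace h := or_res (all6_spec h (y 2)) (by
    rw [Nat.beq_eq, ap_enc, y2])
  replace h := or_res (all6_spec h (y 3)) (fr y 3 [0, 1, 2] (by decide))
  replace h := or_res (all6_spec h (y 4)) (fr y 4 [0, 1, 2, 3] (by decide))
  replace h := or_res (all6_spec h (y 5)) (fr y 5 [0, 1, 2, 3, 4] (by decide))
  rw [← ey] at h
  unfold leafC at h
  simp only [← enc_mul] at h
  replace h := or_res h (by rw [eqL_iff, hc])
  have g1 := fix6 x
  have g2 := fix6 y
  have g3 := fix6 (x * y)
  have g4 := fix6 (x * (x * x))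
  have g5 := fix6 (y * (y * y))
  replace h := or_res h (by rw [Nat.beq_eq]; omega)
  replace h := or_res h (by rw [Nat.beq_eq]; omega)
  replace h := or_res h (by rw [Nat.beq_eq]; omega)
  simp only [powChk, ← enc_mul, ← enc_one6, Bool.or_eq_true, eqL_iff] at h
  rcases h with h | h | h | h | h | h
  · exact ⟨0, by rw [enc_inj h]; simp⟩
  · exact ⟨1, by rw [enc_inj h]; simp⟩
  · exact ⟨2, by rw [enc_inj h]; simp only [pow_succ, pow_zero, one_mul, mul_assoc]⟩
  · exact ⟨3, by rw [enc_inj h]; simp only [pow_succ, pow_zero, one_mul, mul_assoc]⟩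
  · exact ⟨4, by rw [enc_inj h]; simp only [pow_succ, pow_zero, one_mul, mul_assoc]⟩
  · exact ⟨5, by rw [enc_inj h]; simp only [pow_succ, pow_zero, one_mul, mul_assoc]⟩

theorem exists_perm_to : ∀ a b c : Fin 6, a ≠ b → a ≠ c → b ≠ c →
    ∃ g : Equiv.Perm (Fin 6), g 0 = a ∧ g 1 = b ∧ g 2 = c := by
  intro a b c hab hac hbc
  refine ⟨Equiv.swap 0 a * (Equiv.swap 1 (Equiv.swap 0 a b) * Equiv.swap 2
    (Equiv.swap 1 (Equiv.swap 0 a b) (Equiv.swap 0 a c))), ?_⟩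
  revert a b c
  decide +kernel

theorem commC (x y : Equiv.Perm (Fin 6)) (hx : x * x ≠ 1) (hc : x * y = y * x)
    (f1 : x.support.card = y.support.card) (f2 : x.support.card = (x * y).support.card)
    (f3 : (x * (x * x)).support.card = (y * (y * y)).support.card) : ∃ k : ℕ, y = x ^ k := by
  obtain ⟨a, ha⟩ : ∃ a, x (x a) ≠ a := by
    by_contra! h
    exact hx (Equiv.ext h)
  have hb : x a ≠ a := fun h => ha (by rw [h, h])
  obtain ⟨g, g0, g1, g2⟩ := exists_perm_to a (x a) (x (x a)) hb.symm ha.symm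
    (fun h => hb (x.injective h.symm))
  have key : ∀ p q : Equiv.Perm (Fin 6), (g⁻¹ * p * g) * (g⁻¹ * q * g) = g⁻¹ * (p * q) * g := by
    intro p q; group
  have sc : ∀ p : Equiv.Perm (Fin 6), (g⁻¹ * p * g).support.card = p.support.card := by
    intro p
    have := Equiv.Perm.card_support_conj (σ := g⁻¹) (τ := p)
    rwa [inv_inv] at this
  obtain ⟨k, hk⟩ := commC0 (g⁻¹ * x * g) (g⁻¹ * y * g)
    (by simp [g0, ← g1]) (by simp [g1, ← g2])
    (by rw [key, key, hc]) (by rw [sc, sc, f1]) (by rw [key, sc, sc, f2])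
    (by rw [key, key, key, key, sc, sc, f3])
  refine ⟨k, ?_⟩
  have : (g⁻¹ * x * g) ^ k = g⁻¹ * x ^ k * g := by
    have := conj_pow (i := k) (a := g⁻¹) (b := x)
    rwa [inv_inv] at this
  rw [this] at hk
  exact mul_left_cancel (mul_right_cancel hk)

theorem even_inv {N : ℕ} (hN : N < 8) (z : Equiv.Perm (Fin N)) (h2 : z * z = 1) (h1 : z ≠ 1)
    (hs : Equiv.Perm.sign z = 1) : z.support.card = 4 := by
  have ho : orderOf z = 2 := orderOf_eq_prime (by rw [pow_two, h2]) h1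
  obtain ⟨n, hn⟩ := Equiv.Perm.cycleType_prime_order (σ := z) (by rw [ho]; exact Nat.prime_two)
  rw [ho] at hn
  have hc := Equiv.Perm.sum_cycleType z
  have hle := Finset.card_le_univ z.support
  rw [Equiv.Perm.sign_of_cycleType, hn] at hs
  rw [hn] at hc
  simp only [Multiset.sum_replicate, smul_eq_mul, Multiset.card_replicate, Fintype.card_fin] at hc hs hle
  have : n < 3 := by omega
  interval_cases n
  · exact absurd hs (by decide)
  · omega
  · exact absurd hs (by decide)

theorem lemD6_0 (p z : Equiv.Perm (Fin 6)) (h0 : p 0 = 1) (h1 : p 1 = 2) (hp : p * (p * p) = 1)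
    (hz : z * z = 1) (hs : Equiv.Perm.sign z = 1) (hc : p * z = z * p) : z = 1 := by
  by_contra hz1
  have h2 : p 2 = 0 := by
    have := congrArg (fun g => g 0) hp
    simpa [h0, h1] using this
  have ex : enc p = [1, 2, 0, (p 3 : ℕ), (p 4 : ℕ), (p 5 : ℕ)] := by
    rw [enc6, h0, h1, h2]; rfl
  have ey := enc6 z
  have v0 : ((p 0 : Fin 6) : ℕ) = 1 := by rw [h0]; rfl
  have v1 : ((p 1 : Fin 6) : ℕ) = 2 := by rw [h1]; rfl
  have v2 : ((p 2 : Fin 6) : ℕ) = 0 := by rw [h2]; rfl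
  have y1 : z 1 = p (z 0) := by
    have := congrArg (fun g => g 0) hc
    simp only [Equiv.Perm.mul_apply, h0] at this
    exact this.symm
  have y2 : z 2 = p (z 1) := by
    have := congrArg (fun g => g 1) hc
    simp only [Equiv.Perm.mul_apply, h1] at this
    exact this.symm
  have h := chkD6_true
  unfold chkD6 at h
  replace h := or_res (all6_spec h (p 3)) (by
    have := fr p 3 [0, 1, 2] (by decide); simpa only [List.map, v0, v1, v2] using this)
  replace h := or_res (all6_spec h (p 4)) (by
    have := fr p 4 [0, 1, 2, 3] (by decide); simpa only [List.map, v0, v1, v2] using this)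
  replace h := (all6_spec h (p 5))
  rw [← ex, Bool.or_assoc] at h
  replace h := or_res h (by
    have := fr p 5 [0, 1, 2, 3, 4] (by decide); simpa only [List.map, v0, v1, v2] using this)
  replace h := or_res h (by rw [← enc_mul, ← enc_mul, ← enc_one6, eqL_iff, hp])
  replace h := or_res (all6_spec (all6_spec h (z 0)) (z 1)) (by
    rw [Nat.beq_eq, ap_enc, y1])
  replace h := or_res (all6_spec h (z 2)) (by
    rw [Nat.beq_eq, ap_enc, y2])
  replace h := or_res (all6_spec h (z 3)) (fr z 3 [0, 1, 2] (by decide))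
  replace h := or_res (all6_spec h (z 4)) (fr z 4 [0, 1, 2, 3] (by decide))
  replace h := or_res (all6_spec h (z 5)) (fr z 5 [0, 1, 2, 3, 4] (by decide))
  rw [← ey] at h
  simp only [← enc_mul] at h
  replace h := or_res h (by rw [eqL_iff, hc])
  replace h := or_res h (by rw [eqL_iff, hz, enc_one6])
  have g := fix6 z
  have g' := even_inv (by norm_num) z hz hz1 hs
  have : fixN (enc z) = 2 := by omega
  rw [this] at h
  exact absurd h (by decide)

theorem lemD6 (p z : Equiv.Perm (Fin 6)) (hp1 : p ≠ 1) (hp : p * (p * p) = 1)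
    (hz : z * z = 1) (hs : Equiv.Perm.sign z = 1) (hc : p * z = z * p) : z = 1 := by
  obtain ⟨a, hb⟩ : ∃ a, p a ≠ a := by
    by_contra! h
    exact hp1 (Equiv.ext h)
  have h3 : p (p (p a)) = a := by
    have := congrArg (fun g => g a) hp
    simpa using this
  have ha : p (p a) ≠ a := fun h => hb (by rw [h] at h3; exact h3)
  obtain ⟨g, g0, g1, g2⟩ := exists_perm_to a (p a) (p (p a)) hb.symm ha.symm
    (fun h => hb (p.injective h.symm))
  have key : ∀ p q : Equiv.Perm (Fin 6), (g⁻¹ * p * g) * (g⁻¹ * q * g) = g⁻¹ * (p * q) * g := by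
    intro p q; group
  have := lemD6_0 (g⁻¹ * p * g) (g⁻¹ * z * g)
    (by simp [g0, ← g1]) (by simp [g1, ← g2])
    (by rw [key, key, hp]; group) (by rw [key, hz]; group)
    (by rw [map_mul, map_mul, hs, map_inv]; simp) (by rw [key, key, hc])
  have e : z = g * (g⁻¹ * z * g) * g⁻¹ := by group
  rw [e, this]; group

theorem allInv5_spec {k : List ℕ → Bool} (h : allInv5 k = true) (p : Equiv.Perm (Fin 5))
    (hp : p * p = 1) : k (enc p) = true := by
  unfold allInv5 at h
  replace h := (all5_spec h (p 0))
  replace h := or_res (all5_spec h (p 1)) (fr p 1 [0] (by decide))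
  replace h := or_res (all5_spec h (p 2)) (fr p 2 [0, 1] (by decide))
  replace h := or_res (all5_spec h (p 3)) (fr p 3 [0, 1, 2] (by decide))
  replace h := all5_spec h (p 4)
  rw [← enc5, Bool.or_assoc] at h
  replace h := or_res h (fr p 4 [0, 1, 2, 3] (by decide))
  exact or_res h (by rw [← enc_mul, hp, enc_one5, eqL_iff])

theorem lemD5 (u v w : Equiv.Perm (Fin 5)) (hu : u * u = 1) (hv : v * v = 1) (hw : w * w = 1)
    (hs : Equiv.Perm.sign u = 1) (hc : u * w = w * u) (b1 : u * (v * u) = v * (u * v))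
    (b2 : w * (v * w) = v * (w * v)) : u = 1 ∨ u = w := by
  by_cases hu1 : u = 1
  · exact Or.inl hu1
  right
  have g := fix5 u
  have g' := even_inv (by norm_num) u hu hu1 hs
  have h := chkD5_true
  unfold chkD5 at h
  replace h := or_res (allInv5_spec h u hu) (by rw [Nat.beq_eq]; omega)
  replace h := or_res (allInv5_spec h w hw) (by rw [← enc_mul, ← enc_mul, hc, eqL_iff])
  rw [Bool.or_eq_true] at h
  rcases h with h | h
  · exact enc_inj ((eqL_iff _ _).1 h)
  · replace h := or_res (allInv5_spec h v hv) (by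
      simp only [← enc_mul]; rw [b1, eqL_iff])
    simp only [← enc_mul] at h
    rw [b2] at h
    have : eqL (enc (v * (w * v))) (enc (v * (w * v))) = true := by rw [eqL_iff]
    rw [this] at h
    exact absurd h (by decide)


/-! ### Small cases -/

theorem kill_j0 {n : ℕ} (hn : 5 ≤ n) {G : Type*} [Group G] (f : K n →* G) {j : ℕ} (h3 : 3 ≤ j)
    (hj : j + 1 < n) (hf : f (d (by omega) j 0 hj (by omega)) = 1) : ∀ x, f x = 1 := by
  refine kill (by omega) f _ (i := 0) (by omega) ?_ hf ?_
  · exact (s_comm n (by omega)).mul_right (Commute.refl _).inv_right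
  · intro Q _ π h
    have h' : π (s n j) = π (s n 0) := by simpa [d, mul_inv_eq_one] using h
    refine ⟨0, by omega, ?_⟩
    refine braid_eq_of_comm (by simpa using congrArg π (s_braid n (i := 0) (by omega))) ?_
    rw [← h']
    simpa using congrArg π (s_comm n (i := 1) (j := j) (by omega)).symm.eq

theorem kill_24 {n : ℕ} (hn : 6 ≤ n) {G : Type*} [Group G] (f : K n →* G)
    (hf : f (d (by omega) 2 4 (by omega) (by omega)) = 1) : ∀ x, f x = 1 := by
  refine kill (by omega) f _ (i := 0) (by omega) ?_ hf ?_
  · exact (s_comm n (by omega)).mul_right (s_comm n (by omega)).inv_right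
  · intro Q _ π h
    have h' : π (s n 2) = π (s n 4) := by simpa [d, mul_inv_eq_one] using h
    refine ⟨1, by omega, ?_⟩
    refine braid_eq_of_comm (by simpa using congrArg π (s_braid n (i := 1) (by omega))) ?_
    rw [show 1 + 1 = 2 from rfl, h']
    simpa using congrArg π (s_comm n (i := 1) (j := 4) (by omega)).eq

theorem swap_aux {G : Type*} [Group G] {a b c : G} (h1 : a * b * a = b * a * b)
    (h2 : b * c * b = c * b * c) (h3 : a * c = c * a) :
    (b * a * c * b) * a = c * (b * a * c * b) ∧ (b * a * c * b) * c = a * (b * a * c * b) := by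
  constructor
  · calc (b * a * c * b) * a = b * (a * c) * (b * a) := by group
      _ = b * c * (a * b * a) := by rw [h3]; group
      _ = (b * c * b) * (a * b) := by rw [h1]; group
      _ = c * b * (c * a) * b := by rw [h2]; group
      _ = c * (b * a * c * b) := by rw [← h3]; group
  · calc (b * a * c * b) * c = b * a * (c * b * c) := by group
      _ = (b * a * b) * (c * b) := by rw [← h2]; group
      _ = a * (b * a * c * b) := by rw [← h1]; group

theorem swapK {n : ℕ} (hn : 6 ≤ n) {i l : ℕ} (hi : i + 3 < n) (hl : l + 1 < n)
    (hil : i + 4 ≤ l ∨ l + 2 ≤ i) : ∃ k : K n, (k : BraidGroup n) * s n i * (k : BraidGroup n)⁻¹ = s n (i + 2) ∧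
      (k : BraidGroup n) * s n (i + 2) * (k : BraidGroup n)⁻¹ = s n i ∧
      (k : BraidGroup n) * s n l * (k : BraidGroup n)⁻¹ = s n l := by
  obtain ⟨g1, g2⟩ := swap_aux (s_braid n (i := i) (by omega)) (s_braid n (i := i + 1) (by omega))
    (s_comm n (i := i) (j := i + 2) (by omega)).eq
  have cm : ∀ t, t ≤ 2 → Commute (s n (i + t)) (s n l) := by
    intro t ht
    rcases hil with h | h
    · exact s_comm n (by omega)
    · exact (s_comm n (by omega)).symm
  have g3 := (((cm 1 (by omega)).mul_left (cm 0 (by omega))).mul_left (cm 2 (by omega))).mul_left (cm 1 (by omega))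
  change Commute (s n (i+1) * s n i * s n (i + 2) * s n (i+1)) (s n l) at g3
  change (s n (i+1) * s n i * s n (i + 2) * s n (i+1)) * _ = _ * (s n (i+1) * s n i * s n (i + 2) * s n (i+1)) at g1
  change (s n (i+1) * s n i * s n (i + 2) * s n (i+1)) * _ = _ * (s n (i+1) * s n i * s n (i + 2) * s n (i+1)) at g2
  set g := s n (i+1) * s n i * s n (i + 2) * s n (i+1)
  obtain ⟨j, hj⟩ := exists_adjust (n := n) (by omega) hl g
  have e0 := ((cm 0 (by omega)).zpow_right j).symm.eq
  have e2 := ((cm 2 (by omega)).zpow_right j).symm.eq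
  have el := ((Commute.refl (s n l)).zpow_right j).symm.eq
  change s n l ^ j * s n i = s n i * s n l ^ j at e0
  refine ⟨⟨g * s n l ^ j, hj⟩, ?_, ?_, ?_⟩
  · rw [mul_inv_eq_iff_eq_mul]
    change g * s n l ^ j * s n i = s n (i+2) * (g * s n l ^ j)
    rw [mul_assoc, e0, ← mul_assoc, g1, mul_assoc]
  · rw [mul_inv_eq_iff_eq_mul]
    change g * s n l ^ j * s n (i+2) = s n i * (g * s n l ^ j)
    rw [mul_assoc, e2, ← mul_assoc, g2, mul_assoc]
  · rw [mul_inv_eq_iff_eq_mul]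
    change g * s n l ^ j * s n l = s n l * (g * s n l ^ j)
    rw [mul_assoc, el, ← mul_assoc, g3.eq, mul_assoc]

theorem d_conj {n : ℕ} (hn : 2 < n) (k : K n) {i j i' j' : ℕ} (hi : i + 1 < n) (hj : j + 1 < n)
    (hi' : i' + 1 < n) (hj' : j' + 1 < n)
    (h1 : (k : BraidGroup n) * s n i * (k : BraidGroup n)⁻¹ = s n i')
    (h2 : (k : BraidGroup n) * s n j * (k : BraidGroup n)⁻¹ = s n j') :
    k * d hn i j hi hj * k⁻¹ = d hn i' j' hi' hj' := by
  apply Subtype.ext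
  change (k : BraidGroup n) * (s n i * (s n j)⁻¹) * (k : BraidGroup n)⁻¹ = s n i' * (s n j')⁻¹
  rw [← h1, ← h2]; group

theorem d_inv {n : ℕ} (hn : 2 < n) {i j : ℕ} (hi : i + 1 < n) (hj : j + 1 < n) :
    d hn i j hi hj = (d hn j i hj hi)⁻¹ := by
  apply Subtype.ext
  simp [d]

theorem d_mul {n : ℕ} (hn : 2 < n) {i j k : ℕ} (hi : i + 1 < n) (hj : j + 1 < n) (hk : k + 1 < n) :
    d hn i j hi hj * d hn j k hj hk = d hn i k hi hk := by
  apply Subtype.ext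
  simp [d]

theorem cube_aux {G : Type*} [Group G] {u v : G} (h3 : u * u * u = 1)
    (h1 : u * v * u = v * u * v) (h2 : (u * u) * v * (u * u) = v * (u * u) * v) : u = 1 := by
  have e1 : v * (u * (v * v * u)) = v * (u * (u * v)) := by
    calc v * (u * (v * v * u)) = (v * u * v) * (v * u) := by group
      _ = (u * v * u) * (v * u) := by rw [← h1]
      _ = u * (v * u * v) * u := by group
      _ = u * (u * v * u) * u := by rw [← h1]
      _ = (u * u) * v * (u * u) := by group
      _ = v * (u * (u * v)) := by rw [h2]; group
  have e2 : v * v * u = u * v := mul_left_cancel (mul_left_cancel e1)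
  have e3 : v = (u * v) * u * (u * v)⁻¹ := by
    rw [h1]; group
  have v3 : v * v * v = 1 := by
    have : v * v * v = (u * v) * (u * u * u) * (u * v)⁻¹ := by
      calc v * v * v = ((u * v) * u * (u * v)⁻¹) * ((u * v) * u * (u * v)⁻¹) * ((u * v) * u * (u * v)⁻¹) := by
            rw [← e3]
        _ = _ := by group
    rw [this, h3]; group
  have e4 : u * v * u⁻¹ = v * v := by rw [← e2]; group
  have e5 : u * (v * v) * u⁻¹ = v := by
    calc u * (v * v) * u⁻¹ = (u * v * u⁻¹) * (u * v * u⁻¹) := by group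
      _ = (v * v * v) * v := by rw [e4]; group
      _ = v := by rw [v3, one_mul]
  have e6 : u * (u * (u * v * u⁻¹) * u⁻¹) * u⁻¹ = v := by
    calc u * (u * (u * v * u⁻¹) * u⁻¹) * u⁻¹ = (u * u * u) * v * (u * u * u)⁻¹ := by group
      _ = v := by rw [h3]; group
  rw [e4, e5, e4] at e6
  have v1 : v = 1 := by simpa using e6
  subst v1
  simpa using h1

theorem step67 {n : ℕ} (hn : 6 ≤ n) (f : K n →* Equiv.Perm (Fin 6)) :
    (∀ x, f x = 1) ∨ f (d (by omega) 2 0 (by omega) (by omega)) *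
      f (d (by omega) 2 0 (by omega) (by omega)) = 1 := by
  have hn2 : 2 < n := by omega
  obtain ⟨k, k1, k2, k3⟩ := swapK hn (i := 0) (l := 4) (by omega) (by omega) (by omega)
  obtain ⟨k', k1', k2', k3'⟩ := swapK hn (i := 2) (l := 0) (by omega) (by omega) (by omega)
  have a1 := congrArg f (d_conj hn2 k (i := 0) (j := 2) (by omega) (by omega) (by omega) (by omega) k1 k2)
  have a2 := congrArg f (d_conj hn2 k (i := 2) (j := 4) (by omega) (by omega) (by omega) (by omega) k2 k3)
  have b1 := congrArg f (d_conj hn2 k' (i := 0) (j := 2) (by omega) (by omega) (by omega) (by omega) k3' k1')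
  have b2 := congrArg f (d_conj hn2 k' (i := 2) (j := 4) (by omega) (by omega) (by omega) (by omega) k1' k2')
  simp only [map_mul, map_inv, zero_add, Nat.reduceAdd] at a1 a2 b1 b2
  have hxy := congrArg f (d_mul hn2 (i := 0) (j := 2) (k := 4) (by omega) (by omega) (by omega))
  rw [map_mul] at hxy
  have hcm : Commute (d hn2 0 2 (by omega) (by omega)) (d hn2 2 4 (by omega) (by omega)) := by
    apply Subtype.ext
    have c1 := s_comm n (i := 0) (j := 2) (by omega)
    have c2 := s_comm n (i := 0) (j := 4) (by omega)
    have c3 := s_comm n (i := 2) (j := 4) (by omega)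
    exact ((c1.mul_right c2.inv_right).mul_left
      ((Commute.refl _).mul_right c3.inv_right).inv_left).eq
  have hc := (hcm.map f).eq
  have hu : f (d hn2 2 0 (by omega) (by omega)) = (f (d hn2 0 2 (by omega) (by omega)))⁻¹ := by
    rw [d_inv, map_inv]
  have hw : f (d hn2 4 0 (by omega) (by omega)) = (f (d hn2 0 4 (by omega) (by omega)))⁻¹ := by
    rw [d_inv, map_inv]
  have hy' : f (d hn2 4 2 (by omega) (by omega)) = (f (d hn2 2 4 (by omega) (by omega)))⁻¹ := by
    rw [d_inv, map_inv]
  have br1 := congrArg f (c_braid hn2 (i := 2) (by omega) (by omega))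
  have br2 := congrArg f (c_braid hn2 (i := 3) (by omega) (by omega))
  simp only [map_mul, Nat.reduceAdd] at br1 br2
  have kl := kill_20 (n := n) (by omega) f
  rw [hw] at br2
  rw [hu] at br1 kl a1
  rw [hu]
  rw [hy'] at b2
  rw [← hxy] at a2 b1 br2
  set x := f (d hn2 0 2 (by omega) (by omega))
  set y := f (d hn2 2 4 (by omega) (by omega))
  set t := f k
  set t' := f k'
  set v := f (d hn2 3 0 (by omega) (by omega))
  by_cases hx : x * x = 1
  · right
    rw [← mul_inv_rev, hx, inv_one]
  left
  have sx : x.support.card = (x * y).support.card := by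
    rw [← b1]; exact Equiv.Perm.card_support_conj.symm
  have sy : y.support.card = (x * y).support.card := by
    rw [← a2]; exact Equiv.Perm.card_support_conj.symm
  have sx3 : (x * (x * x)).support.card = ((x * y) * ((x * y) * (x * y))).support.card := by
    rw [← b1, show (t' * x * t'⁻¹) * ((t' * x * t'⁻¹) * (t' * x * t'⁻¹)) = t' * (x * (x * x)) * t'⁻¹ by group]
    exact Equiv.Perm.card_support_conj.symm
  have sy3 : (y * (y * y)).support.card = ((x * y) * ((x * y) * (x * y))).support.card := by
    rw [← a2, show (t * y * t⁻¹) * ((t * y * t⁻¹) * (t * y * t⁻¹)) = t * (y * (y * y)) * t⁻¹ by group]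
    exact Equiv.Perm.card_support_conj.symm
  obtain ⟨m, hm⟩ := commC x y hx hc (sx.trans sy.symm) sx (sx3.trans sy3.symm)
  have e1 : x * y = y⁻¹ := by
    rw [← a2]
    conv_lhs => rw [hm]
    rw [← conj_pow, a1, inv_pow, ← hm]
  have e2 : x = y := by
    have h := congrArg (fun z => t' * z * t'⁻¹) e1
    have l : t' * (x * y) * t'⁻¹ = x := by
      rw [show t' * (x * y) * t'⁻¹ = (t' * x * t'⁻¹) * (t' * y * t'⁻¹) by group, b1, b2]; group
    have r : t' * y⁻¹ * t'⁻¹ = y := by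
      rw [show t' * y⁻¹ * t'⁻¹ = (t' * y * t'⁻¹)⁻¹ by group, b2, inv_inv]
    rw [l, r] at h
    exact h
  rw [← e2] at e1 br2
  have x3 : x * x * x = 1 := by rw [e1]; group
  rw [e1, inv_inv] at br2
  have uu : x⁻¹ * x⁻¹ = x := by rw [← mul_inv_rev, e1, inv_inv]
  apply kl
  refine cube_aux (v := v) ?_ br1 ?_
  · rw [uu]; group
  · rw [uu]; exact br2.symm

theorem c_sq {n : ℕ} (hn : 6 ≤ n) {G : Type*} [Group G] (f : K n →* G)
    (h : f (d (by omega) 2 0 (by omega) (by omega)) *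
      f (d (by omega) 2 0 (by omega) (by omega)) = 1) (i : ℕ) (hi : 2 ≤ i) (hin : i + 1 < n) :
    f (d (by omega) i 0 (by omega) (by omega)) *
      f (d (by omega) i 0 (by omega) (by omega)) = 1 := by
  induction i, hi using Nat.le_induction with
  | base => exact h
  | succ i hi ih =>
    have e := ih (by omega)
    have b := congrArg f (c_braid (n := n) (by omega) hi (by omega))
    simp only [map_mul] at b
    set u := f (d (by omega) i 0 (by omega) (by omega))
    set v := f (d (by omega) (i+1) 0 (by omega) (by omega))
    have ev : v = (u * v) * u * (u * v)⁻¹ := by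
      rw [b]; group
    rw [ev, show (u * v) * u * (u * v)⁻¹ * ((u * v) * u * (u * v)⁻¹) = (u * v) * (u * u) * (u * v)⁻¹ by group, e]
    group

theorem sign_one {n : ℕ} (hn : 5 ≤ n) {X : Type*} [Fintype X] [DecidableEq X]
    (f : K n →* Equiv.Perm X) (x : K n) : Equiv.Perm.sign (f x) = 1 :=
  perfect hn (Equiv.Perm.sign.comp f) x

theorem case7 (f : K 7 →* Equiv.Perm (Fin 6)) : ∀ x, f x = 1 := by
  rcases step67 (by norm_num) f with h | h
  · exact h
  have sq := c_sq (by norm_num) f h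
  have u2 := sq 2 (by norm_num) (by norm_num)
  have v2 := sq 3 (by norm_num) (by norm_num)
  have z2 := sq 5 (by norm_num) (by norm_num)
  have b := congrArg f (c_braid (n := 7) (by norm_num) (i := 2) (by norm_num) (by norm_num))
  simp only [map_mul, Nat.reduceAdd] at b
  have c1 := ((c_comm (n := 7) (by norm_num) (i := 2) (j := 5) (by norm_num) (by norm_num) (by norm_num)).map f)
  have c2 := ((c_comm (n := 7) (by norm_num) (i := 3) (j := 5) (by norm_num) (by norm_num) (by norm_num)).map f)
  have hs := sign_one (n := 7) (by norm_num) f (d (by norm_num) 5 0 (by norm_num) (by norm_num))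
  have k1 := kill_j0 (n := 7) (by norm_num) f (j := 5) (by norm_num) (by norm_num)
  have k2 := kill_adj (n := 7) (by norm_num) f (k := 2) (l := 0) (by norm_num) (by norm_num) (by norm_num)
  rw [← d_mul (j := 0) (hj := by norm_num), map_mul, d_inv (i := 0), map_inv] at k2
  simp only [Nat.reduceAdd] at k2
  set u := f (d (n := 7) (by norm_num) 2 0 (by norm_num) (by norm_num))
  set v := f (d (n := 7) (by norm_num) 3 0 (by norm_num) (by norm_num))
  set z := f (d (n := 7) (by norm_num) 5 0 (by norm_num) (by norm_num))
  by_cases hp : u * v = 1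
  · apply k2
    have : u = v := by
      rw [← mul_left_inj v, hp, v2]
    rw [this]; simp
  · apply k1
    refine lemD6 (u * v) z hp ?_ z2 hs (c1.mul_left c2).eq
    calc u * v * (u * v * (u * v)) = (u * v * u) * (v * u * v) := by group
      _ = u * v * (u * u) * v * u := by rw [← b]; group
      _ = 1 := by rw [u2, mul_one, mul_assoc u v v, v2, mul_one, u2]

theorem case6 (f : K 6 →* Equiv.Perm (Fin 5)) : ∀ x, f x = 1 := by
  let ι : Fin 5 ↪ Fin 6 := Fin.castSuccEmb
  have hι := Equiv.Perm.viaEmbeddingHom_injective ι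
  have h : f (d (by norm_num) 2 0 (by norm_num) (by norm_num)) *
      f (d (by norm_num) 2 0 (by norm_num) (by norm_num)) = 1 := by
    rcases step67 (by norm_num) ((Equiv.Perm.viaEmbeddingHom ι).comp f) with h | h
    · have : f (d (n := 6) (by norm_num) 2 0 (by norm_num) (by norm_num)) = 1 := by
        apply hι
        rw [map_one]; exact h _
      rw [this, one_mul]
    · apply hι
      rw [map_one, map_mul]; exact h
  have sq := c_sq (by norm_num) f h
  have u2 := sq 2 (by norm_num) (by norm_num)
  have v2 := sq 3 (by norm_num) (by norm_num)
  have w2 := sq 4 (by norm_num) (by norm_num)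
  have b := congrArg f (c_braid (n := 6) (by norm_num) (i := 2) (by norm_num) (by norm_num))
  have b' := congrArg f (c_braid (n := 6) (by norm_num) (i := 3) (by norm_num) (by norm_num))
  simp only [map_mul, Nat.reduceAdd] at b b'
  have c1 := ((c_comm (n := 6) (by norm_num) (i := 2) (j := 4) (by norm_num) (by norm_num) (by norm_num)).map f)
  have hs := sign_one (n := 6) (by norm_num) f (d (by norm_num) 2 0 (by norm_num) (by norm_num))
  have k1 := kill_20 (n := 6) (by norm_num) f
  have k2 := kill_24 (n := 6) (by norm_num) f
  rw [← d_mul (j := 0) (hj := by norm_num), map_mul, d_inv (i := 0), map_inv] at k2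
  rcases lemD5 _ _ _ u2 v2 w2 hs c1.eq (by simpa only [mul_assoc] using b)
    (by simpa only [mul_assoc] using b'.symm) with h | h
  · exact k1 h
  · apply k2
    rw [h]; simp

def V4 : Subgroup (Equiv.Perm (Fin 4)) where
  carrier := {p | p * p = 1 ∧ Equiv.Perm.sign p = 1}
  one_mem' := by simp
  mul_mem' := by
    have : ∀ a b : Equiv.Perm (Fin 4), (a * a = 1 ∧ Equiv.Perm.sign a = 1) →
      (b * b = 1 ∧ Equiv.Perm.sign b = 1) → (a * b) * (a * b) = 1 ∧ Equiv.Perm.sign (a * b) = 1 := by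
      decide +kernel
    intro a b ha hb
    exact this a b ha hb
  inv_mem' := by
    rintro a ⟨h1, h2⟩
    refine ⟨?_, by simpa using h2⟩
    rw [← mul_inv_rev, h1, inv_one]

theorem case5 (f : K 5 →* Equiv.Perm (Fin 4)) : ∀ x, f x = 1 := by
  have h1 : ∀ a b : Equiv.Perm (Fin 4), Equiv.Perm.sign a = 1 → Equiv.Perm.sign b = 1 →
      (a * b * a⁻¹ * b⁻¹) * (a * b * a⁻¹ * b⁻¹) = 1 := by
    decide +kernel
  have h2 : ∀ a b : Equiv.Perm (Fin 4), a * a = 1 ∧ Equiv.Perm.sign a = 1 →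
      b * b = 1 ∧ Equiv.Perm.sign b = 1 → a * b = b * a := by
    decide +kernel
  have hp := perfect_top (n := 5) (by norm_num)
  have hV : ∀ x, f x ∈ V4 := by
    have : commutator (K 5) ≤ V4.comap f := by
      rw [commutator_def, Subgroup.commutator_le]
      intro a _ b _
      refine ⟨?_, sign_one (by norm_num) f _⟩
      rw [map_commutatorElement]
      exact h1 _ _ (sign_one (by norm_num) f _) (sign_one (by norm_num) f _)
    intro x
    exact this (hp ▸ Subgroup.mem_top x)
  have : commutator (K 5) ≤ f.ker := by
    rw [commutator_def, Subgroup.commutator_le]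
    intro a _ b _
    rw [MonoidHom.mem_ker, map_commutatorElement, commutatorElement_eq_one_iff_mul_comm]
    exact h2 _ _ (hV a) (hV b)
  intro x
  exact this (hp ▸ Subgroup.mem_top x)

theorem small {n N : ℕ} (h : ∀ f : K n →* Equiv.Perm (Fin N), ∀ x, f x = 1)
    (X : Type) [Fintype X] [DecidableEq X] (hX : Fintype.card X ≤ N)
    (f : K n →* Equiv.Perm X) : ∀ x, f x = 1 := by
  obtain ⟨ι⟩ : Nonempty (X ↪ Fin N) := Function.Embedding.nonempty_of_card_le (by simpa using hX)
  intro x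
  apply Equiv.Perm.viaEmbeddingHom_injective ι
  rw [map_one]
  exact h ((Equiv.Perm.viaEmbeddingHom ι).comp f) x


/-- The inclusion of braid groups on the first strands. -/
def incl {m n : ℕ} (h : m ≤ n) : BraidGroup m →* BraidGroup n :=
  PresentedGroup.toGroup (rels := braidRels m) (f := fun i : Fin (m - 1) => s n i) (by
    rintro r (⟨i, j, hij, rfl⟩ | ⟨i, j, hij, rfl⟩)
    · simp only [map_mul, map_inv, FreeGroup.lift_apply_of]
      rw [mul_inv_eq_one, mul_inv_eq_iff_eq_mul]
      rcases le_abs.1 hij with h | h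
      · exact (s_comm n (i := j) (j := i) (by omega)).symm
      · exact (s_comm n (i := i) (j := j) (by omega))
    · simp only [map_mul, map_inv, FreeGroup.lift_apply_of]
      rw [mul_inv_eq_one, mul_inv_eq_iff_eq_mul, mul_inv_eq_iff_eq_mul]
      have hi := i.2
      have hj := j.2
      rcases (abs_eq (by norm_num)).1 hij with h | h
      · have e : (i : ℕ) = j + 1 := by omega
        rw [e]
        exact (s_braid n (by omega)).symm
      · have e : (j : ℕ) = i + 1 := by omega
        rw [e]
        exact s_braid n (by omega))

theorem incl_s {m n : ℕ} (h : m ≤ n) {i : ℕ} (hi : i + 1 < m) : incl h (s m i) = s n i := by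
  have h1 : i < m - 1 := by omega
  have : s m i = PresentedGroup.of ⟨i, h1⟩ := by simp [s, h1, braidGen]
  rw [this]
  exact PresentedGroup.toGroup.of _

theorem incl_mem {m n : ℕ} (h : m ≤ n) (g : K m) : incl h g ∈ K n := by
  have : K m ≤ (K n).comap (incl h) := by
    rw [K, commutator_def, Subgroup.commutator_le]
    intro a _ b _
    rw [Subgroup.mem_comap, map_commutatorElement]
    exact Subgroup.commutator_mem_commutator (Subgroup.mem_top _) (Subgroup.mem_top _)
  exact this g.2

/-- The inclusion restricted to commutator subgroups. -/
def inclK {m n : ℕ} (h : m ≤ n) : K m →* K n :=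
  ((incl h).comp (K m).subtype).codRestrict (K n) (incl_mem h)

theorem inclK_comm {m n : ℕ} (h : m ≤ n) (hn : 2 < n) {i j : ℕ} (hi : i + 1 < n) (hj : j + 1 < n)
    (hmi : m ≤ i) (hmj : m ≤ j) (g : K m) : Commute (inclK h g) (d hn i j hi hj) := by
  have key : (⊤ : Subgroup (BraidGroup m)) ≤
      (Subgroup.centralizer {s n i * (s n j)⁻¹}).comap (incl h) := by
    rw [← s_closure, Subgroup.closure_le]
    rintro _ ⟨k, rfl⟩
    by_cases hk : k + 1 < m
    · simp only [Subgroup.coe_comap, Set.mem_preimage, SetLike.mem_coe,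
        Subgroup.mem_centralizer_singleton_iff]
      rw [incl_s h hk]
      exact ((s_comm n (i := k) (j := i) (by omega)).mul_right
        (s_comm n (i := k) (j := j) (by omega)).inv_right)
    · have : s m k = 1 := by
        unfold s; rw [dif_neg]; omega
      rw [this]
      exact Subgroup.one_mem _
  have := key (Subgroup.mem_top (g : BraidGroup m))
  rw [Subgroup.mem_comap, Subgroup.mem_centralizer_singleton_iff] at this
  exact Subtype.ext this

/-- Triviality of all actions on sets with fewer than `n` elements. -/
def P (n : ℕ) : Prop := ∀ (X : Type) [Fintype X] [DecidableEq X], Fintype.card X < n →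
  ∀ f : K n →* Equiv.Perm X, ∀ x, f x = 1

theorem two_mul_card_cycles {X : Type} [Fintype X] [DecidableEq X] (c : Equiv.Perm X) :
    2 * c.cycleFactorsFinset.card ≤ Fintype.card X := by
  have h := Multiset.card_nsmul_le_sum (s := c.cycleType) (a := 2)
    (fun x hx => Equiv.Perm.two_le_of_mem_cycleType hx)
  rw [Equiv.Perm.sum_cycleType, Equiv.Perm.cycleType_def, Multiset.card_map] at h
  have h2 := Finset.card_le_univ c.support
  simp only [smul_eq_mul] at h
  have h3 : (c.cycleFactorsFinset.val).card = c.cycleFactorsFinset.card := rfl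
  omega

theorem fix_support {m : ℕ} (hm : 5 ≤ m) (hP : P m) {X : Type} [Fintype X] [DecidableEq X]
    (c : Equiv.Perm X) (hX : Fintype.card X < 2 * m) (ψ : K m →* Equiv.Perm X)
    (hc : ∀ k, Commute (ψ k) c) (k : K m) (p : X) (hp : c p ≠ p) : ψ k p = p := by
  let ψ₁ : K m →* Subgroup.centralizer {c} := ψ.codRestrict _ (fun k => by
    rw [Subgroup.mem_centralizer_singleton_iff]; exact (hc k))
  have h2 := two_mul_card_cycles c
  have tr := hP c.cycleFactorsFinset (by rw [Fintype.card_coe]; omega)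
    ((Equiv.Perm.OnCycleFactors.toPermHom c).comp ψ₁)
  have cm : ∀ k, ∀ τ ∈ c.cycleFactorsFinset, Commute (ψ k) τ := fun k =>
    (Equiv.Perm.OnCycleFactors.mem_ker_toPermHom_iff c (ψ₁ k)).1 (MonoidHom.mem_ker.2 (tr k))
  have pw : ∀ k, ∃ i : ℤ, (c ^ i) p = ψ k p := by
    intro k
    have hτ : c.cycleOf p ∈ c.cycleFactorsFinset :=
      Equiv.Perm.cycleOf_mem_cycleFactorsFinset_iff.2 (Equiv.Perm.mem_support.2 hp)
    have e := DFunLike.congr_fun (cm k _ hτ).eq p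
    simp only [Equiv.Perm.mul_apply, Equiv.Perm.cycleOf_apply_self] at e
    by_contra hcon
    have : ¬ c.SameCycle p (ψ k p) := hcon
    rw [Equiv.Perm.cycleOf_apply_of_not_sameCycle this] at e
    exact hp ((ψ k).injective e)
  have cp : ∀ k (i : ℤ) (q : X), ψ k ((c ^ i) q) = (c ^ i) (ψ k q) := fun k i q =>
    DFunLike.congr_fun ((hc k).zpow_right i).eq q
  have ab : ∀ a b, ψ a (ψ b p) = ψ b (ψ a p) := by
    intro a b
    obtain ⟨i, hi⟩ := pw a
    obtain ⟨j, hj⟩ := pw b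
    rw [← hj, cp, ← hi, cp, ← hj, ← Equiv.Perm.mul_apply, ← Equiv.Perm.mul_apply,
      ← zpow_add, ← zpow_add, add_comm]
  have key : commutator (K m) ≤ (MulAction.stabilizer (Equiv.Perm X) p).comap ψ := by
    rw [commutator_def, Subgroup.commutator_le]
    intro a _ b _
    rw [Subgroup.mem_comap, MulAction.mem_stabilizer_iff, Equiv.Perm.smul_def,
      commutatorElement_def]
    have := ab a⁻¹ b⁻¹
    simp only [map_mul, Equiv.Perm.mul_apply]
    rw [this, ← Equiv.Perm.mul_apply (ψ b), ← map_mul, mul_inv_cancel, map_one,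
      Equiv.Perm.one_apply, ← Equiv.Perm.mul_apply, ← map_mul, mul_inv_cancel, map_one,
      Equiv.Perm.one_apply]
  rw [perfect_top hm] at key
  exact key (Subgroup.mem_top k)

theorem step {n : ℕ} (hn : 8 ≤ n) (hP : P (n - 3)) : P n := by
  intro X _ _ hX f
  have hm : n - 3 ≤ n := by omega
  let c := f (d (by omega) (n - 3) (n - 3 + 1) (by omega) (by omega))
  let ψ : K (n - 3) →* Equiv.Perm X := f.comp (inclK hm)
  have hc : ∀ k, Commute (ψ k) c := fun k =>
    (inclK_comm hm (by omega) (by omega) (by omega) le_rfl (by omega) k).map f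
  have fs := fix_support (by omega) hP c (by omega) ψ hc
  by_cases h3 : 3 ≤ c.support.card
  · have inv : ∀ k p, c p = p ↔ c (ψ k p) = ψ k p := by
      intro k p
      have e : ψ k (c p) = c (ψ k p) := DFunLike.congr_fun (hc k).eq p
      rw [← e, (ψ k).injective.eq_iff]
    let φ : K (n - 3) →* Equiv.Perm {p // c p = p} :=
      { toFun := fun k => (ψ k).subtypePerm (fun p => (inv k p).symm)
        map_one' := by ext; simp
        map_mul' := fun a b => by
          ext p
          exact DFunLike.congr_fun (map_mul ψ a b) (p : X) }
    have hcard : Fintype.card {p // c p = p} < n - 3 := by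
      have e1 := Fintype.card_subtype_compl (fun p => c p = p)
      have e2 : Fintype.card {p // ¬ c p = p} = c.support.card := by
        rw [Fintype.card_subtype]; rfl
      have e3 := Fintype.card_subtype_le (fun p => c p = p)
      omega
    have tr := hP _ hcard φ
    have all : ∀ k, ψ k = 1 := by
      intro k
      ext p
      by_cases hp : c p = p
      · have := congrArg Subtype.val (DFunLike.congr_fun (tr k) ⟨p, hp⟩)
        simpa [φ] using this
      · simpa using fs k p hp
    refine kill_adj (by omega) f (k := 0) (l := 3) (by omega) (by omega) (by omega) ?_
    have := all (d (by omega) 0 1 (by omega) (by omega))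
    rw [← this]
    change f _ = f _
    congr 1
    apply Subtype.ext
    change s n 0 * (s n 1)⁻¹ = incl hm (s (n - 3) 0 * (s (n - 3) 1)⁻¹)
    rw [map_mul, map_inv, incl_s hm (by omega), incl_s hm (by omega)]
  · have sc : Equiv.Perm.sign c = 1 := sign_one (by omega) f _
    have c1 : c = 1 := by
      have n1 := Equiv.Perm.card_support_ne_one c
      have n2 : c.support.card ≠ 2 := by
        intro h
        have := (Equiv.Perm.card_support_eq_two.1 h).sign_eq
        rw [sc] at this
        exact absurd this (by decide)
      exact Equiv.Perm.card_support_eq_zero.1 (by omega)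
    exact kill_adj (by omega) f (k := n - 3) (l := 0) (by omega) (by omega) (by omega) c1

theorem P_all (n : ℕ) (hn : 5 ≤ n) : P n := by
  induction n using Nat.strong_induction_on with
  | _ n ih =>
    by_cases h8 : 8 ≤ n
    · exact step h8 (ih (n - 3) (by omega) (by omega))
    · obtain rfl | rfl | rfl : n = 5 ∨ n = 6 ∨ n = 7 := by omega
      · intro X _ _ hX f
        exact small case5 X (by omega) f
      · intro X _ _ hX f
        exact small case6 X (by omega) f
      · intro X _ _ hX f
        exact small case7 X (by omega) f

end KnAux

/-- For `n ≥ 5` and `r < n`, every homomorphism from the commutator subgroup of the braid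
group into the symmetric group on `r` letters is trivial. -/
theorem hom_Kn_symm_trivial (n r : ℕ) (hn : 5 ≤ n) (hr : r < n)
    (f : ↥(commutator (BraidGroup n)) →* Equiv.Perm (Fin r)) :
    ∀ x, f x = 1 := by
  exact KnAux.P_all n hn (Fin r) (by simpa using hr) f
end

section
/- For every n ≥ 5 and every r with 2 ≤ r ≤ n − 1, the group K_n has no subgroup of index r: there is no subgroup H of K_n with H.index = r. -/
/-! ### Generators of the braid group -/

/-- The generator with natural number index, `1` when out of range. -/
def bs (n i : ℕ) : BraidGroup n := if h : i < n - 1 then braidGen ⟨i, h⟩ else 1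

theorem bs_comm (n : ℕ) {i j : ℕ} (hi : i < n - 1) (hj : j < n - 1) (hij : i + 2 ≤ j) :
    bs n i * bs n j = bs n j * bs n i := by
  have h : (PresentedGroup.mk (braidRels n)) (FreeGroup.of ⟨i, hi⟩ * FreeGroup.of ⟨j, hj⟩ *
      (FreeGroup.of ⟨i, hi⟩)⁻¹ * (FreeGroup.of ⟨j, hj⟩)⁻¹) = 1 := by
    apply PresentedGroup.one_of_mem
    refine Or.inl ⟨⟨i, hi⟩, ⟨j, hj⟩, ?_, rfl⟩
    simp only
    rw [abs_sub_comm, abs_of_nonneg] <;> omega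
  simp only [map_mul, map_inv] at h
  simp only [bs, hi, hj, dif_pos, braidGen, PresentedGroup.of]
  rw [mul_inv_eq_one, mul_inv_eq_iff_eq_mul] at h
  exact h

theorem bs_braid (n : ℕ) {i : ℕ} (hi : i + 1 < n - 1) :
    bs n i * bs n (i + 1) * bs n i = bs n (i + 1) * bs n i * bs n (i + 1) := by
  have hi' : i < n - 1 := by omega
  have h : (PresentedGroup.mk (braidRels n)) (FreeGroup.of ⟨i, hi'⟩ * FreeGroup.of ⟨i + 1, hi⟩ *
      FreeGroup.of ⟨i, hi'⟩ * (FreeGroup.of ⟨i + 1, hi⟩)⁻¹ *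
      (FreeGroup.of ⟨i, hi'⟩)⁻¹ * (FreeGroup.of ⟨i + 1, hi⟩)⁻¹) = 1 := by
    apply PresentedGroup.one_of_mem
    refine Or.inr ⟨⟨i, hi'⟩, ⟨i + 1, hi⟩, ?_, rfl⟩
    simp
  simp only [map_mul, map_inv] at h
  simp only [bs, hi, hi', dif_pos, braidGen, PresentedGroup.of]
  rw [mul_inv_eq_one, mul_inv_eq_iff_eq_mul, mul_inv_eq_iff_eq_mul] at h
  exact h

theorem bs_closure (n : ℕ) (S : Subgroup (BraidGroup n)) (h : ∀ i, i < n - 1 → bs n i ∈ S) :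
    S = ⊤ := by
  rw [eq_top_iff, ← PresentedGroup.closure_range_of, Subgroup.closure_le]
  rintro _ ⟨i, rfl⟩
  have := h i i.2
  simpa [bs, braidGen] using this

/-- A map on generators satisfying the braid relations extends. -/
theorem braid_lift (n : ℕ) {G : Type*} [Group G] (f : ℕ → G)
    (hc : ∀ i j, i + 2 ≤ j → j < n - 1 → f i * f j = f j * f i)
    (hb : ∀ i, i + 1 < n - 1 → f i * f (i + 1) * f i = f (i + 1) * f i * f (i + 1)) :
    ∃ F : BraidGroup n →* G, ∀ i, i < n - 1 → F (bs n i) = f i := by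
  have key : ∀ r ∈ braidRels n, FreeGroup.lift (fun i : Fin (n - 1) => f i) r = 1 := by
    rintro r (⟨i, j, hij, rfl⟩ | ⟨i, j, hij, rfl⟩)
    · simp only [map_mul, map_inv, FreeGroup.lift_apply_of]
      rw [mul_inv_eq_one, mul_inv_eq_iff_eq_mul]
      rcases le_total (i : ℕ) j with h | h
      · refine hc i j ?_ j.2
        rw [abs_sub_comm, abs_of_nonneg] at hij <;> omega
      · refine (hc j i ?_ i.2).symm
        rw [abs_of_nonneg] at hij <;> omega
    · simp only [map_mul, map_inv, FreeGroup.lift_apply_of]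
      rw [mul_inv_eq_one, mul_inv_eq_iff_eq_mul, mul_inv_eq_iff_eq_mul]
      rcases le_total (i : ℕ) j with h | h
      · have : (j : ℕ) = i + 1 := by
          rw [abs_sub_comm, abs_of_nonneg] at hij <;> omega
        rw [this]
        exact hb i (by omega)
      · have : (i : ℕ) = j + 1 := by
          rw [abs_of_nonneg] at hij <;> omega
        rw [this]
        exact (hb j (by omega)).symm
  refine ⟨PresentedGroup.toGroup key, fun i hi => ?_⟩
  simp only [bs, hi, dif_pos, braidGen]
  exact PresentedGroup.toGroup.of key

/-! ### Abstract braid identities -/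

theorem braid_comm_eq {G : Type*} [Group G] {x y : G} (hb : x * y * x = y * x * y)
    (hc : x * y = y * x) : x = y := by
  rw [hc, mul_assoc, mul_assoc] at hb
  exact mul_left_cancel (mul_left_cancel hb)

/-- In a group in which three successive braid generators satisfy `x = y`, also `y = z`. -/
theorem braid_shift {G : Type*} [Group G] {x y z : G} (h1 : x * y * x = y * x * y)
    (h2 : y * z * y = z * y * z) (h3 : x * z = z * x) : x = y ↔ y = z := by
  constructor
  · rintro rfl
    exact braid_comm_eq h2 h3
  · rintro rfl
    exact braid_comm_eq h1 h3

theorem braid_key {G : Type*} [Group G] {a b d : G} (h1 : a * b * a = b * a * b)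
    (h2 : b * d * b = d * b * d) (h3 : a * d = d * a) :
    (d * a⁻¹) * ((a * b * a⁻¹ * a⁻¹) * (d * a⁻¹) * (a * b * a⁻¹ * a⁻¹)⁻¹) =
      (b * a⁻¹) * (d * a⁻¹) * (b * a⁻¹)⁻¹ := by
  have e3 : a⁻¹ * d = d * a⁻¹ := by
    rw [inv_mul_eq_iff_eq_mul, ← mul_assoc, h3, mul_assoc, mul_inv_cancel, mul_one]
  have e1 : a⁻¹ * b⁻¹ * a⁻¹ = b⁻¹ * a⁻¹ * b⁻¹ := by
    have := congrArg (·⁻¹) h1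
    simpa [mul_assoc] using this
  calc _ = d * b * a⁻¹ * (a⁻¹ * d) * a * b⁻¹ * a⁻¹ := by group
    _ = d * b * a⁻¹ * (d * a⁻¹) * a * b⁻¹ * a⁻¹ := by rw [e3]
    _ = d * b * (a⁻¹ * d) * b⁻¹ * a⁻¹ := by group
    _ = (d * b * d) * (a⁻¹ * b⁻¹ * a⁻¹) := by rw [e3]; simp only [mul_assoc]
    _ = b * (d * a⁻¹) * b⁻¹ := by rw [← h2, e1]; group
    _ = b * (a⁻¹ * d) * b⁻¹ := by rw [e3]
    _ = _ := by group

theorem braid_swap {G : Type*} [Group G] {x y z : G} (h1 : x * y * x = y * x * y)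
    (h2 : y * z * y = z * y * z) (h3 : x * z = z * x) :
    (y * x * z * y) * x = z * (y * x * z * y) := by
  calc (y * x * z * y) * x = y * (x * z) * y * x := by group
    _ = y * z * (x * y * x) := by rw [h3]; group
    _ = (y * z * y) * x * y := by rw [h1]; group
    _ = z * y * (z * x) * y := by rw [h2]; group
    _ = _ := by rw [← h3]; group

theorem braid_swap' {G : Type*} [Group G] {x y z : G} (h1 : x * y * x = y * x * y)
    (h2 : y * z * y = z * y * z) (h3 : x * z = z * x) :
    (y * x * z * y) * z = x * (y * x * z * y) := by
  have := braid_swap (x := z) (y := y) (z := x) h2.symm h1.symm h3.symm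
  rwa [mul_assoc y z x, ← h3, ← mul_assoc] at this

/-! ### The commutator subgroup -/

theorem ab_bs (n : ℕ) (_hn : 2 ≤ n) {i : ℕ} (hi : i < n - 1) :
    Abelianization.of (bs n i) = Abelianization.of (bs n 0) := by
  induction i with
  | zero => rfl
  | succ k ih =>
    rw [← ih (by omega)]
    have := congrArg Abelianization.of (bs_braid n hi)
    simp only [map_mul] at this
    exact (braid_comm_eq this (mul_comm _ _)).symm

theorem mem_comm_iff {G : Type*} [Group G] (x : G) :
    x ∈ commutator G ↔ Abelianization.of x = 1 := by
  rw [← Abelianization.ker_of, MonoidHom.mem_ker]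

theorem ab_zpow (n : ℕ) (hn : 2 ≤ n) (b : BraidGroup n) :
    ∃ m : ℤ, Abelianization.of b = Abelianization.of (bs n 0) ^ m := by
  have : (Subgroup.zpowers (Abelianization.of (bs n 0))).comap
      (Abelianization.of (G := BraidGroup n)) = ⊤ := by
    apply bs_closure
    intro i hi
    rw [Subgroup.mem_comap, ab_bs n hn hi]
    exact Subgroup.mem_zpowers _
  have h : b ∈ (Subgroup.zpowers (Abelianization.of (bs n 0))).comap
      (Abelianization.of (G := BraidGroup n)) := by rw [this]; trivial
  obtain ⟨m, hm⟩ := h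
  exact ⟨m, hm.symm⟩

theorem diff_mem (n : ℕ) {i j : ℕ} (hi : i < n - 1) (hj : j < n - 1) :
    bs n i * (bs n j)⁻¹ ∈ commutator (BraidGroup n) := by
  rw [mem_comm_iff, map_mul, map_inv, ab_bs n (by omega) hi, ab_bs n (by omega) hj, mul_inv_cancel]

/-- The element `σ_i σ_j⁻¹` of the commutator subgroup. -/
def kd (n : ℕ) {i j : ℕ} (hi : i < n - 1) (hj : j < n - 1) : commutator (BraidGroup n) :=
  ⟨bs n i * (bs n j)⁻¹, diff_mem n hi hj⟩

/-- If a homomorphism of the commutator subgroup kills an element commuting with a generator,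
it kills its normal closure in the braid group. -/
theorem kill_normalClosure (n : ℕ) {G : Type*} [Group G]
    (φ : commutator (BraidGroup n) →* G) (x : commutator (BraidGroup n)) {i : ℕ} (hi : i < n - 1)
    (hx : bs n i * x = x * bs n i) (h : φ x = 1)
    (hQ : commutator (BraidGroup n) ≤ Subgroup.normalClosure {(x : BraidGroup n)}) :
    ∀ y, φ y = 1 := by
  have key : Subgroup.normalClosure {(x : BraidGroup n)} ≤
      φ.ker.map (commutator (BraidGroup n)).subtype := by
    rw [Subgroup.normalClosure, Subgroup.closure_le]
    intro z hz
    rw [Group.mem_conjugatesOfSet_iff] at hz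
    obtain ⟨w, hw, hz⟩ := hz
    rw [Set.mem_singleton_iff] at hw
    subst hw
    obtain ⟨b, rfl⟩ := isConj_iff.1 hz
    obtain ⟨m, hm⟩ := ab_zpow n (by omega) b
    have hk : b * (bs n i ^ m)⁻¹ ∈ commutator (BraidGroup n) := by
      rw [mem_comm_iff, map_mul, map_inv, map_zpow, hm, ab_bs n (by omega) hi, mul_inv_cancel]
    have hc : (bs n i ^ m) * x = x * (bs n i ^ m) := (Commute.zpow_left (a := bs n i) hx m).eq
    refine ⟨⟨_, hk⟩ * x * ⟨_, hk⟩⁻¹, ?_, ?_⟩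
    · simp [h]
    · simp only [Subgroup.subtype_apply, Subgroup.coe_mul, Subgroup.coe_inv]
      generalize bs n i ^ m = t at hc
      calc _ = b * t⁻¹ * (x * t) * b⁻¹ := by group
        _ = _ := by rw [← hc]; group
  intro y
  obtain ⟨z, hz, hzy⟩ := key (hQ y.2)
  rw [← Subtype.ext (a1 := z) (a2 := y) hzy]
  exact hz

theorem comm_le_of_adj (n : ℕ) (N : Subgroup (BraidGroup n)) [N.Normal] {i : ℕ} (hi : i + 1 < n - 1)
    (h : (bs n i : BraidGroup n ⧸ N) = (bs n (i + 1) : BraidGroup n ⧸ N)) :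
    commutator (BraidGroup n) ≤ N := by
  set q := QuotientGroup.mk' N with hq
  have hstep : ∀ j, j + 2 < n - 1 → (q (bs n j) = q (bs n (j + 1)) ↔
      q (bs n (j + 1)) = q (bs n (j + 2))) := by
    intro j hj
    apply braid_shift
    · simpa only [map_mul] using congrArg q (bs_braid n (i := j) (by omega))
    · simpa only [map_mul] using congrArg q (bs_braid n (i := j + 1) (by omega))
    · simpa only [map_mul] using congrArg q (bs_comm n (i := j) (j := j + 2)
        (by omega) (by omega) (by omega))
  have h0 : ∀ j, j + 1 < n - 1 → (q (bs n j) = q (bs n (j + 1)) ↔ q (bs n 0) = q (bs n 1)) := by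
    intro j
    induction j with
    | zero => intro _; rfl
    | succ k ih =>
      intro hk
      rw [← ih (by omega)]
      exact (hstep k hk).symm
  have h1 : q (bs n 0) = q (bs n 1) := (h0 i hi).1 h
  have hall : ∀ j, j < n - 1 → q (bs n j) = q (bs n 0) := by
    intro j
    induction j with
    | zero => intro _; rfl
    | succ k ih =>
      intro hk
      rw [← ih (by omega)]
      exact ((h0 k hk).2 h1).symm
  have hz : (Subgroup.zpowers (q (bs n 0))).comap q = ⊤ := by
    apply bs_closure
    intro j hj
    rw [Subgroup.mem_comap, hall j hj]
    exact Subgroup.mem_zpowers _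
  have hz' : ∀ b, ∃ m : ℤ, q (bs n 0) ^ m = q b := by
    intro b
    have hb : b ∈ (Subgroup.zpowers (q (bs n 0))).comap q := by rw [hz]; trivial
    exact hb
  rw [commutator_def, Subgroup.commutator_le]
  intro a _ b _
  have : q (a * b * a⁻¹ * b⁻¹) = 1 := by
    obtain ⟨m, hm⟩ := hz' a
    obtain ⟨l, hl⟩ := hz' b
    simp only [map_mul, map_inv]
    rw [← hm, ← hl, mul_inv_eq_one, mul_inv_eq_iff_eq_mul]
    exact (Commute.zpow_zpow_self _ m l).eq
  exact (QuotientGroup.eq_one_iff _).1 this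

theorem quot_eq_of_diff {G : Type*} [Group G] (N : Subgroup G) [N.Normal] {a b : G}
    (h : a * b⁻¹ ∈ N) : (a : G ⧸ N) = (b : G ⧸ N) := by
  have := (QuotientGroup.eq_one_iff _).2 h
  rwa [QuotientGroup.mk_mul, QuotientGroup.mk_inv, mul_inv_eq_one] at this

theorem trivial_of_adj (n : ℕ) {G : Type*} [Group G] (φ : commutator (BraidGroup n) →* G)
    {i j : ℕ} (hi : i + 1 < n - 1) (hj : j < n - 1) (hij : j + 2 ≤ i ∨ i + 3 ≤ j)
    (h : φ (kd n (i := i) (j := i + 1) (by omega) hi) = 1) : ∀ y, φ y = 1 := by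
  refine kill_normalClosure n φ _ hj ?_ h ?_
  · have c1 : Commute (bs n j) (bs n i) := by
      rcases hij with h | h
      · exact bs_comm n (by omega) (by omega) (by omega)
      · exact (bs_comm n (by omega) (by omega) (by omega)).symm
    have c2 : Commute (bs n j) (bs n (i + 1)) := by
      rcases hij with h | h
      · exact bs_comm n (by omega) (by omega) (by omega)
      · exact (bs_comm n (by omega) (by omega) (by omega)).symm
    exact (c1.mul_right c2.inv_right).eq
  · apply comm_le_of_adj n _ hi
    apply quot_eq_of_diff
    exact Subgroup.subset_normalClosure rfl

theorem trivial_of_c (n : ℕ) (hn : 5 ≤ n) {G : Type*} [Group G] (φ : commutator (BraidGroup n) →* G)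
    (h : φ (kd n (i := 2) (j := 0) (by omega) (by omega)) = 1) : ∀ y, φ y = 1 := by
  refine kill_normalClosure n φ _ (i := 0) (by omega) ?_ h ?_
  · have c1 : Commute (bs n 0) (bs n 2) := bs_comm n (by omega) (by omega) (by omega)
    exact (c1.mul_right (Commute.refl _).inv_right).eq
  · apply comm_le_of_adj n _ (i := 2) (by omega)
    set N := Subgroup.normalClosure
      {((kd n (i := 2) (j := 0) (by omega) (by omega) : commutator (BraidGroup n)) : BraidGroup n)}
    have h20 : (bs n 2 : BraidGroup n ⧸ N) = (bs n 0 : BraidGroup n ⧸ N) := by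
      apply quot_eq_of_diff
      exact Subgroup.subset_normalClosure rfl
    apply braid_comm_eq
    · exact congrArg (QuotientGroup.mk' N) (bs_braid n (i := 2) (by omega))
    · rw [h20]
      exact congrArg (QuotientGroup.mk' N) (bs_comm n (i := 0) (j := 3)
        (by omega) (by omega) (by omega))

/-- The element `v = σ_0 σ_1 σ_0⁻²`. -/
def kv (n : ℕ) (hn : 5 ≤ n) : commutator (BraidGroup n) :=
  ⟨bs n 0 * bs n 1 * (bs n 0)⁻¹ * (bs n 0)⁻¹, by
    rw [mem_comm_iff]
    simp only [map_mul, map_inv, ab_bs n (i := 1) (by omega) (by omega)]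
    group⟩

theorem kd_key (n : ℕ) (hn : 5 ≤ n) :
    kd n (i := 2) (j := 0) (by omega) (by omega) *
      (kv n hn * kd n (i := 2) (j := 0) (by omega) (by omega) * (kv n hn)⁻¹) =
    kd n (i := 1) (j := 0) (by omega) (by omega) * kd n (i := 2) (j := 0) (by omega) (by omega) *
      (kd n (i := 1) (j := 0) (by omega) (by omega))⁻¹ := by
  apply Subtype.ext
  exact braid_key (bs_braid n (i := 0) (by omega)) (bs_braid n (i := 1) (by omega))
    (bs_comm n (i := 0) (j := 2) (by omega) (by omega) (by omega))

/-- The commutator subgroup is perfect, in the form of homomorphisms with commutative image. -/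
theorem trivial_of_commImage (n : ℕ) (hn : 5 ≤ n) {G : Type*} [Group G]
    (φ : commutator (BraidGroup n) →* G) (h : ∀ x y, φ x * φ y = φ y * φ x) : ∀ y, φ y = 1 := by
  apply trivial_of_c n hn
  have := congrArg φ (kd_key n hn)
  simp only [map_mul, map_inv] at this
  rw [h (kv n hn), mul_inv_cancel_right, h (kd n (i := 1) (j := 0) (by omega) (by omega)),
    mul_inv_cancel_right] at this
  simpa using this

/-! ### Centralizers in small alternating groups -/

/-- The centralizer of `g` in the alternating group. -/
def evenCent {α : Type*} [Fintype α] [DecidableEq α] (g : Equiv.Perm α) :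
    Subgroup (Equiv.Perm α) := alternatingGroup α ⊓ Subgroup.centralizer {g}

theorem mem_evenCent {α : Type*} [Fintype α] [DecidableEq α] {g x : Equiv.Perm α} :
    x ∈ evenCent g ↔ Equiv.Perm.sign x = 1 ∧ g * x = x * g := by
  rw [evenCent, Subgroup.mem_inf, Equiv.Perm.mem_alternatingGroup,
    Subgroup.mem_centralizer_singleton_iff, eq_comm (a := x * g)]

theorem evenCent_card_eq {α : Type*} [Fintype α] [DecidableEq α] (g : Equiv.Perm α) :
    (alternatingGroup α).relIndex (Subgroup.centralizer {g}) * Nat.card (evenCent g) =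
      Nat.card (Subgroup.centralizer {g}) := by
  rw [← Subgroup.card_mul_index ((alternatingGroup α).subgroupOf (Subgroup.centralizer {g})),
    mul_comm, Subgroup.relIndex, evenCent]
  congr 1
  rw [← Subgroup.inf_subgroupOf_right]
  exact (Nat.card_congr (Subgroup.subgroupOfEquivOfLe inf_le_right).toEquiv).symm

theorem evenCent_card {α : Type*} [Fintype α] [DecidableEq α] [Nontrivial α] (g : Equiv.Perm α)
    (m : Multiset ℕ) (k : ℕ) (hm : g.cycleType = m)
    (hk : (Fintype.card α - m.sum).factorial * m.prod *
        (∏ n ∈ m.toFinset, (m.count n).factorial) = k) :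
    (((∀ c ∈ m, Odd c) ∧ Fintype.card α ≤ m.sum + 1 ∧ m.Nodup) → Nat.card (evenCent g) = k) ∧
    (¬ ((∀ c ∈ m, Odd c) ∧ Fintype.card α ≤ m.sum + 1 ∧ m.Nodup) →
      2 * Nat.card (evenCent g) = k) := by
  subst hm
  have h0 := evenCent_card_eq g
  rw [Equiv.Perm.nat_card_centralizer, hk] at h0
  have h1 := Equiv.Perm.centralizer_le_alternating_iff (g := g)
  rw [← Multiset.nodup_iff_count_le_one] at h1
  rw [← h1]
  constructor
  · intro h
    rw [Subgroup.relIndex_eq_one.2 h, one_mul] at h0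
    exact h0
  · intro h
    have h2 : (alternatingGroup α).relIndex (Subgroup.centralizer {g}) ∣ 2 := by
      rw [← alternatingGroup.index_eq_two (α := α)]
      exact Subgroup.relIndex_dvd_index_of_normal _ _
    rcases (Nat.dvd_prime Nat.prime_two).1 h2 with h3 | h3
    · exact absurd (Subgroup.relIndex_eq_one.1 h3) h
    · rw [h3] at h0
      exact h0

theorem cycleType_cases {k : ℕ} (hk : k ≤ 6) (g : Equiv.Perm (Fin k)) (hs : Equiv.Perm.sign g = 1)
    (hg : g ≠ 1) :
    (g.cycleType = {3} ∧ 3 ≤ k) ∨ (g.cycleType = {5} ∧ 5 ≤ k) ∨ (g.cycleType = {2, 2} ∧ 4 ≤ k) ∨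
      (g.cycleType = {3, 3} ∧ 6 ≤ k) ∨ (g.cycleType = {4, 2} ∧ 6 ≤ k) := by
  have h1 : g.cycleType.sum ≤ k := by
    rw [Equiv.Perm.sum_cycleType]
    simpa using Finset.card_le_univ g.support
  have h2 : ∀ c ∈ g.cycleType, 2 ≤ c := fun c hc => Equiv.Perm.two_le_of_mem_cycleType hc
  have h3 : g.cycleType ≠ 0 := by rwa [Ne, Equiv.Perm.cycleType_eq_zero]
  rw [Equiv.Perm.sign_of_cycleType] at hs
  generalize g.cycleType = m at *
  induction m using Multiset.induction_on with
  | empty => exact absurd rfl h3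
  | cons a m _ =>
  have ha := h2 a (by simp)
  induction m using Multiset.induction_on with
  | empty =>
    simp at h1
    have : a ≤ 6 := by omega
    interval_cases a <;> first | (exfalso; revert hs; decide) | (simp; omega)
  | cons b m _ =>
  have hb := h2 b (by simp)
  induction m using Multiset.induction_on with
  | empty =>
    simp at h1
    have : a ≤ 4 := by omega
    have : b ≤ 4 := by omega
    interval_cases a <;> interval_cases b <;>
      first
      | omega
      | (exfalso; revert hs; decide)
      | exact Or.inr (Or.inr (Or.inl ⟨by decide, by omega⟩))
      | exact Or.inr (Or.inr (Or.inr (Or.inl ⟨by decide, by omega⟩)))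
      | exact Or.inr (Or.inr (Or.inr (Or.inr ⟨by decide, by omega⟩)))
  | cons c m _ =>
  have hc := h2 c (by simp)
  induction m using Multiset.induction_on with
  | empty =>
    simp at h1
    have : a = 2 := by omega
    have : b = 2 := by omega
    have : c = 2 := by omega
    subst a b c
    exfalso; revert hs; decide
  | cons d m _ =>
    have hd := h2 d (by simp)
    simp at h1
    omega

theorem evenCent_five (g : Equiv.Perm (Fin 5)) (hs : Equiv.Perm.sign g = 1) (hg : g ≠ 1) :
    (∃ p, p.Prime ∧ Nat.card (evenCent g) = p) ∨ (g * g = 1 ∧ Nat.card (evenCent g) = 2 ^ 2) := by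
  rcases cycleType_cases (by norm_num) g hs hg with h | h | h | h | h
  · left
    have := (evenCent_card g _ 6 h.1 (by decide)).2 (by decide)
    exact ⟨3, by norm_num, by omega⟩
  · left
    have := (evenCent_card g _ 5 h.1 (by decide)).1 (by decide)
    exact ⟨5, by norm_num, by omega⟩
  · right
    have := (evenCent_card g _ 8 h.1 (by decide)).2 (by decide)
    refine ⟨?_, by omega⟩
    have ho := pow_orderOf_eq_one g
    rw [← Equiv.Perm.lcm_cycleType, h.1] at ho
    rw [← pow_two]
    exact ho
  · omega
  · omega

theorem evenCent_six (g : Equiv.Perm (Fin 6)) (hs : Equiv.Perm.sign g = 1) (hg : g ≠ 1) :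
    ∃ p k, p.Prime ∧ Nat.card (evenCent g) = p ^ k := by
  rcases cycleType_cases (by norm_num) g hs hg with h | h | h | h | h
  · have := (evenCent_card g _ 18 h.1 (by decide)).2 (by decide)
    exact ⟨3, 2, by norm_num, by omega⟩
  · have := (evenCent_card g _ 5 h.1 (by decide)).1 (by decide)
    exact ⟨5, 1, by norm_num, by omega⟩
  · have := (evenCent_card g _ 16 h.1 (by decide)).2 (by decide)
    exact ⟨2, 3, by norm_num, by omega⟩
  · have := (evenCent_card g _ 18 h.1 (by decide)).2 (by decide)
    exact ⟨3, 2, by norm_num, by omega⟩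
  · have := (evenCent_card g _ 8 h.1 (by decide)).2 (by decide)
    exact ⟨2, 2, by norm_num, by omega⟩

theorem evenCent_five_comm (g : Equiv.Perm (Fin 5)) (hs : Equiv.Perm.sign g = 1) (hg : g ≠ 1)
    {x y : Equiv.Perm (Fin 5)} (hx : x ∈ evenCent g) (hy : y ∈ evenCent g) : x * y = y * x := by
  have key : ∀ a b : evenCent g, a * b = b * a := by
    rcases evenCent_five g hs hg with ⟨p, hp, hc⟩ | ⟨_, hc⟩
    · have := Fact.mk hp
      have := isCyclic_of_prime_card hc
      exact fun a b => (IsCyclic.isMulCommutative (α := evenCent g)).is_comm.comm a b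
    · have := Fact.mk Nat.prime_two
      exact fun a b => (IsPGroup.isMulCommutative_of_card_eq_prime_sq hc).is_comm.comm a b
  exact congrArg Subtype.val (key ⟨x, hx⟩ ⟨y, hy⟩)

theorem evenCent_five_zpow (g : Equiv.Perm (Fin 5)) (hs : Equiv.Perm.sign g = 1) (hg : g * g ≠ 1)
    {x : Equiv.Perm (Fin 5)} (hx : x ∈ evenCent g) : ∃ k : ℤ, x = g ^ k := by
  have hg1 : g ≠ 1 := by rintro rfl; simp at hg
  rcases evenCent_five g hs hg1 with ⟨p, hp, hc⟩ | ⟨h, _⟩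
  · have := Fact.mk hp
    have hgm : g ∈ evenCent g := mem_evenCent.2 ⟨hs, rfl⟩
    have := mem_zpowers_of_prime_card hc (g := (⟨g, hgm⟩ : evenCent g)) (g' := ⟨x, hx⟩)
      (fun h => hg1 (congrArg Subtype.val h))
    obtain ⟨k, hk⟩ := this
    exact ⟨k, (congrArg Subtype.val hk).symm⟩
  · exact absurd h hg

/-- In a nilpotent group, `c * v c v⁻¹ = u c u⁻¹` forces `c = 1`. -/
theorem nilpotent_key {G : Type*} [Group G] [Group.IsNilpotent G] {c u v : G}
    (h : c * (v * c * v⁻¹) = u * c * u⁻¹) : c = 1 := by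
  have key : ∀ k, c ∈ (⊤ : Subgroup G).lowerCentralSeries k := by
    intro k
    induction k with
    | zero => trivial
    | succ k ih =>
      have hu : c * u * c⁻¹ * u⁻¹ ∈ (⊤ : Subgroup G).lowerCentralSeries (k + 1) :=
        Subgroup.subset_closure ⟨c, ih, u, trivial, rfl⟩
      have hv : c * v * c⁻¹ * v⁻¹ ∈ (⊤ : Subgroup G).lowerCentralSeries (k + 1) :=
        Subgroup.subset_closure ⟨c, ih, v, trivial, rfl⟩
      have e : c = (c * u * c⁻¹ * u⁻¹)⁻¹ * (c * v * c⁻¹ * v⁻¹) := by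
        have h' : u * c * u⁻¹ = c * (v * c * v⁻¹) := h.symm
        calc c = c * (v * c * v⁻¹) * (v * c⁻¹ * v⁻¹) := by group
          _ = (u * c * u⁻¹) * (v * c⁻¹ * v⁻¹) := by rw [h']
          _ = _ := by group
      rw [e]
      exact mul_mem (inv_mem hu) hv
  obtain ⟨k, hk⟩ := Subgroup.nilpotent_iff_lowerCentralSeries.1 (inferInstance : Group.IsNilpotent G)
  have := key k
  rw [hk] at this
  exact this

/-! ### The main argument -/

theorem sign_trivial (n : ℕ) (hn : 5 ≤ n) {X : Type*} [Fintype X] [DecidableEq X]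
    (φ : commutator (BraidGroup n) →* Equiv.Perm X) (y : commutator (BraidGroup n)) :
    Equiv.Perm.sign (φ y) = 1 :=
  trivial_of_commImage n hn (Equiv.Perm.sign.comp φ) (fun _ _ => mul_comm _ _) y

theorem case_five (φ : commutator (BraidGroup 5) →* Equiv.Perm (Fin 4)) : ∀ y, φ y = 1 := by
  let φ' : commutator (BraidGroup 5) →* alternatingGroup (Fin 4) :=
    φ.codRestrict _ (fun y => Equiv.Perm.mem_alternatingGroup.2 (sign_trivial 5 le_rfl φ y))
  have h4 : Nat.card (Fin 4) = 4 := by simp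
  have h1 : ∀ y, φ' y ∈ alternatingGroup.kleinFour (Fin 4) := by
    intro y
    rw [alternatingGroup.kleinFour_eq_commutator h4, mem_comm_iff]
    exact trivial_of_commImage 5 le_rfl (Abelianization.of.comp φ') (fun _ _ => mul_comm _ _) y
  have := alternatingGroup.kleinFour_isKleinFour h4
  have hc := IsKleinFour.isMulCommutative (G := alternatingGroup.kleinFour (Fin 4))
  apply trivial_of_commImage 5 le_rfl
  intro x y
  have := hc.is_comm.comm ⟨φ' x, h1 x⟩ ⟨φ' y, h1 y⟩
  exact congrArg Subtype.val (congrArg Subtype.val this)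

/-- The element exchanging `σ_i` and `σ_{i+2}`, corrected by a fourth power. -/
def kswap (n i j : ℕ) (hi : i + 2 < n - 1) (hj : j < n - 1) : commutator (BraidGroup n) :=
  ⟨(bs n (i + 1) * bs n i * bs n (i + 2) * bs n (i + 1)) * (bs n j ^ 4)⁻¹, by
    rw [mem_comm_iff]
    simp only [map_mul, map_inv, map_pow, ab_bs n (i := i + 1) (by omega) (by omega),
      ab_bs n (i := i) (by omega) (by omega), ab_bs n (i := i + 2) (by omega) (by omega),
      ab_bs n (i := j) (by omega) (by omega)]
    group⟩

theorem conj_eq {G : Type*} [Group G] {w t x y : G} (h : w * x = y * w) (ht : Commute t x) :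
    (w * (t ^ 4)⁻¹) * x * (w * (t ^ 4)⁻¹)⁻¹ = y := by
  have : Commute ((t ^ 4)⁻¹) x := (ht.pow_left 4).inv_left
  rw [mul_assoc w, this.eq, mul_inv_eq_iff_eq_mul, ← mul_assoc, h, mul_assoc]

theorem conj_diff {G : Type*} [Group G] {k x y x' y' : G} (hx : k * x * k⁻¹ = x')
    (hy : k * y * k⁻¹ = y') : k * (x * y⁻¹) * k⁻¹ = x' * y'⁻¹ := by
  rw [← hx, ← hy]; group

theorem alg_six {G : Type*} [Group G] {a b : G} (h3 : a * a * a = 1)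
    (h1 : a * b * a = b * a * b) (h2 : b * b * b = 1)
    (h4 : a⁻¹ * b * a⁻¹ = b * a⁻¹ * b) : a = 1 := by
  have ea : a⁻¹ = a * a := inv_eq_of_mul_eq_one_right (by rw [← mul_assoc]; exact h3)
  have eb : b * b = b⁻¹ := eq_inv_of_mul_eq_one_left h2
  have e1 : b * a * b⁻¹ * a = b * a⁻¹ * b := by
    rw [← h4, ← eb]
    calc b * a * (b * b) * a = (b * a * b) * b * a := by group
      _ = (a * b * a) * b * a := by rw [← h1]
      _ = a * (b * a * b) * a := by group
      _ = a * (a * b * a) * a := by rw [← h1]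
      _ = (a * a) * b * (a * a) := by group
      _ = _ := by rw [ea]
  have e2 : b⁻¹ * a = a * b := by
    have : a * (b⁻¹ * a) = a * (a * b) := by
      have := mul_left_cancel (a := b) (b := a * (b⁻¹ * a)) (c := a⁻¹ * b)
        (by simpa only [mul_assoc] using e1)
      rw [this, ea, mul_assoc]
    exact mul_left_cancel this
  have e3 : a = a * b * a := by
    rw [h1]
    calc a = b * (b⁻¹ * a) := by group
      _ = _ := by rw [e2, mul_assoc]
  have e4 : b * a = 1 := by
    have : a * 1 = a * (b * a) := by rw [mul_one, ← mul_assoc]; exact e3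
    exact (mul_left_cancel this).symm
  have e5 : b = a⁻¹ := eq_inv_of_mul_eq_one_left e4
  rw [e5, ea] at h1
  have e6 : a = a * a := by
    calc a = a * (a * a * a) := by rw [h3, mul_one]
      _ = a * (a * a) * a := by group
      _ = a * a * a * (a * a) := by rw [h1]
      _ = a * a := by rw [h3, one_mul]
  have : a * 1 = a * a := by rw [mul_one]; exact e6
  exact (mul_left_cancel this).symm

theorem case_six (φ : commutator (BraidGroup 6) →* Equiv.Perm (Fin 5)) : ∀ y, φ y = 1 := by
  by_contra hne
  have hs := sign_trivial 6 (by norm_num) φ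
  set c1 : commutator (BraidGroup 6) := kd 6 (i := 2) (j := 0) (by omega) (by omega) with hc1
  set c2 : commutator (BraidGroup 6) := kd 6 (i := 3) (j := 0) (by omega) (by omega) with hc2
  set c3 : commutator (BraidGroup 6) := kd 6 (i := 4) (j := 0) (by omega) (by omega) with hc3
  set g : commutator (BraidGroup 6) := kswap 6 2 0 (by omega) (by omega) with hg
  set h : commutator (BraidGroup 6) := kswap 6 0 4 (by omega) (by omega) with hh
  have C : ∀ i j, i + 2 ≤ j → j < 5 → Commute (bs 6 i) (bs 6 j) := fun i j hij hj =>
    bs_comm 6 (by omega) (by omega) hij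
  have B : ∀ i, i + 1 < 5 →
      bs 6 i * bs 6 (i + 1) * bs 6 i = bs 6 (i + 1) * bs 6 i * bs 6 (i + 1) := fun i hi =>
    bs_braid 6 (by omega)
  have g2 : (g : BraidGroup 6) * bs 6 2 * (g : BraidGroup 6)⁻¹ = bs 6 4 :=
    conj_eq (braid_swap (B 2 (by omega)) (B 3 (by omega)) (C 2 4 (by omega) (by omega)))
      (C 0 2 (by omega) (by omega))
  have g4 : (g : BraidGroup 6) * bs 6 4 * (g : BraidGroup 6)⁻¹ = bs 6 2 :=
    conj_eq (braid_swap' (B 2 (by omega)) (B 3 (by omega)) (C 2 4 (by omega) (by omega)))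
      (C 0 4 (by omega) (by omega))
  have g0 : (g : BraidGroup 6) * bs 6 0 * (g : BraidGroup 6)⁻¹ = bs 6 0 := by
    refine conj_eq ?_ (Commute.refl _)
    have k2 := (C 0 2 (by omega) (by omega)).symm
    have k3 := (C 0 3 (by omega) (by omega)).symm
    have k4 := (C 0 4 (by omega) (by omega)).symm
    exact (((k3.mul_left k2).mul_left k4).mul_left k3).eq
  have h0 : (h : BraidGroup 6) * bs 6 0 * (h : BraidGroup 6)⁻¹ = bs 6 2 :=
    conj_eq (braid_swap (B 0 (by omega)) (B 1 (by omega)) (C 0 2 (by omega) (by omega)))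
      (C 0 4 (by omega) (by omega)).symm
  have h2 : (h : BraidGroup 6) * bs 6 2 * (h : BraidGroup 6)⁻¹ = bs 6 0 :=
    conj_eq (braid_swap' (B 0 (by omega)) (B 1 (by omega)) (C 0 2 (by omega) (by omega)))
      (C 2 4 (by omega) (by omega)).symm
  have h4 : (h : BraidGroup 6) * bs 6 4 * (h : BraidGroup 6)⁻¹ = bs 6 4 := by
    refine conj_eq ?_ (Commute.refl _)
    have k0 := C 0 4 (by omega) (by omega)
    have k1 := C 1 4 (by omega) (by omega)
    have k2 := C 2 4 (by omega) (by omega)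
    exact (((k1.mul_left k0).mul_left k2).mul_left k1).eq
  have eg1 : g * c1 * g⁻¹ = c3 := Subtype.ext (conj_diff g2 g0)
  have eg3 : g * c3 * g⁻¹ = c1 := Subtype.ext (conj_diff g4 g0)
  have eh1 : h * c1 * h⁻¹ = c1⁻¹ := by
    apply Subtype.ext
    refine (conj_diff h2 h0).trans ?_
    simp [hc1, kd]
  have eh3 : h * c3 * h⁻¹ = c3 * c1⁻¹ := by
    apply Subtype.ext
    refine (conj_diff h4 h0).trans ?_
    simp [hc1, hc3, kd]
  have e13 : c1 * c3 = c3 * c1 := by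
    apply Subtype.ext
    have k02 := C 0 2 (by omega) (by omega)
    have k04 := C 0 4 (by omega) (by omega)
    have k24 := C 2 4 (by omega) (by omega)
    exact ((k24.mul_right k02.symm.inv_right).mul_left
      (k04.inv_left.mul_right (Commute.refl _).inv_inv)).eq
  have br : ∀ {x y t : BraidGroup 6}, x * y * x = y * x * y → Commute t x → Commute t y →
      (x * t⁻¹) * (y * t⁻¹) * (x * t⁻¹) = (y * t⁻¹) * (x * t⁻¹) * (y * t⁻¹) := by
    intro x y t hb hx hy
    have kx : t⁻¹ * x = x * t⁻¹ := hx.inv_left.eq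
    have ky : t⁻¹ * y = y * t⁻¹ := hy.inv_left.eq
    have r : ∀ {x y : BraidGroup 6}, t⁻¹ * x = x * t⁻¹ → t⁻¹ * y = y * t⁻¹ →
        (x * t⁻¹) * (y * t⁻¹) * (x * t⁻¹) = (x * y * x) * (t⁻¹ * t⁻¹ * t⁻¹) := by
      intro x y kx ky
      calc _ = x * (t⁻¹ * y) * (t⁻¹ * x) * t⁻¹ := by simp only [mul_assoc]
        _ = x * y * (t⁻¹ * x) * t⁻¹ * t⁻¹ := by rw [ky, kx]; simp only [mul_assoc]; rw [← mul_assoc t⁻¹ x, kx, mul_assoc]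
        _ = _ := by rw [kx]; simp only [mul_assoc]
    rw [r kx ky, r ky kx, hb]
  have e121 : c1 * c2 * c1 = c2 * c1 * c2 := Subtype.ext
    (br (B 2 (by omega)) (C 0 2 (by omega) (by omega)) (C 0 3 (by omega) (by omega)))
  have e232 : c2 * c3 * c2 = c3 * c2 * c3 := Subtype.ext
    (br (B 3 (by omega)) (C 0 3 (by omega) (by omega)) (C 0 4 (by omega) (by omega)))
  have n1 : φ c1 ≠ 1 := fun hc => hne (trivial_of_c 6 (by norm_num) φ hc)
  have s1 := hs c1
  have s2 := hs c2
  have s3 := hs c3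
  have sg := hs g
  replace eg1 := congrArg φ eg1
  replace eg3 := congrArg φ eg3
  replace eh1 := congrArg φ eh1
  replace eh3 := congrArg φ eh3
  replace e13 := congrArg φ e13
  replace e121 := congrArg φ e121
  replace e232 := congrArg φ e232
  simp only [map_mul, map_inv] at eg1 eg3 eh1 eh3 e13 e121 e232
  generalize φ c1 = x1 at *
  generalize φ c2 = x2 at *
  generalize φ c3 = x3 at *
  generalize φ g = y at *
  generalize φ h = z at *
  by_cases hsq : x1 * x1 = 1
  · have i1 : x1⁻¹ = x1 := inv_eq_of_mul_eq_one_left hsq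
    have i3 : x3⁻¹ = x3 := by
      rw [← eg1, mul_inv_rev, mul_inv_rev, inv_inv, i1, mul_assoc]
    have hw : x1 * x3 ≠ 1 := by
      intro hw
      have h13 : x3 = x1 := by rw [← i1]; exact (inv_eq_of_mul_eq_one_right hw).symm
      rw [h13, eh1, mul_inv_cancel] at eh3
      exact n1 (by simpa using eh3)
    have hyw : y * (x1 * x3) = (x1 * x3) * y := by
      have : y * (x1 * x3) * y⁻¹ = x1 * x3 := by
        calc y * (x1 * x3) * y⁻¹ = (y * x1 * y⁻¹) * (y * x3 * y⁻¹) := by group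
          _ = x1 * x3 := by rw [eg1, eg3, e13]
      exact mul_inv_eq_iff_eq_mul.1 this
    have hcomm := evenCent_five_comm (x1 * x3) (by simp [s1, s3]) hw (x := y) (y := x1)
      (mem_evenCent.2 ⟨sg, hyw.symm⟩)
      (mem_evenCent.2 ⟨s1, by rw [mul_assoc, ← e13]⟩)
    rw [hcomm, mul_inv_cancel_right] at eg1
    apply hw
    rw [← eg1, hsq]
  · obtain ⟨k, hk⟩ := evenCent_five_zpow x1 s1 hsq (mem_evenCent.2 ⟨s3, e13⟩)
    have hz3 : z * x3 * z⁻¹ = x3⁻¹ := by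
      rw [hk, ← conj_zpow, eh1, inv_zpow]
    have q1 : x3 * x3 = x1 := by
      rw [hz3] at eh3
      have : x3⁻¹ * x1 = x3 := by rw [eh3, inv_mul_cancel_right]
      rw [inv_mul_eq_iff_eq_mul] at this
      exact this.symm
    have q2 : x1 * x1 = x3 := by
      calc x1 * x1 = y * (x3 * x3) * y⁻¹ := by rw [← eg3]; group
        _ = x3 := by rw [q1, eg1]
    have q3 : x1 * x1 * x1 = 1 := by
      have : x1 * (x1 * x1 * x1) = x1 * 1 := by
        calc x1 * (x1 * x1 * x1) = (x1 * x1) * (x1 * x1) := by group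
          _ = x1 * 1 := by rw [q2, q1, mul_one]
      exact mul_left_cancel this
    have q4 : x3 = x1⁻¹ := by rw [← q2]; exact eq_inv_of_mul_eq_one_left q3
    have q5 : x2 = (x1 * x2) * x1 * (x1 * x2)⁻¹ := by
      rw [eq_mul_inv_iff_mul_eq, ← mul_assoc, ← e121]
    have q6 : x2 * x2 * x2 = 1 := by
      rw [q5]
      generalize x1 * x2 = w
      calc _ = w * (x1 * x1 * x1) * w⁻¹ := by group
        _ = 1 := by rw [q3]; group
    rw [q4] at e232
    exact n1 (alg_six q3 e121 q6 e232.symm)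

theorem case_seven (φ : commutator (BraidGroup 7) →* Equiv.Perm (Fin 6)) : ∀ y, φ y = 1 := by
  by_contra hne
  have hs := sign_trivial 7 (by norm_num) φ
  set a : commutator (BraidGroup 7) := kd 7 (i := 4) (j := 5) (by omega) (by omega) with ha
  have na : φ a ≠ 1 := fun hc => hne (trivial_of_adj 7 φ (i := 4) (j := 0)
    (by omega) (by omega) (by omega) hc)
  have C : ∀ i, i < 3 → Commute (a : BraidGroup 7) (bs 7 i) := by
    intro i hi
    have k1 : Commute (bs 7 i) (bs 7 4) := bs_comm 7 (by omega) (by omega) (by omega)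
    have k2 : Commute (bs 7 i) (bs 7 5) := bs_comm 7 (by omega) (by omega) (by omega)
    exact (k1.mul_right k2.inv_right).symm
  have mem : ∀ t : commutator (BraidGroup 7), Commute (a : BraidGroup 7) t →
      φ t ∈ evenCent (φ a) := by
    intro t ht
    refine mem_evenCent.2 ⟨hs t, ?_⟩
    rw [← map_mul, ← map_mul]
    exact congrArg φ (Subtype.ext ht)
  have mc := mem (kd 7 (i := 2) (j := 0) (by omega) (by omega))
    ((C 2 (by omega)).mul_right (C 0 (by omega)).inv_right)
  have mu := mem (kd 7 (i := 1) (j := 0) (by omega) (by omega))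
    ((C 1 (by omega)).mul_right (C 0 (by omega)).inv_right)
  have mv := mem (kv 7 (by omega))
    ((((C 0 (by omega)).mul_right (C 1 (by omega))).mul_right (C 0 (by omega)).inv_right).mul_right
      (C 0 (by omega)).inv_right)
  obtain ⟨p, k, hp, hcard⟩ := evenCent_six (φ a) (hs a) na
  have := Fact.mk hp
  have : Group.IsNilpotent (evenCent (φ a)) := (IsPGroup.of_card hcard).isNilpotent
  have key := congrArg φ (kd_key 7 (by omega))
  simp only [map_mul, map_inv] at key
  have := nilpotent_key (c := (⟨_, mc⟩ : evenCent (φ a))) (u := ⟨_, mu⟩) (v := ⟨_, mv⟩)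
    (Subtype.ext key)
  exact hne (trivial_of_c 7 (by omega) φ (congrArg Subtype.val this))

theorem trivial_any (m : ℕ) (hP : ∀ φ : commutator (BraidGroup m) →* Equiv.Perm (Fin (m - 1)),
    ∀ y, φ y = 1) {Y : Type*} [Fintype Y] (hY : Fintype.card Y ≤ m - 1)
    (φ : commutator (BraidGroup m) →* Equiv.Perm Y) : ∀ y, φ y = 1 := by
  intro y
  have hne : Nonempty (Y ↪ Fin (m - 1)) :=
    Function.Embedding.nonempty_of_card_le (by simpa using hY)
  obtain ⟨e⟩ := hne
  have := hP ((Equiv.Perm.viaEmbeddingHom e).comp φ) y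
  apply Equiv.Perm.viaEmbeddingHom_injective e
  rw [map_one]
  exact this

/-- Restriction of an action by permutations to an invariant subset. -/
def restrHom {K X : Type*} [Group K] (ψ : K →* Equiv.Perm X) (p : X → Prop)
    (h : ∀ k x, p (ψ k x) ↔ p x) : K →* Equiv.Perm {x // p x} where
  toFun k := (ψ k).subtypePerm (h k)
  map_one' := by ext x; simp
  map_mul' a b := by
    ext x
    change ψ (a * b) x = ψ a (ψ b x)
    rw [map_mul]
    rfl

theorem restrHom_triv {K X : Type*} [Group K] (ψ : K →* Equiv.Perm X) (p : X → Prop)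
    (h : ∀ k x, p (ψ k x) ↔ p x) (k : K) (hk : restrHom ψ p h k = 1) (x : X) (hx : p x) :
    ψ k x = x := by
  have := congrArg (fun e : Equiv.Perm {x // p x} => (e ⟨x, hx⟩ : X)) hk
  exact this

theorem card_cycleFactors_le {X : Type*} [Fintype X] [DecidableEq X] (u : Equiv.Perm X) :
    2 * u.cycleFactorsFinset.card ≤ Fintype.card X := by
  have h1 : u.cycleType.card = u.cycleFactorsFinset.card := by
    rw [Equiv.Perm.cycleType_def, Multiset.card_map]; rfl
  have h2 : u.cycleType.card • 2 ≤ u.cycleType.sum :=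
    Multiset.card_nsmul_le_sum fun x hx => Equiv.Perm.two_le_of_mem_cycleType hx
  have h3 := u.sum_cycleType
  have h4 : u.support.card ≤ Fintype.card X := Finset.card_le_univ _
  rw [smul_eq_mul] at h2
  omega

theorem fix_support (m : ℕ) (hm : 5 ≤ m)
    (hP : ∀ φ : commutator (BraidGroup m) →* Equiv.Perm (Fin (m - 1)), ∀ y, φ y = 1)
    {X : Type*} [Fintype X] [DecidableEq X] (ψ : commutator (BraidGroup m) →* Equiv.Perm X)
    (u : Equiv.Perm X) (hu : ∀ k, ψ k * u = u * ψ k) (hX : Fintype.card X ≤ 2 * (m - 1) + 1) :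
    ∀ k x, u x ≠ x → ψ k x = x := by
  have hux : ∀ k x, ψ k (u x) = u (ψ k x) := fun k x => congrArg (fun e : Equiv.Perm X => e x) (hu k)
  let θ : commutator (BraidGroup m) →* Subgroup.centralizer {u} :=
    ψ.codRestrict _ (fun k => Subgroup.mem_centralizer_singleton_iff.2 (hu k))
  have ht : ∀ k, (Equiv.Perm.OnCycleFactors.toPermHom u) (θ k) = 1 := by
    apply trivial_any m hP ?_ ((Equiv.Perm.OnCycleFactors.toPermHom u).comp θ)
    have := card_cycleFactors_le u
    rw [Fintype.card_coe]
    omega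
  have hc : ∀ k, ∀ c ∈ u.cycleFactorsFinset, Commute (ψ k) c := fun k =>
    (Equiv.Perm.OnCycleFactors.mem_ker_toPermHom_iff u (θ k)).1 (MonoidHom.mem_ker.2 (ht k))
  have hz : ∀ k x, u x ≠ x → ∃ i : ℤ, (u ^ i) x = ψ k x := by
    intro k x hx
    have hmem : u.cycleOf x ∈ u.cycleFactorsFinset :=
      Equiv.Perm.cycleOf_mem_cycleFactorsFinset_iff.2 (Equiv.Perm.mem_support.2 hx)
    have h1 : ψ k (u.cycleOf x x) = u.cycleOf x (ψ k x) :=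
      congrArg (fun e : Equiv.Perm X => e x) (hc k _ hmem)
    have h2 : u.cycleOf x (ψ k x) ≠ ψ k x := by
      rw [← h1, Equiv.Perm.cycleOf_apply_self]
      exact fun h => hx ((ψ k).injective h)
    by_contra hcon
    exact h2 (Equiv.Perm.cycleOf_apply_of_not_sameCycle hcon)
  have hinv : ∀ k x, u (ψ k x) ≠ ψ k x ↔ u x ≠ x := by
    intro k x
    rw [← hux, (ψ k).injective.ne_iff]
  have hzc : ∀ k (i : ℤ) x, ψ k ((u ^ i) x) = (u ^ i) (ψ k x) := by
    intro k i x
    have : Commute (ψ k) (u ^ i) := Commute.zpow_right (hu k) i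
    exact congrArg (fun e : Equiv.Perm X => e x) this
  intro k x hx
  refine restrHom_triv ψ (fun x => u x ≠ x) hinv k ?_ x hx
  refine trivial_of_commImage m hm (restrHom ψ (fun x => u x ≠ x) hinv) ?_ k
  intro a b
  ext ⟨y, hy⟩
  change ψ a (ψ b y) = ψ b (ψ a y)
  obtain ⟨i, hi⟩ := hz a y hy
  obtain ⟨j, hj⟩ := hz b y hy
  rw [← hj, hzc, ← hi, hzc, ← hj, ← Equiv.Perm.mul_apply, ← Equiv.Perm.mul_apply,
    ← zpow_add, ← zpow_add, add_comm]

theorem big_step (m : ℕ) (hm : 5 ≤ m)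
    (hP : ∀ φ : commutator (BraidGroup m) →* Equiv.Perm (Fin (m - 1)), ∀ y, φ y = 1)
    (φ : commutator (BraidGroup (m + 3)) →* Equiv.Perm (Fin (m + 2))) : ∀ y, φ y = 1 := by
  obtain ⟨F, hF⟩ := braid_lift m (fun i => bs (m + 3) i)
    (fun i j hij hj => bs_comm (m + 3) (by omega) (by omega) hij)
    (fun i hi => bs_braid (m + 3) (by omega))
  have hFc : ∀ x : BraidGroup m, x ∈ commutator (BraidGroup m) →
      F x ∈ commutator (BraidGroup (m + 3)) := by
    intro x hx
    rw [mem_comm_iff]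
    exact Abelianization.commutator_subset_ker (Abelianization.of.comp F) hx
  let ι : commutator (BraidGroup m) →* commutator (BraidGroup (m + 3)) :=
    (F.comp (commutator (BraidGroup m)).subtype).codRestrict _ (fun x => hFc x x.2)
  have hcm : ∀ j, m ≤ j → j < m + 2 → ∀ x, Commute (bs (m + 3) j) (F x) := by
    intro j hj hj2 x
    have : (Subgroup.centralizer {bs (m + 3) j}).comap F = ⊤ := by
      apply bs_closure
      intro i hi
      rw [Subgroup.mem_comap, hF i hi, Subgroup.mem_centralizer_singleton_iff]
      exact bs_comm (m + 3) (by omega) (by omega) (by omega)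
    have hx : x ∈ (Subgroup.centralizer {bs (m + 3) j}).comap F := by rw [this]; trivial
    exact (Subgroup.mem_centralizer_singleton_iff.1 hx).symm
  set w : commutator (BraidGroup (m + 3)) :=
    kd (m + 3) (i := m) (j := m + 1) (by omega) (by omega) with hw
  have hcw : ∀ k, φ (ι k) * φ w = φ w * φ (ι k) := by
    intro k
    rw [← map_mul, ← map_mul]
    refine congrArg φ (Subtype.ext ?_)
    exact ((hcm m le_rfl (by omega) k).mul_left
      (hcm (m + 1) (by omega) (by omega) k).inv_left).symm.eq
  have hfix := fix_support m hm hP (φ.comp ι) (φ w) hcw (by rw [Fintype.card_fin]; omega)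
  by_cases hs : 3 ≤ (φ w).support.card
  · have htriv : ∀ k, φ (ι k) = 1 := by
      intro k
      ext1 x
      by_cases hx : φ w x = x
      · have hinv : ∀ k x, φ w ((φ.comp ι) k x) = (φ.comp ι) k x ↔ φ w x = x := by
          intro k x
          have : φ w ((φ.comp ι) k x) = (φ.comp ι) k (φ w x) :=
            (congrArg (fun e : Equiv.Perm (Fin (m + 2)) => e x) (hcw k)).symm
          rw [this, ((φ.comp ι) k).injective.eq_iff]
        refine restrHom_triv (φ.comp ι) (fun x => φ w x = x) hinv k ?_ x hx
        refine trivial_any m hP ?_ (restrHom (φ.comp ι) (fun x => φ w x = x) hinv) k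
        rw [Fintype.card_subtype]
        have h1 : (Finset.univ.filter fun x => φ w x = x) = (φ w).supportᶜ := by
          ext x; simp
        rw [h1, Finset.card_compl, Fintype.card_fin]
        omega
      · exact hfix k x hx
    apply trivial_of_c (m + 3) (by omega)
    have h2 := htriv (kd m (i := 2) (j := 0) (by omega) (by omega))
    rw [← h2]
    refine congrArg φ (Subtype.ext ?_)
    change _ = F (bs m 2 * (bs m 0)⁻¹)
    rw [map_mul, map_inv, hF 2 (by omega), hF 0 (by omega)]
    rfl
  · have hsg := sign_trivial (m + 3) (by omega) φ w
    refine trivial_of_adj (m + 3) φ (i := m) (j := 0) (by omega) (by omega) (by omega) ?_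
    change φ w = 1
    by_contra hne
    have h2 : 2 ≤ (φ w).support.card := Equiv.Perm.two_le_card_support_of_ne_one hne
    have h3 : (φ w).IsSwap := Equiv.Perm.card_support_eq_two.1 (by omega)
    rw [h3.sign_eq] at hsg
    exact absurd hsg (by decide)

theorem main_trivial (n : ℕ) (hn : 5 ≤ n) :
    ∀ φ : commutator (BraidGroup n) →* Equiv.Perm (Fin (n - 1)), ∀ y, φ y = 1 := by
  induction n using Nat.strong_induction_on with
  | _ n ih =>
    by_cases h5 : n = 5
    · subst h5; exact case_five
    by_cases h6 : n = 6
    · subst h6; exact case_six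
    by_cases h7 : n = 7
    · subst h7; exact case_seven
    obtain ⟨m, rfl⟩ : ∃ m, n = m + 3 := ⟨n - 3, by omega⟩
    exact big_step m (by omega) (ih m (by omega) (by omega))

/-- For `n ≥ 5` and `2 ≤ r ≤ n - 1`, the commutator subgroup of the braid group has no
subgroup of index `r`. -/
theorem no_subgroup_of_small_index (n r : ℕ) (hn : 5 ≤ n) (hr2 : 2 ≤ r) (hrn : r ≤ n - 1) :
    ¬ ∃ H : Subgroup ↥(commutator (BraidGroup n)), H.index = r := by
  rintro ⟨H, hH⟩
  have hfi : H.FiniteIndex := ⟨by omega⟩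
  let _ : Fintype (↥(commutator (BraidGroup n)) ⧸ H) := Fintype.ofFinite _
  have hcard : Fintype.card (↥(commutator (BraidGroup n)) ⧸ H) ≤ n - 1 := by
    rw [← Nat.card_eq_fintype_card]
    change H.index ≤ n - 1
    omega
  have ht := trivial_any n (main_trivial n hn) hcard
    (MulAction.toPermHom ↥(commutator (BraidGroup n)) (↥(commutator (BraidGroup n)) ⧸ H))
  have htop : H = ⊤ := by
    rw [eq_top_iff]
    intro k _
    have h1 := congrArg (fun e : Equiv.Perm (↥(commutator (BraidGroup n)) ⧸ H) =>
      e ((1 : ↥(commutator (BraidGroup n))) : ↥(commutator (BraidGroup n)) ⧸ H)) (ht k)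
    have h2 : ((k * 1 : ↥(commutator (BraidGroup n))) : ↥(commutator (BraidGroup n)) ⧸ H) =
      ((1 : ↥(commutator (BraidGroup n))) : ↥(commutator (BraidGroup n)) ⧸ H) := h1
    rw [mul_one, eq_comm, QuotientGroup.eq] at h2
    simpa using h2
  rw [htop, Subgroup.index_top] at hH
  omega
end

section
/- For every n ≥ 5, every nontrivial group homomorphism f : K_n →* S_n is transitive: for all i, j ∈ Fin n there exists g ∈ K_n with (f g) i = j. -/
open Equiv

def GoodFive (a : Perm (Fin 5)) : Prop :=
  ∀ c, a * c = c * a → Perm.sign c = 1 → a ≠ c → ∀ b, a * b * a = b * a * b →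
    b * c * b = c * b * c → False

def GoodSix (a : Perm (Fin 6)) : Prop :=
  ∀ c, a * c = c * a → Perm.sign c = 1 → ∀ d, a * d = d * a → c * d * c = d * c * d → c = d

instance (a : Perm (Fin 5)) : Decidable (GoodFive a) := by unfold GoodFive; infer_instance
instance (a : Perm (Fin 6)) : Decidable (GoodSix a) := by unfold GoodSix; infer_instance

theorem GoodFive.conj {a r : Perm (Fin 5)} (h : IsConj a r) (hr : GoodFive r) : GoodFive a := by
  obtain ⟨s, rfl⟩ := isConj_iff.1 h
  intro c hac hc hne b h1 h2
  have e : s * a * s⁻¹ = MulAut.conj s a := rfl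
  rw [e] at hr
  refine hr (MulAut.conj s c) ?_ ?_ ?_ (MulAut.conj s b) ?_ ?_
  · rw [← map_mul, hac, map_mul]
  · simp [hc]
  · exact fun hh => hne ((MulAut.conj s).injective hh)
  · simp only [← map_mul, h1]
  · simp only [← map_mul, h2]

theorem GoodSix.conj {a r : Perm (Fin 6)} (h : IsConj a r) (hr : GoodSix r) : GoodSix a := by
  obtain ⟨s, rfl⟩ := isConj_iff.1 h
  intro c hac hc d had h1
  have e : s * a * s⁻¹ = MulAut.conj s a := rfl
  rw [e] at hr
  apply (MulAut.conj s).injective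
  refine hr (MulAut.conj s c) ?_ ?_ (MulAut.conj s d) ?_ ?_
  · rw [← map_mul, hac, map_mul]
  · simp [hc]
  · rw [← map_mul, had, map_mul]
  · simp only [← map_mul, h1]

theorem prime_types {k : ℕ} (hk : k ≤ 6) (a : Perm (Fin k)) (ha : Perm.sign a = 1)
    (hp : (orderOf a).Prime) :
    a.cycleType = {2, 2} ∨ a.cycleType = {3} ∨ a.cycleType = {3, 3} ∧ 6 ≤ k ∨ a.cycleType = {5} := by
  obtain ⟨m, hm⟩ := Perm.cycleType_prime_order hp
  have hs := Perm.sum_cycleType a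
  have hsup : a.support.card ≤ k := by simpa using Finset.card_le_univ a.support
  have hsg := Perm.sign_of_cycleType a
  rw [ha] at hsg
  rw [hm] at hs hsg ⊢
  generalize orderOf a = p at *
  simp only [Multiset.sum_replicate, smul_eq_mul, Multiset.card_replicate] at hs hsg
  have hp2 := hp.two_le
  have hle : (m + 1) * p ≤ 6 := by omega
  have hp6 : p ≤ 6 := by nlinarith
  have hm3 : m + 1 ≤ 3 := by nlinarith
  have : m = 0 ∨ m = 1 ∨ m = 2 := by omega
  rcases this with rfl | rfl | rfl <;> interval_cases p <;>
    first
    | (exfalso; revert hsg; decide)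
    | (exfalso; revert hp; decide)
    | omega
    | (left; decide)
    | (right; left; decide)
    | (right; right; left; exact ⟨by decide, by omega⟩)
    | (right; right; right; decide)

theorem five_order : ∀ a : Perm (Fin 5), Perm.sign a = 1 → a ^ 2 = 1 ∨ a ^ 3 = 1 ∨ a ^ 5 = 1 := by
  decide +kernel

theorem good5_1 : GoodFive (swap 0 1 * swap 2 3) := by decide +kernel
theorem good5_2 : GoodFive (swap 0 1 * swap 1 2) := by decide +kernel
theorem good5_3 : GoodFive (swap 0 1 * swap 1 2 * swap 2 3 * swap 3 4) := by decide +kernel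
theorem good6_1 : GoodSix (swap 0 1 * swap 2 3) := by decide +kernel
theorem good6_2 : GoodSix (swap 0 1 * swap 1 2) := by decide +kernel
theorem good6_3 : GoodSix (swap 0 1 * swap 1 2 * (swap 3 4 * swap 4 5)) := by decide +kernel
theorem good6_4 : GoodSix (swap 0 1 * swap 1 2 * swap 2 3 * swap 3 4) := by decide +kernel

theorem good_five (a : Perm (Fin 5)) (ha : Perm.sign a = 1) (h1 : a ≠ 1) : GoodFive a := by
  have hp : (orderOf a).Prime := by
    rcases five_order a ha with h | h | h
    · rw [orderOf_eq_prime (p := 2) (hp := ⟨by norm_num⟩) h h1]; norm_num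
    · rw [orderOf_eq_prime (p := 3) (hp := ⟨by norm_num⟩) h h1]; norm_num
    · rw [orderOf_eq_prime (p := 5) (hp := ⟨by norm_num⟩) h h1]; norm_num
  rcases prime_types (by norm_num) a ha hp with h | h | h | h
  · exact good5_1.conj (Perm.isConj_iff_cycleType_eq.2 (h.trans (by decide +kernel)))
  · exact good5_2.conj (Perm.isConj_iff_cycleType_eq.2 (h.trans (by decide +kernel)))
  · omega
  · exact good5_3.conj (Perm.isConj_iff_cycleType_eq.2 (h.trans (by decide +kernel)))

theorem good_six (a : Perm (Fin 6)) (ha : Perm.sign a = 1) (h1 : a ≠ 1) : GoodSix a := by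
  have ho : orderOf a ≠ 1 := by simpa using h1
  obtain ⟨p, hp, hpd⟩ := Nat.exists_prime_and_dvd ho
  set e := orderOf a / p with he
  have hb : orderOf (a ^ e) = p := orderOf_pow_orderOf_div (orderOf_pos a).ne' hpd
  have key : GoodSix (a ^ e) := by
    have hs : Perm.sign (a ^ e) = 1 := by simp [ha]
    rcases prime_types le_rfl (a ^ e) hs (hb ▸ hp) with h | h | h | h
    · exact good6_1.conj (Perm.isConj_iff_cycleType_eq.2 (h.trans (by decide +kernel)))
    · exact good6_2.conj (Perm.isConj_iff_cycleType_eq.2 (h.trans (by decide +kernel)))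
    · exact good6_3.conj (Perm.isConj_iff_cycleType_eq.2 (h.1.trans (by decide +kernel)))
    · exact good6_4.conj (Perm.isConj_iff_cycleType_eq.2 (h.trans (by decide +kernel)))
  intro c hac hc d had h
  exact key c (Commute.pow_left hac e) hc d (Commute.pow_left had e) h

section braid

variable {n : ℕ}

/-- generator with natural number index -/
def sg (n i : ℕ) (h : i + 1 < n) : BraidGroup n := braidGen ⟨i, by omega⟩

theorem sg_comm {i j : ℕ} (hi : i + 1 < n) (hj : j + 1 < n) (hij : i + 2 ≤ j) :
    sg n i hi * sg n j hj = sg n j hj * sg n i hi := by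
  have : (PresentedGroup.mk (braidRels n)) (FreeGroup.of ⟨i, by omega⟩ * FreeGroup.of ⟨j, by omega⟩ *
      (FreeGroup.of ⟨i, by omega⟩)⁻¹ * (FreeGroup.of ⟨j, by omega⟩)⁻¹) = 1 := by
    apply PresentedGroup.one_of_mem
    left
    refine ⟨⟨i, by omega⟩, ⟨j, by omega⟩, ?_, rfl⟩
    rw [abs_sub_comm, abs_of_nonneg] <;> simp <;> omega
  simp only [map_mul, map_inv] at this
  have h2 := eq_of_mul_inv_eq_one this
  exact mul_inv_eq_iff_eq_mul.1 h2

theorem sg_comm' {i j : ℕ} (hi : i + 1 < n) (hj : j + 1 < n) (hij : i + 2 ≤ j ∨ j + 2 ≤ i ∨ i = j) :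
    Commute (sg n i hi) (sg n j hj) := by
  rcases hij with h | h | h
  · exact sg_comm hi hj h
  · exact (sg_comm hj hi h).symm
  · subst h; exact Commute.refl _

theorem sg_braid {i : ℕ} (hj : i + 1 + 1 < n) :
    sg n i (by omega) * sg n (i+1) hj * sg n i (by omega) =
      sg n (i+1) hj * sg n i (by omega) * sg n (i+1) hj := by
  have : (PresentedGroup.mk (braidRels n)) (FreeGroup.of ⟨i, by omega⟩ * FreeGroup.of ⟨i+1, by omega⟩ *
      FreeGroup.of ⟨i, by omega⟩ *
      (FreeGroup.of ⟨i+1, by omega⟩)⁻¹ * (FreeGroup.of ⟨i, by omega⟩)⁻¹ *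
      (FreeGroup.of ⟨i+1, by omega⟩)⁻¹) = 1 := by
    apply PresentedGroup.one_of_mem
    right
    refine ⟨⟨i, by omega⟩, ⟨i+1, by omega⟩, ?_, rfl⟩
    simp
  simp only [map_mul, map_inv] at this
  have h2 := eq_of_mul_inv_eq_one this
  rw [mul_inv_eq_iff_eq_mul, mul_inv_eq_iff_eq_mul] at h2
  exact h2

theorem sg_closure : Subgroup.closure {x | ∃ i h, x = sg n i h} = ⊤ := by
  rw [eq_top_iff, ← PresentedGroup.closure_range_of (braidRels n), Subgroup.closure_le]
  rintro _ ⟨i, rfl⟩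
  exact Subgroup.subset_closure ⟨i.1, by omega, rfl⟩

/-- two braided elements that commute are equal -/
theorem eq_of_braid_comm {G : Type*} [Group G] {a b : G} (h : a * b * a = b * a * b)
    (hc : a * b = b * a) : a = b := by
  rw [hc] at h
  exact mul_left_cancel h

theorem all_eq_of_adj {G : Type*} [Group G] (q : BraidGroup n →* G) {i : ℕ} (hi : i + 1 + 1 < n)
    (h : q (sg n i (by omega)) = q (sg n (i+1) hi)) :
    ∀ j hj, q (sg n j hj) = q (sg n i (by omega)) := by
  have up : ∀ j, ∀ hj : i + j + 1 + 1 < n,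
      q (sg n (i+j) (by omega)) = q (sg n i (by omega)) ∧
      q (sg n (i+j+1) hj) = q (sg n i (by omega)) := by
    intro j
    induction j with
    | zero => intro hj; exact ⟨rfl, h.symm⟩
    | succ j ih =>
      intro hj
      obtain ⟨h1, h2⟩ := ih (by omega)
      refine ⟨h2, ?_⟩
      have hb := congrArg q (sg_braid (n := n) (i := i + j + 1) hj)
      have hc := congrArg q (sg_comm (n := n) (i := i + j) (j := i+j+1+1) (by omega) hj (by omega))
      simp only [map_mul] at hb hc
      rw [h1, ← h2] at hc
      exact (eq_of_braid_comm hb hc).symm.trans h2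
  have down : ∀ j, ∀ hj : j ≤ i,
      q (sg n (i-j) (by omega)) = q (sg n i (by omega)) ∧
      q (sg n (i-j+1) (by omega)) = q (sg n i (by omega)) := by
    intro j
    induction j with
    | zero => intro hj; exact ⟨rfl, h.symm⟩
    | succ j ih =>
      intro hj
      obtain ⟨h1, h2⟩ := ih (by omega)
      obtain ⟨t, ht⟩ : ∃ t, i - j = t + 1 := ⟨i - (j+1), by omega⟩
      have ht' : i - (j+1) = t := by omega
      simp only [ht, ht'] at h1 h2 ⊢
      refine ⟨?_, h1⟩
      have hb := congrArg q (sg_braid (n := n) (i := t) (by omega))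
      have hc := congrArg q (sg_comm (n := n) (i := t) (j := t+1+1) (by omega) (by omega) (by omega))
      simp only [map_mul] at hb hc
      rw [h2, ← h1] at hc
      exact (eq_of_braid_comm hb hc).trans h1
  intro j hj
  rcases le_total j i with hle | hle
  · have := (down (i - j) (by omega)).1
    simpa only [show i - (i - j) = j by omega] using this
  · rcases Nat.eq_or_lt_of_le hle with rfl | hlt
    · rfl
    · have := (up (j - i - 1) (by omega)).2
      simpa only [show i + (j - i - 1) + 1 = j by omega] using this

theorem all_eq_of_far (hn : 5 ≤ n) {G : Type*} [Group G] (q : BraidGroup n →* G)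
    (h : q (sg n 0 (by omega)) = q (sg n 2 (by omega))) :
    ∀ j hj, q (sg n j hj) = q (sg n 0 (by omega)) := by
  have hb := congrArg q (sg_braid (n := n) (i := 2) (by omega))
  have hc := congrArg q (sg_comm (n := n) (i := 0) (j := 3) (by omega) (by omega) (by omega))
  simp only [map_mul] at hb hc
  rw [h] at hc
  have h3 := all_eq_of_adj q (i := 2) (by omega) (eq_of_braid_comm hb hc)
  intro j hj
  rw [h3 j hj, h3 0]

theorem ab_eq (i j : ℕ) (hi : i + 1 < n) (hj : j + 1 < n) :
    Abelianization.of (sg n i hi) = Abelianization.of (sg n j hj) := by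
  have : ∀ k hk, Abelianization.of (sg n k hk) = Abelianization.of (sg n 0 (by omega)) := by
    intro k
    induction k with
    | zero => intro _; rfl
    | succ k ih =>
      intro hk
      rw [← ih (by omega)]
      have hb := congrArg Abelianization.of (sg_braid (n := n) (i := k) hk)
      simp only [map_mul] at hb
      exact (eq_of_braid_comm hb (mul_comm _ _)).symm
  rw [this i, this j]

theorem mem_comm_iff_s16 (g : BraidGroup n) :
    g ∈ commutator (BraidGroup n) ↔ Abelianization.of g = 1 := by
  rw [← Abelianization.ker_of, MonoidHom.mem_ker]

/-- the element `σ_i σ_j⁻¹` of the commutator subgroup -/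
def dd (n i j : ℕ) (hi : i + 1 < n) (hj : j + 1 < n) : commutator (BraidGroup n) :=
  ⟨sg n i hi * (sg n j hj)⁻¹, by rw [mem_comm_iff_s16, map_mul, map_inv, ab_eq i j hi hj, mul_inv_cancel]⟩

theorem decomp (i : ℕ) (hi : i + 1 < n) (g : BraidGroup n) :
    ∃ z : ℤ, g * (sg n i hi) ^ (-z) ∈ commutator (BraidGroup n) := by
  have : Abelianization.of g ∈ Subgroup.zpowers (Abelianization.of (sg n i hi)) := by
    have hle : (⊤ : Subgroup (BraidGroup n)) ≤
        (Subgroup.zpowers (Abelianization.of (sg n i hi))).comap Abelianization.of := by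
      rw [← sg_closure, Subgroup.closure_le]
      rintro _ ⟨j, hj, rfl⟩
      simp only [Subgroup.coe_comap, Set.mem_preimage, SetLike.mem_coe]
      rw [ab_eq j i hj hi]
      exact Subgroup.mem_zpowers _
    exact hle (Subgroup.mem_top g)
  obtain ⟨z, hz⟩ := this
  refine ⟨z, ?_⟩
  rw [mem_comm_iff_s16, map_mul, map_zpow, zpow_neg, ← hz, mul_inv_cancel]

theorem kill {G : Type*} [Group G] (f : commutator (BraidGroup n) →* G)
    (x : commutator (BraidGroup n)) (i : ℕ) (hi : i + 1 < n) (hx : Commute (sg n i hi) x.1)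
    (hfx : f x = 1)
    (hall : ∀ (Q : Type) [Group Q] (q : BraidGroup n →* Q), q x.1 = 1 →
      ∃ t, ∀ j hj, q (sg n j hj) = t) : f = 1 := by
  set M : Subgroup (BraidGroup n) := f.ker.map (commutator (BraidGroup n)).subtype with hM
  have h1 : Subgroup.normalClosure {x.1} ≤ M := by
    rw [Subgroup.normalClosure, Subgroup.closure_le]
    intro y hy
    obtain ⟨_, rfl, hy⟩ := Group.mem_conjugatesOfSet_iff.1 hy
    obtain ⟨g, rfl⟩ := isConj_iff.1 hy
    obtain ⟨z, hz⟩ := decomp i hi g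
    refine ⟨⟨_, hz⟩ * x * ⟨_, hz⟩⁻¹, ?_, ?_⟩
    · simp [MonoidHom.mem_ker, hfx]
    · have hc : sg n i hi ^ (-z) * x.1 = x.1 * sg n i hi ^ (-z) := (hx.zpow_left (-z))
      simp only [Subgroup.subtype_apply, Subgroup.coe_mul, Subgroup.coe_inv]
      rw [mul_assoc g, hc]
      group
  obtain ⟨t, ht⟩ := hall (BraidGroup n ⧸ Subgroup.normalClosure {x.1})
    (QuotientGroup.mk' _) (by
      rw [← MonoidHom.mem_ker, QuotientGroup.ker_mk']
      exact Subgroup.subset_normalClosure rfl)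
  have h2 : commutator (BraidGroup n) ≤ Subgroup.normalClosure {x.1} := by
    have hr : ∀ g, (QuotientGroup.mk' (Subgroup.normalClosure {x.1})) g ∈ Subgroup.zpowers t := by
      have hle : (⊤ : Subgroup (BraidGroup n)) ≤ (Subgroup.zpowers t).comap
          (QuotientGroup.mk' (Subgroup.normalClosure {x.1})) := by
        rw [← sg_closure, Subgroup.closure_le]
        rintro _ ⟨j, hj, rfl⟩
        simp only [Subgroup.coe_comap, Set.mem_preimage, SetLike.mem_coe]
        rw [ht j hj]
        exact Subgroup.mem_zpowers _
      exact fun g => hle (Subgroup.mem_top g)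
    refine Subgroup.commutator_le.2 ?_
    intro a _ b _
    rw [← QuotientGroup.ker_mk' (Subgroup.normalClosure {x.1}), MonoidHom.mem_ker,
      map_commutatorElement, commutatorElement_eq_one_iff_mul_comm]
    obtain ⟨u, hu⟩ := hr a
    obtain ⟨v, hv⟩ := hr b
    rw [← hu, ← hv]
    exact (Commute.refl t).zpow_zpow u v
  ext g
  obtain ⟨y, hy, hyg⟩ := h1 (h2 g.2)
  have : y = g := Subtype.ext hyg
  subst this
  exact hy

theorem kill_adj (hn : 5 ≤ n) {G : Type*} [Group G] (f : commutator (BraidGroup n) →* G)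
    {i : ℕ} (hi1 : i ≠ 1) (hi : i + 1 + 1 < n) (h : f (dd n i (i+1) (by omega) hi) = 1) : f = 1 := by
  obtain ⟨k, hk, hk1, hk2⟩ : ∃ k, k + 1 < n ∧ (k + 2 ≤ i ∨ i + 2 ≤ k ∨ k = i) ∧
      (k + 2 ≤ i + 1 ∨ i + 1 + 2 ≤ k ∨ k = i + 1) := by
    by_cases h0 : i = 0
    · exact ⟨3, by omega, by omega, by omega⟩
    · exact ⟨0, by omega, by omega, by omega⟩
  refine kill f _ k hk ?_ h ?_
  · exact (sg_comm' _ _ hk1).mul_right (sg_comm' _ _ hk2).inv_right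
  · intro Q _ q hq
    refine ⟨q (sg n i (by omega)), all_eq_of_adj q hi ?_⟩
    simpa [dd, mul_inv_eq_one] using hq

theorem kill_far (hn : 5 ≤ n) {G : Type*} [Group G] (f : commutator (BraidGroup n) →* G)
    (h : f (dd n 0 2 (by omega) (by omega)) = 1) : f = 1 := by
  refine kill f _ 0 (by omega) ?_ h ?_
  · exact (sg_comm' _ _ (by omega)).mul_right (sg_comm' _ _ (by omega)).inv_right
  · intro Q _ q hq
    refine ⟨q (sg n 0 (by omega)), all_eq_of_far hn q ?_⟩
    simpa [dd, mul_inv_eq_one] using hq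

end braid

section perms

/-- every subgroup of finite index less than `m` is everything -/
def NoSmall (G : Type*) [Group G] (m : ℕ) : Prop :=
  ∀ H : Subgroup G, H.index ≠ 0 → H.index < m → H = ⊤

theorem noSmall_of_hom {G : Type*} [Group G] {k : ℕ} (h : ∀ f : G →* Perm (Fin k), f = 1) :
    NoSmall G (k + 1) := by
  intro H h0 hlt
  have : H.FiniteIndex := ⟨h0⟩
  have : Finite (G ⧸ H) := inferInstance
  have : Fintype (G ⧸ H) := Fintype.ofFinite _
  have hc : Fintype.card (G ⧸ H) ≤ Fintype.card (Fin k) := by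
    rw [← Nat.card_eq_fintype_card, Fintype.card_fin]
    have : H.index = Nat.card (G ⧸ H) := rfl
    omega
  obtain ⟨e⟩ := Function.Embedding.nonempty_of_card_le hc
  have h1 := h ((Perm.viaEmbeddingHom e).comp (MulAction.toPermHom G (G ⧸ H)))
  rw [eq_top_iff]
  intro g _
  have h2 := DFunLike.congr_fun h1 g
  simp only [MonoidHom.comp_apply, MonoidHom.one_apply] at h2
  have h3 : MulAction.toPermHom G (G ⧸ H) g = 1 :=
    Perm.viaEmbeddingHom_injective e (h2.trans (map_one _).symm)
  have h4 := congrArg (fun s => s ((1 : G) : G ⧸ H)) h3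
  simp only [MulAction.toPermHom_apply, MulAction.toPerm_apply, Perm.one_apply,
    MulAction.Quotient.smul_mk, smul_eq_mul, mul_one] at h4
  have h5 := QuotientGroup.eq.1 h4.symm
  simpa using h5

theorem orbit_big {G X : Type*} [Group G] [Finite X] [MulAction G X] {m : ℕ} (hN : NoSmall G m)
    (p : X) (hp : ∃ h : G, h • p ≠ p) : m ≤ (MulAction.orbit G p).ncard := by
  by_contra hlt
  push Not at hlt
  rw [← MulAction.index_stabilizer] at hlt
  have h0 : (MulAction.stabilizer G p).index ≠ 0 := by
    rw [MulAction.index_stabilizer]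
    exact ((Set.ncard_pos (Set.toFinite _)).2 (MulAction.nonempty_orbit p)).ne'
  have := hN _ h0 hlt
  obtain ⟨h, hh⟩ := hp
  apply hh
  have : h ∈ MulAction.stabilizer G p := by rw [this]; trivial
  exact this

theorem centralizer_fix {G X : Type*} [Group G] [Finite X] [MulAction G X] {m : ℕ}
    (hperf : commutator G = ⊤) (hN : NoSmall G m) (hX : Nat.card X < 2 * m)
    (g : Perm X) (hg : ∀ (h : G) (x : X), g (h • x) = h • g x)
    (p : X) (hp : ∃ h : G, h • p ≠ p) : g p = p := by
  by_contra hgp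
  have hb1 := orbit_big hN p hp
  have hp2 : ∃ h : G, h • g p ≠ g p := by
    obtain ⟨h, hh⟩ := hp
    exact ⟨h, fun h' => hh (g.injective (by rw [hg, h']))⟩
  have hb2 := orbit_big hN (g p) hp2
  have hmeet : ¬ Disjoint (MulAction.orbit G p) (MulAction.orbit G (g p)) := by
    intro hd
    have h1 := Set.ncard_union_eq hd
    have h2 := Set.ncard_le_card (MulAction.orbit G p ∪ MulAction.orbit G (g p))
    omega
  obtain ⟨x, ⟨h1, hx1⟩, ⟨h2, hx2⟩⟩ := Set.not_disjoint_iff.1 hmeet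
  have hh0 : (h2⁻¹ * h1) • p = g p := by
    rw [mul_smul, inv_smul_eq_iff]
    exact hx1.trans hx2.symm
  have hgz : ∀ (z : ℤ) (h : G) (x : X), (g ^ z) (h • x) = h • (g ^ z) x := by
    intro z h x
    have hc : Commute g (MulAction.toPerm h) := by
      ext y; exact hg h y
    exact congrArg (fun s : Perm X => s x) (hc.zpow_left z).eq
  let H' : Subgroup G :=
    { carrier := {h | ∃ z : ℤ, h • p = (g ^ z) p}
      one_mem' := ⟨0, by simp⟩
      mul_mem' := by
        rintro a b ⟨z, hz⟩ ⟨w, hw⟩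
        refine ⟨w + z, ?_⟩
        rw [mul_smul, hw, ← hgz, hz, zpow_add, Perm.mul_apply]
      inv_mem' := by
        rintro a ⟨z, hz⟩
        refine ⟨-z, ?_⟩
        rw [inv_smul_eq_iff, ← hgz, hz, ← Perm.mul_apply, ← zpow_add]
        simp }
  have hle : MulAction.stabilizer G p ≤ H' := fun h hh => ⟨0, by simpa using hh⟩
  have hmul := Subgroup.relIndex_mul_index hle
  have hidx : (MulAction.stabilizer G p).index ≤ Nat.card X := by
    rw [MulAction.index_stabilizer]; exact Set.ncard_le_card _
  have h0 : (MulAction.stabilizer G p).index ≠ 0 := by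
    rw [MulAction.index_stabilizer]
    exact ((Set.ncard_pos (Set.toFinite _)).2 (MulAction.nonempty_orbit p)).ne'
  have hr1 : (MulAction.stabilizer G p).relIndex H' ≠ 1 := by
    intro hr
    rw [Subgroup.relIndex_eq_one] at hr
    have : h2⁻¹ * h1 ∈ MulAction.stabilizer G p := hr ⟨1, by simpa using hh0⟩
    exact hgp (hh0.symm.trans this)
  have hr0 : (MulAction.stabilizer G p).relIndex H' ≠ 0 := by
    intro h; rw [h, zero_mul] at hmul; exact h0 hmul.symm
  have hi0 : H'.index ≠ 0 := by
    intro h; rw [h, mul_zero] at hmul; exact h0 hmul.symm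
  have hlt : H'.index < m := by
    have : 2 ≤ (MulAction.stabilizer G p).relIndex H' := by omega
    nlinarith
  have htop := hN H' hi0 hlt
  have hcomm : commutator G ≤ MulAction.stabilizer G p := by
    refine Subgroup.commutator_le.2 ?_
    intro a _ b _
    obtain ⟨z, hz⟩ : a ∈ H' := by rw [htop]; trivial
    obtain ⟨w, hw⟩ : b ∈ H' := by rw [htop]; trivial
    rw [MulAction.mem_stabilizer_iff, commutatorElement_def]
    have hab : (a * b) • p = (b * a) • p := by
      rw [mul_smul, mul_smul, hz, hw, ← hgz, ← hgz, hz, hw, ← Perm.mul_apply, ← Perm.mul_apply,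
        ← zpow_add, ← zpow_add, add_comm]
    have : a * b * a⁻¹ * b⁻¹ = (a * b) * (b * a)⁻¹ := by group
    obtain ⟨t, ht⟩ : (b * a)⁻¹ ∈ H' := by rw [htop]; trivial
    rw [this, mul_smul, ht, ← hgz, hab, hgz, ← ht, smul_inv_smul]
  obtain ⟨h, hh⟩ := hp
  rw [hperf] at hcomm
  exact hh (hcomm (Subgroup.mem_top h))

theorem centralizer_support {G X : Type*} [Group G] [Finite X] (f : G →* Perm X) {m : ℕ}
    (hperf : commutator G = ⊤) (hN : NoSmall G m) (hX : Nat.card X < 2 * m) (hf : f ≠ 1) :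
    ∃ F : Set X, F.ncard + m ≤ Nat.card X ∧
      ∀ g : Perm X, (∀ h, Commute g (f h)) → ∀ p ∉ F, g p = p := by
  let : MulAction G X := MulAction.compHom X f
  refine ⟨{q | ∀ h, f h q = q}, ?_, ?_⟩
  · obtain ⟨h, hh⟩ : ∃ h, f h ≠ 1 := by
      by_contra hcon; push Not at hcon; exact hf (MonoidHom.ext hcon)
    obtain ⟨p, hp⟩ : ∃ p, f h p ≠ p := by
      by_contra hcon; push Not at hcon; exact hh (Equiv.ext hcon)
    have hb := orbit_big hN p ⟨h, hp⟩
    have hd : Disjoint {q | ∀ h, f h q = q} (MulAction.orbit G p) := by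
      rw [Set.disjoint_left]
      rintro q hq ⟨k, hk⟩
      have e1 : f k p = q := hk
      have e2 : p = q := by
        have := hq k⁻¹
        rw [map_inv, Perm.inv_eq_iff_eq] at this
        exact (f k).injective (e1.trans this)
      subst e2
      exact hp (hq h)
    have h1 := Set.ncard_union_eq hd
    have h2 := Set.ncard_le_card ({q | ∀ h, f h q = q} ∪ (MulAction.orbit G p))
    omega
  · intro g hg p hp
    simp only [Set.mem_ofPred_eq, not_forall] at hp
    exact centralizer_fix hperf hN hX g
      (fun h x => congrArg (fun s : Perm X => s x) (hg h).eq) p hp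

theorem small_support {X : Type*} [DecidableEq X] (x y : X) (W : Perm X)
    (h : ∀ p, p ≠ x → p ≠ y → W p = p) : W = 1 ∨ W = swap x y := by
  have hinj := W.injective
  by_cases hx : W x = x
  · left
    ext p
    simp only [Perm.one_apply]
    by_cases hp : p = x
    · subst hp; exact hx
    by_cases hq : p = y
    · subst hq
      by_contra hne
      by_cases h2 : W p = x
      · exact hp (hinj (h2.trans hx.symm))
      · exact hne (hinj (h _ h2 hne))
    · exact h p hp hq
  · right
    have hxy : W x = y := by
      by_contra h2
      exact hx (hinj (h _ hx h2))
    have hne : x ≠ y := by rintro rfl; exact hx hxy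
    have hy : W y = x := by
      by_contra h2
      by_cases h3 : W y = y
      · exact hne (hinj (hxy.trans h3.symm))
      · exact h3 (hinj (h _ h2 h3))
    ext p
    by_cases hp : p = x
    · subst hp; simp [hxy]
    by_cases hq : p = y
    · subst hq; simp [hy]
    rw [swap_apply_of_ne_of_ne hp hq, h p hp hq]

theorem eq_of_small_support {X : Type*} [Finite X] (F : Set X) (hF : F.ncard ≤ 2)
    (U V : Perm X) (hU : ∀ p ∉ F, U p = p) (hV : ∀ p ∉ F, V p = p) (hU1 : U ≠ 1) (hV1 : V ≠ 1) :
    U = V := by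
  classical
  obtain ⟨x, y, hxy⟩ : ∃ x y, F ⊆ {x, y} := by
    have : F.ncard = 0 ∨ F.ncard = 1 ∨ F.ncard = 2 := by omega
    rcases this with h | h | h
    · rw [Set.ncard_eq_zero] at h
      exact absurd (Equiv.ext fun p => hU p (by simp [h])) hU1
    · obtain ⟨x, rfl⟩ := Set.ncard_eq_one.1 h
      exact ⟨x, x, by simp⟩
    · obtain ⟨x, y, _, rfl⟩ := Set.ncard_eq_two.1 h
      exact ⟨x, y, le_rfl⟩
  have aux : ∀ W : Perm X, (∀ p ∉ F, W p = p) → W ≠ 1 → W = swap x y := by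
    intro W hW hW1
    refine (small_support x y W ?_).resolve_left hW1
    intro p hp hq
    exact hW p (fun hpF => by
      rcases hxy hpF with h | h
      · exact hp h
      · exact hq h)
  rw [aux U hU hU1, aux V hV hV1]

end perms

section main

variable {n : ℕ}

theorem dd_div {i j k : ℕ} (hi : i + 1 < n) (hj : j + 1 < n) (hk : k + 1 < n) :
    dd n i k hi hk * (dd n j k hj hk)⁻¹ = dd n i j hi hj := by
  apply Subtype.ext
  simp [dd]

theorem dd_inv {i j : ℕ} (hi : i + 1 < n) (hj : j + 1 < n) :
    (dd n i j hi hj)⁻¹ = dd n j i hj hi := by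
  apply Subtype.ext
  simp [dd]

theorem braid_twist {G : Type*} [Group G] {x y z : G} (h : x * y * x = y * x * y)
    (hx : Commute z x) (hy : Commute z y) :
    (x * z⁻¹) * (y * z⁻¹) * (x * z⁻¹) = (y * z⁻¹) * (x * z⁻¹) * (y * z⁻¹) := by
  have hx' : z⁻¹ * x = x * z⁻¹ := hx.inv_left
  have hy' : z⁻¹ * y = y * z⁻¹ := hy.inv_left
  have e1 : (x * z⁻¹) * (y * z⁻¹) * (x * z⁻¹) = (x * y * x) * (z⁻¹ * z⁻¹ * z⁻¹) := by
    calc _ = x * (z⁻¹ * y) * (z⁻¹ * x) * z⁻¹ := by group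
      _ = x * y * (z⁻¹ * x) * z⁻¹ * z⁻¹ := by rw [hx', hy']; simp only [mul_assoc, ← hx']
      _ = _ := by rw [hx']; group
  have e2 : (y * z⁻¹) * (x * z⁻¹) * (y * z⁻¹) = (y * x * y) * (z⁻¹ * z⁻¹ * z⁻¹) := by
    calc _ = y * (z⁻¹ * x) * (z⁻¹ * y) * z⁻¹ := by group
      _ = y * x * (z⁻¹ * y) * z⁻¹ * z⁻¹ := by rw [hx', hy']; simp only [mul_assoc, ← hy']
      _ = _ := by rw [hy']; group
  rw [e1, e2, h]

theorem dd_braid {i k : ℕ} (hi : i + 1 + 1 < n) (hk : k + 1 < n)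
    (h1 : k + 2 ≤ i ∨ i + 2 ≤ k ∨ k = i) (h2 : k + 2 ≤ i + 1 ∨ i + 1 + 2 ≤ k ∨ k = i + 1) :
    dd n i k (by omega) hk * dd n (i+1) k hi hk * dd n i k (by omega) hk =
    dd n (i+1) k hi hk * dd n i k (by omega) hk * dd n (i+1) k hi hk := by
  apply Subtype.ext
  exact braid_twist (sg_braid hi) (sg_comm' _ _ h1) (sg_comm' _ _ h2)

theorem dd_comm {i j k l : ℕ} (hi : i + 1 < n) (hj : j + 1 < n) (hk : k + 1 < n) (hl : l + 1 < n)
    (h1 : i + 2 ≤ k ∨ k + 2 ≤ i ∨ i = k) (h2 : i + 2 ≤ l ∨ l + 2 ≤ i ∨ i = l)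
    (h3 : j + 2 ≤ k ∨ k + 2 ≤ j ∨ j = k) (h4 : j + 2 ≤ l ∨ l + 2 ≤ j ∨ j = l) :
    dd n i j hi hj * dd n k l hk hl = dd n k l hk hl * dd n i j hi hj := by
  apply Subtype.ext
  exact ((sg_comm' _ _ h1).mul_right (sg_comm' _ _ h2).inv_right).mul_left
    ((sg_comm' _ _ h3).mul_right (sg_comm' _ _ h4).inv_right).inv_left

theorem hom_comm_trivial (hn : 5 ≤ n) {A : Type*} [CommGroup A]
    (f : commutator (BraidGroup n) →* A) : f = 1 := by
  refine kill_adj hn f (i := 0) (by omega) (by omega) ?_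
  rw [← dd_div (k := 3) (by omega) (by omega) (by omega), map_mul, map_inv, mul_inv_eq_one]
  have hb := congrArg f (dd_braid (n := n) (i := 0) (k := 3) (by omega) (by omega) (by omega) (by omega))
  simp only [map_mul] at hb
  exact eq_of_braid_comm hb (mul_comm _ _)

theorem perfect (hn : 5 ≤ n) : commutator (commutator (BraidGroup n)) = ⊤ := by
  have h := Abelianization.ker_of (commutator (BraidGroup n))
  rw [hom_comm_trivial hn Abelianization.of, MonoidHom.ker_one] at h
  exact h.symm

theorem sign_eq_one_of_hom (hn : 5 ≤ n) {k : ℕ} (f : commutator (BraidGroup n) →* Perm (Fin k)) (g) :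
    Perm.sign (f g) = 1 :=
  DFunLike.congr_fun (hom_comm_trivial hn (Perm.sign.comp f)) g

theorem base_five (f : commutator (BraidGroup 5) →* Perm (Fin 4)) : f = 1 := by
  let f1 : commutator (BraidGroup 5) →* alternatingGroup (Fin 4) :=
    f.codRestrict _ (fun g => Perm.mem_alternatingGroup.2 (sign_eq_one_of_hom le_rfl f g))
  have h4 : Nat.card (Fin 4) = 4 := by simp
  have h2 : ∀ g, f1 g ∈ alternatingGroup.kleinFour (Fin 4) := by
    intro g
    rw [alternatingGroup.kleinFour_eq_commutator h4]
    have hg : g ∈ commutator (commutator (BraidGroup 5)) := by rw [perfect le_rfl]; trivial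
    have : commutator (commutator (BraidGroup 5)) ≤ (commutator (alternatingGroup (Fin 4))).comap f1 := by
      refine Subgroup.commutator_le.2 ?_
      intro a _ b _
      rw [Subgroup.mem_comap, map_commutatorElement]
      exact Subgroup.commutator_mem_commutator trivial trivial
    exact this hg
  have hk : IsKleinFour (alternatingGroup.kleinFour (Fin 4)) :=
    alternatingGroup.kleinFour_isKleinFour h4
  let f2 := f1.codRestrict _ h2
  let _ : CommGroup (alternatingGroup.kleinFour (Fin 4)) :=
    { (inferInstance : Group (alternatingGroup.kleinFour (Fin 4))) with
      mul_comm := fun a b => (IsKleinFour.isMulCommutative (G := alternatingGroup.kleinFour (Fin 4))).1.1 a b }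
  have h3 : f2 = 1 := hom_comm_trivial le_rfl f2
  ext1 g
  have := DFunLike.congr_fun h3 g
  exact congrArg (fun t : alternatingGroup.kleinFour (Fin 4) =>
    ((t : alternatingGroup (Fin 4)) : Perm (Fin 4))) this

theorem base_six (f : commutator (BraidGroup 6) →* Perm (Fin 5)) : f = 1 := by
  refine kill_far (by omega) f ?_
  rw [← dd_div (k := 4) (by omega) (by omega) (by omega), map_mul, map_inv, mul_inv_eq_one]
  have hb1 := congrArg f (dd_braid (n := 6) (i := 0) (k := 4) (by omega) (by omega) (by omega) (by omega))
  have hb2 := congrArg f (dd_braid (n := 6) (i := 1) (k := 4) (by omega) (by omega) (by omega) (by omega))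
  have hc := congrArg f (dd_comm (n := 6) (i := 0) (j := 4) (k := 2) (l := 4) (by omega) (by omega)
    (by omega) (by omega) (by omega) (by omega) (by omega) (by omega))
  simp only [map_mul] at hb1 hb2 hc
  by_contra hne
  by_cases h1 : f (dd 6 0 4 (by omega) (by omega)) = 1
  · rw [h1] at hb1 hne
    simp only [one_mul, mul_one] at hb1
    have hb : f (dd 6 (0+1) 4 (by omega) (by omega)) = 1 := by
      simpa using hb1
    simp only [zero_add] at hb
    rw [hb] at hb2
    simp only [one_mul, mul_one] at hb2
    apply hne
    symm
    simpa using hb2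
  · exact good_five _ (sign_eq_one_of_hom (by omega) f _) h1 _ hc (sign_eq_one_of_hom (by omega) f _) hne _ hb1 hb2

theorem base_seven (f : commutator (BraidGroup 7) →* Perm (Fin 6)) : f = 1 := by
  by_cases h1 : f (dd 7 0 2 (by omega) (by omega)) = 1
  · exact kill_far (by omega) f h1
  refine kill_adj (by omega) f (i := 4) (by omega) (by omega) ?_
  rw [← dd_div (k := 0) (by omega) (by omega) (by omega), map_mul, map_inv, mul_inv_eq_one]
  have hb := congrArg f (dd_braid (n := 7) (i := 4) (k := 0) (by omega) (by omega) (by omega) (by omega))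
  have hc1 := congrArg f (dd_comm (n := 7) (i := 0) (j := 2) (k := 4) (l := 0) (by omega) (by omega)
    (by omega) (by omega) (by omega) (by omega) (by omega) (by omega))
  have hc2 := congrArg f (dd_comm (n := 7) (i := 0) (j := 2) (k := 5) (l := 0) (by omega) (by omega)
    (by omega) (by omega) (by omega) (by omega) (by omega) (by omega))
  simp only [map_mul] at hb hc1 hc2
  exact good_six _ (sign_eq_one_of_hom (by omega) f _) h1 _ hc1 (sign_eq_one_of_hom (by omega) f _) _ hc2 hb

/-- the homomorphism sending `σ_i` to `σ_{i+3}` -/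
def shiftHom (m : ℕ) : BraidGroup m →* BraidGroup (m + 3) :=
  PresentedGroup.toGroup (rels := braidRels m)
    (f := fun i => sg (m + 3) (i.1 + 3) (by have := i.2; omega)) (by
      rintro r (⟨i, j, hij, rfl⟩ | ⟨i, j, hij, rfl⟩)
      · simp only [map_mul, map_inv, FreeGroup.lift_apply_of]
        rw [mul_inv_eq_one, mul_inv_eq_iff_eq_mul]
        refine (sg_comm' _ _ ?_).eq
        have := le_abs.1 hij
        omega
      · simp only [map_mul, map_inv, FreeGroup.lift_apply_of]
        rw [mul_inv_eq_one, mul_inv_eq_iff_eq_mul, mul_inv_eq_iff_eq_mul]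
        obtain ⟨i, hi⟩ := i
        obtain ⟨j, hj⟩ := j
        rcases (abs_eq (by norm_num)).1 hij with h | h
        · obtain rfl : i = j + 1 := by simp only at h; omega
          exact (sg_braid (n := m + 3) (i := j + 3) (by omega)).symm
        · obtain rfl : j = i + 1 := by simp only at h; omega
          exact sg_braid (n := m + 3) (i := i + 3) (by omega))

theorem shiftHom_sg (m i : ℕ) (hi : i + 1 < m) :
    shiftHom m (sg m i hi) = sg (m + 3) (i + 3) (by omega) :=
  PresentedGroup.toGroup.of _

theorem shift_commute (m i : ℕ) (hi : i ≤ 1) (hi2 : i + 1 < m + 3) (g : BraidGroup m) :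
    Commute (sg (m + 3) i hi2) (shiftHom m g) := by
  have hle : (⊤ : Subgroup (BraidGroup m)) ≤
      (Subgroup.centralizer {sg (m + 3) i hi2}).comap (shiftHom m) := by
    rw [← sg_closure, Subgroup.closure_le]
    rintro _ ⟨j, hj, rfl⟩
    simp only [Subgroup.coe_comap, Set.mem_preimage, SetLike.mem_coe,
      Subgroup.mem_centralizer_singleton_iff]
    rw [shiftHom_sg]
    exact (sg_comm' _ _ (by omega)).eq.symm
  have := hle (Subgroup.mem_top g)
  rw [Subgroup.mem_comap, Subgroup.mem_centralizer_singleton_iff] at this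
  exact this.symm

/-- the restriction of `shiftHom` to commutator subgroups -/
def shiftComm (m : ℕ) : commutator (BraidGroup m) →* commutator (BraidGroup (m + 3)) :=
  ((shiftHom m).comp (commutator (BraidGroup m)).subtype).codRestrict _ (fun g => by
    rw [mem_comm_iff_s16]
    exact Abelianization.commutator_subset_ker (Abelianization.of.comp (shiftHom m)) g.2)

theorem step (m : ℕ) (hm : 5 ≤ m) (hN : NoSmall (commutator (BraidGroup m)) m)
    (f : commutator (BraidGroup (m + 3)) →* Perm (Fin (m + 2))) : f = 1 := by
  by_cases hf : f.comp (shiftComm m) = 1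
  · refine kill_adj (by omega) f (i := 3) (by omega) (by omega) ?_
    have h := DFunLike.congr_fun hf (dd m 0 1 (by omega) (by omega))
    have e : shiftComm m (dd m 0 1 (by omega) (by omega)) =
        dd (m + 3) 3 (3 + 1) (by omega) (by omega) := by
      apply Subtype.ext
      change shiftHom m (sg m 0 (by omega) * (sg m 1 (by omega))⁻¹) =
        sg (m + 3) 3 (by omega) * (sg (m + 3) (3 + 1) (by omega))⁻¹
      rw [map_mul, map_inv, shiftHom_sg, shiftHom_sg]
    rw [← e]
    exact h
  obtain ⟨F, hF, hcen⟩ := centralizer_support (f.comp (shiftComm m)) (perfect hm) hN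
    (by simp; omega) hf
  rw [Nat.card_eq_fintype_card, Fintype.card_fin] at hF
  set a := dd (m + 3) 0 3 (by omega) (by omega) with ha
  set b := dd (m + 3) 1 3 (by omega) (by omega) with hb
  have hbr := congrArg f (dd_braid (n := m + 3) (i := 0) (k := 3) (by omega) (by omega) (by omega) (by omega))
  simp only [map_mul, zero_add] at hbr
  rw [← ha, ← hb] at hbr
  suffices hab : f a = f b by
    refine kill_adj (by omega) f (i := 0) (by omega) (by omega) ?_
    rw [← dd_div (k := 3) (by omega) (by omega) (by omega), map_mul, map_inv, mul_inv_eq_one]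
    exact hab
  have hu : ∀ h, Commute (f (b * a⁻¹)) (f.comp (shiftComm m) h) := by
    intro h
    refine Commute.map (y := shiftComm m h) ?_ f
    rw [hb, ha, dd_div]
    apply Subtype.ext
    exact (shift_commute m 1 (by omega) (by omega) h.1).mul_left
      (shift_commute m 0 (by omega) (by omega) h.1).inv_left
  have hv : ∀ h, Commute (f (a * (b * a⁻¹) * a⁻¹)) (f.comp (shiftComm m) h) := by
    intro h
    refine Commute.map (y := shiftComm m h) ?_ f
    rw [hb, ha, dd_div]
    apply Subtype.ext
    have c0 := shift_commute m 0 (by omega) (by omega) h.1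
    have c1 := shift_commute m 1 (by omega) (by omega) h.1
    have e : ((dd (m + 3) 0 3 (by omega) (by omega) * dd (m + 3) 1 0 (by omega) (by omega) *
        (dd (m + 3) 0 3 (by omega) (by omega))⁻¹ : commutator (BraidGroup (m + 3))) :
          BraidGroup (m + 3)) = sg (m + 3) 0 (by omega) *
          (sg (m + 3) 1 (by omega) * (sg (m + 3) 0 (by omega))⁻¹) * (sg (m + 3) 0 (by omega))⁻¹ := by
      have k : Commute (sg (m + 3) 3 (by omega)) (sg (m + 3) 1 (by omega) * (sg (m + 3) 0 (by omega))⁻¹) :=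
        (sg_comm' _ _ (by omega)).mul_right (sg_comm' _ _ (by omega)).inv_right
      have k' : (sg (m + 3) 3 (by omega))⁻¹ * (sg (m + 3) 1 (by omega) * (sg (m + 3) 0 (by omega))⁻¹) =
        (sg (m + 3) 1 (by omega) * (sg (m + 3) 0 (by omega))⁻¹) * (sg (m + 3) 3 (by omega))⁻¹ := k.inv_left
      change sg _ 0 _ * (sg _ 3 _)⁻¹ * (sg _ 1 _ * (sg _ 0 _)⁻¹) * (sg _ 0 _ * (sg _ 3 _)⁻¹)⁻¹ = _
      rw [mul_assoc (sg _ 0 _), k']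
      group
    change _ * (shiftHom m h.1) = (shiftHom m h.1) * _
    rw [e]
    exact (c0.mul_left (c1.mul_left c0.inv_left)).mul_left c0.inv_left
  have sU := hcen _ hu
  have sV := hcen _ hv
  by_cases hU : f (b * a⁻¹) = 1
  · rw [map_mul, map_inv, mul_inv_eq_one] at hU
    exact hU.symm
  have hV : f (a * (b * a⁻¹) * a⁻¹) ≠ 1 := by
    intro h
    apply hU
    rw [map_mul, map_mul, map_inv, mul_inv_eq_one, mul_eq_left] at h
    exact h
  have hUV := eq_of_small_support F (by omega) _ _ sU sV hU hV
  simp only [map_mul, map_inv] at hUV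
  refine eq_of_braid_comm hbr ?_
  have h2 := mul_right_cancel hUV
  rw [← mul_assoc, eq_mul_inv_iff_mul_eq] at h2
  exact h2.symm

theorem noSmall_braid (n : ℕ) (hn : 5 ≤ n) : NoSmall (commutator (BraidGroup n)) n := by
  induction n using Nat.strong_induction_on with
  | _ n ih =>
    by_cases h5 : n = 5
    · subst h5; exact noSmall_of_hom base_five
    by_cases h6 : n = 6
    · subst h6; exact noSmall_of_hom base_six
    by_cases h7 : n = 7
    · subst h7; exact noSmall_of_hom base_seven
    obtain ⟨m, rfl⟩ : ∃ m, n = m + 3 := ⟨n - 3, by omega⟩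
    exact noSmall_of_hom (step m (by omega) (ih m (by omega) (by omega)))

end main

/-- For `n ≥ 5`, every nontrivial homomorphism from the commutator subgroup of the braid
group into the symmetric group on `n` letters is transitive. -/
theorem nontrivial_hom_Kn_transitive (n : ℕ) (hn : 5 ≤ n)
    (f : ↥(commutator (BraidGroup n)) →* Equiv.Perm (Fin n)) (hf : f ≠ 1) :
    ∀ i j : Fin n, ∃ g, (f g) i = j := by
  let _ : MulAction (commutator (BraidGroup n)) (Fin n) := MulAction.compHom (Fin n) f
  obtain ⟨h, hh⟩ : ∃ h, f h ≠ 1 := by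
    by_contra hcon; push Not at hcon; exact hf (MonoidHom.ext hcon)
  obtain ⟨p, hp⟩ : ∃ p, f h p ≠ p := by
    by_contra hcon; push Not at hcon; exact hh (Equiv.ext hcon)
  have hb := orbit_big (noSmall_braid n hn) p ⟨h, hp⟩
  have huniv : MulAction.orbit (commutator (BraidGroup n)) p = Set.univ := by
    apply Set.eq_of_subset_of_ncard_le (Set.subset_univ _)
    rw [Set.ncard_univ]
    simpa using hb
  intro i j
  obtain ⟨g1, h1⟩ : i ∈ MulAction.orbit (commutator (BraidGroup n)) p := by rw [huniv]; trivial
  obtain ⟨g2, h2⟩ : j ∈ MulAction.orbit (commutator (BraidGroup n)) p := by rw [huniv]; trivial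
  have e1 : f g1 p = i := h1
  have e2 : f g2 p = j := h2
  refine ⟨g2 * g1⁻¹, ?_⟩
  rw [map_mul, map_inv, Perm.mul_apply, ← e1, Equiv.Perm.inv_def, Equiv.symm_apply_apply, e2]
end

section
/- For every n ≥ 5 and every r with r < n, the number of group homomorphisms from B_n into the symmetric group S_r equals r!, i.e. Nat.card (B_n →* Equiv.Perm (Fin r)) = r.factorial; indeed every such homomorphism factors through the abelianization of B_n and has cyclic image. -/
open Equiv

def cycReps : List (Perm (Fin 5)) :=
  [swap 0 1, swap 0 1 * swap 2 3, swap 0 1 * swap 1 2, swap 0 1 * swap 1 2 * swap 3 4,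
    swap 0 1 * swap 1 2 * swap 2 3, swap 0 1 * swap 1 2 * swap 2 3 * swap 3 4]

set_option maxRecDepth 100000 in
theorem base5 : ∀ a b : Perm (Fin 4), a * b * a = b * a * b → ∀ c, a * c = c * a →
    b * c * b = c * b * c → ∀ d, a * d = d * a → b * d = d * b → c * d * c = d * c * d →
    a = b := by decide +kernel

set_option maxRecDepth 100000 in
theorem base6 : ∀ a ∈ cycReps,
    ∀ b, a * b = b * a → ∀ c, a * c = c * a → b * c * b = c * b * c → ∀ d, a * d = d * a →
    b * d = d * b → c * d * c = d * c * d → b = d := by decide +kernel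

set_option maxRecDepth 100000 in
theorem reps6a : ∀ x y : Fin 5, x ≠ y → ∃ g : Perm (Fin 5), g x = 0 ∧ g y = 1 := by
  decide +kernel

set_option maxRecDepth 100000 in
theorem reps6b : ∀ a : Perm (Fin 5), a 0 = 1 →
    ∃ g : Perm (Fin 5), g * a * g⁻¹ ∈ cycReps := by decide +kernel

theorem reps6 (a : Perm (Fin 5)) (ha : a ≠ 1) : ∃ g : Perm (Fin 5), g * a * g⁻¹ ∈ cycReps := by
  obtain ⟨x, hx⟩ : ∃ x, a x ≠ x := by
    by_contra! h
    exact ha (Equiv.ext h)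
  obtain ⟨g, h0, h1⟩ := reps6a x (a x) (Ne.symm hx)
  have h2 : (g * a * g⁻¹) 0 = 1 := by
    rw [← h0]; simp [h1]
  obtain ⟨k, hk⟩ := reps6b _ h2
  refine ⟨k * g, ?_⟩
  convert hk using 1
  group

theorem base6' (a b c d : Perm (Fin 5)) (ha : a ≠ 1) (h1 : a * b = b * a) (h2 : a * c = c * a)
    (h3 : b * c * b = c * b * c) (h4 : a * d = d * a) (h5 : b * d = d * b)
    (h6 : c * d * c = d * c * d) : b = d := by
  obtain ⟨g, hg⟩ := reps6 a ha
  have e : ∀ x, g * x * g⁻¹ = MulAut.conj g x := fun x => rfl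
  have := base6 _ hg (g * b * g⁻¹) (by simp only [e, ← map_mul, h1]) (g * c * g⁻¹)
    (by simp only [e, ← map_mul, h2]) (by simp only [e, ← map_mul, h3]) (g * d * g⁻¹)
    (by simp only [e, ← map_mul, h4]) (by simp only [e, ← map_mul, h5])
    (by simp only [e, ← map_mul, h6])
  simpa using this

/-- `s 0, …, s (m-2)` satisfy the braid relations of `B_m`. -/
def IsBraid {G : Type*} [Group G] (m : ℕ) (s : ℕ → G) : Prop :=
  (∀ i j, i + 2 ≤ j → j + 1 < m → s i * s j = s j * s i) ∧
  (∀ i, i + 2 < m → s i * s (i + 1) * s i = s (i + 1) * s i * s (i + 1))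

theorem IsBraid.map {G H : Type*} [Group G] [Group H] {m : ℕ} {s : ℕ → G} (h : IsBraid m s)
    (φ : G →* H) : IsBraid m (fun i => φ (s i)) :=
  ⟨fun i j hi hj => by simp only [← map_mul, h.1 i j hi hj],
   fun i hi => by simp only [← map_mul, h.2 i hi]⟩

theorem eq_of_comm_braid {G : Type*} [Group G] {a b : G} (h : a * b = b * a)
    (h' : a * b * a = b * a * b) : a = b := by
  rw [h] at h'
  exact mul_left_cancel h'

theorem IsBraid.all_eq {G : Type*} [Group G] {m : ℕ} {s : ℕ → G} (h : IsBraid m s)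
    (h01 : s 0 = s 1) : ∀ i, i + 1 < m → s i = s 0 := by
  have key : ∀ i, i + 2 < m → s i = s (i + 1) := by
    intro i
    induction i with
    | zero => intro _; exact h01
    | succ k ih =>
      intro hk
      have e := ih (by omega)
      refine eq_of_comm_braid ?_ (h.2 (k + 1) hk)
      rw [← e]
      exact h.1 k (k + 2) le_rfl (by omega)
  intro i
  induction i with
  | zero => intro _; rfl
  | succ k ih => intro hk; rw [← key k (by omega)]; exact ih (by omega)

theorem IsBraid.eq_one {G : Type*} [Group G] {m : ℕ} {s : ℕ → G} (h : IsBraid m s) (k : ℕ)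
    (hk : k + 1 < m) (h1 : s k = 1) : ∀ i, i ≤ k → s i = 1 := by
  induction k with
  | zero => intro i hi; rwa [Nat.le_zero.1 hi]
  | succ k ih =>
    have h2 := h.2 k (by omega)
    rw [h1] at h2
    have h3 : s k = 1 := by simpa using h2
    intro i hi
    rcases Nat.lt_or_ge k i with hki | hki
    · rwa [show i = k + 1 by omega]
    · exact ih (by omega) h3 i hki

theorem IsBraid.mono {G : Type*} [Group G] {m k : ℕ} {s : ℕ → G} (h : IsBraid m s)
    (hk : k ≤ m) : IsBraid k s :=
  ⟨fun i j hi hj => h.1 i j hi (by omega), fun i hi => h.2 i (by omega)⟩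

def BraidProp (m : ℕ) : Prop :=
  ∀ r : ℕ, r < m → ∀ s : ℕ → Perm (Fin r), IsBraid m s → s 0 = s 1

theorem BraidProp.apply {m : ℕ} (h : BraidProp m) {Y : Type*} [Fintype Y]
    (hY : Fintype.card Y < m) (s : ℕ → Perm Y) (hs : IsBraid m s) :
    ∀ i, i + 1 < m → s i = s 0 := by
  have h1 := h _ hY _ (hs.map (Fintype.equivFin Y).permCongrHom.toMonoidHom)
  exact hs.all_eq ((Fintype.equivFin Y).permCongrHom.injective h1)

theorem braidProp_of_top {m : ℕ} (h : ∀ s : ℕ → Perm (Fin m), IsBraid (m + 1) s → s 0 = s 1) :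
    BraidProp (m + 1) := by
  intro r hr s hs
  have := h _ (hs.map (Perm.viaEmbeddingHom (Fin.castLEEmb (Nat.le_of_lt_succ hr))))
  exact Perm.viaEmbeddingHom_injective _ this

theorem braidProp5 : BraidProp 5 := braidProp_of_top fun s hs =>
  base5 (s 0) (s 1) (hs.2 0 (by omega)) (s 2) (hs.1 0 2 (by omega) (by omega))
    (hs.2 1 (by omega)) (s 3) (hs.1 0 3 (by omega) (by omega)) (hs.1 1 3 (by omega) (by omega))
    (hs.2 2 (by omega))

theorem braidProp6 : BraidProp 6 := braidProp_of_top fun s hs => by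
  by_cases h1 : s 4 = 1
  · rw [hs.eq_one 4 (by omega) h1 0 (by omega), hs.eq_one 4 (by omega) h1 1 (by omega)]
  have e := base6' (s 4) (s 0) (s 1) (s 2) h1 (hs.1 0 4 (by omega) (by omega)).symm
    (hs.1 1 4 (by omega) (by omega)).symm (hs.2 0 (by omega))
    (hs.1 2 4 (by omega) (by omega)).symm (hs.1 0 2 (by omega) (by omega)) (hs.2 1 (by omega))
  -- `s 0 = s 2` commutes with `s 3`
  have e2 : s 2 = s 3 := eq_of_comm_braid (by
    rw [← e]; exact hs.1 0 3 (by omega) (by omega)) (hs.2 2 (by omega))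
  refine eq_of_comm_braid ?_ (hs.2 0 (by omega))
  rw [e, e2]
  exact (hs.1 1 3 (by omega) (by omega)).symm

def fixHom {X : Type*} (σ : Perm X) :
    Subgroup.centralizer {σ} →* Perm {x // σ x = x} where
  toFun k := (k : Perm X).subtypePerm (p := fun x => σ x = x) (by
    intro x
    have h : σ * k = k * σ := Subgroup.mem_centralizer_singleton_iff.1 k.2 |>.symm
    have h' : σ ((k : Perm X) x) = (k : Perm X) (σ x) := congrArg (fun p : Perm X => p x) h
    rw [h']; simp)
  map_one' := by ext; simp
  map_mul' a b := by ext; rfl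

theorem card_fix {X : Type*} [Fintype X] [DecidableEq X] (σ : Perm X) (h : σ ≠ 1) :
    Fintype.card {x // σ x = x} + 2 ≤ Fintype.card X := by
  have h2 : 2 ≤ σ.support.card := Perm.two_le_card_support_of_ne_one h
  have h3 := Fintype.card_subtype_compl (fun x => σ x = x)
  have h4 : Fintype.card {x // ¬ σ x = x} = σ.support.card := by
    rw [Fintype.card_subtype]; rfl
  omega

theorem card_cycles {X : Type*} [Fintype X] [DecidableEq X] (σ : Perm X) :
    2 * σ.cycleFactorsFinset.card ≤ Fintype.card X := by
  have h1 := σ.sum_cycleType_le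
  have h2 := Multiset.card_nsmul_le_sum (s := σ.cycleType) (a := 2)
    (fun x hx => Perm.two_le_of_mem_cycleType hx)
  have h3 : Multiset.card σ.cycleType = σ.cycleFactorsFinset.card := by
    simp [Perm.cycleType_def]
  rw [h3, smul_eq_mul] at h2
  omega

theorem sameCycle_of_hom {X : Type*} [Fintype X] [DecidableEq X] (σ : Perm X)
    (k : Subgroup.centralizer {σ}) (h1 : fixHom σ k = 1)
    (h2 : Perm.OnCycleFactors.toPermHom σ k = 1) (x : X) : σ.SameCycle x ((k : Perm X) x) := by
  by_cases hx : σ x = x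
  · have := congrArg (fun p : Perm {x // σ x = x} => (p ⟨x, hx⟩ : X)) h1
    have h3 : (k : Perm X) x = x := this
    rw [h3]
  · have hc : σ.cycleOf x ∈ σ.cycleFactorsFinset := by
      rwa [Perm.cycleOf_mem_cycleFactorsFinset_iff, Perm.mem_support]
    have := congrArg (fun p : Perm σ.cycleFactorsFinset => (p ⟨_, hc⟩ : Perm X)) h2
    have h3 : (k : Perm X) * σ.cycleOf x * (k : Perm X)⁻¹ = σ.cycleOf x := this
    have h4 : (k : Perm X) x ∈ (σ.cycleOf x).support := by
      rw [Perm.mem_support]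
      intro h
      rw [← h3] at h
      simp at h
      exact hx h
    exact (Perm.mem_support_cycleOf_iff.1 h4).1

theorem braidProp_step {m : ℕ} (hm : 5 ≤ m) (h : BraidProp m) : BraidProp (m + 2) := by
  intro r hr s hs
  by_cases h1 : s m = 1
  · rw [hs.eq_one m (by omega) h1 0 (by omega), hs.eq_one m (by omega) h1 1 (by omega)]
  have hc : ∀ i, i + 1 < m → s i ∈ Subgroup.centralizer {s m} := fun i hi =>
    Subgroup.mem_centralizer_singleton_iff.2 (hs.1 i m (by omega) (by omega))
  classical
  let t : ℕ → Subgroup.centralizer {s m} := fun i =>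
    if hi : i + 1 < m then ⟨s i, hc i hi⟩ else 1
  have ht : ∀ i, i + 1 < m → (t i : Perm (Fin r)) = s i := fun i hi => by simp [t, hi]
  have htb : IsBraid m t := by
    refine ⟨fun i j hi hj => Subtype.ext ?_, fun i hi => Subtype.ext ?_⟩
    · push_cast
      rw [ht i (by omega), ht j (by omega)]
      exact hs.1 i j hi (by omega)
    · push_cast
      rw [ht i (by omega), ht (i + 1) (by omega)]
      exact hs.2 i (by omega)
  have hcf := card_fix (s m) h1
  have hcc := card_cycles (s m)
  rw [Fintype.card_fin] at hcf hcc
  have ef := h.apply (by omega) _ (htb.map (fixHom (s m)))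
  have ec := h.apply (by rw [Fintype.card_coe]; omega) _
    (htb.map (Perm.OnCycleFactors.toPermHom (s m)))
  have same : ∀ i, i + 1 < m → ∀ x, (s m).SameCycle x ((s i * (s 3)⁻¹) x) := by
    intro i hi x
    have := sameCycle_of_hom (s m) (t i * (t 3)⁻¹)
      (by rw [map_mul, map_inv, ef i hi, ef 3 (by omega), mul_inv_cancel])
      (by rw [map_mul, map_inv, ec i hi, ec 3 (by omega), mul_inv_cancel]) x
    push_cast at this
    rwa [ht i hi, ht 3 (by omega)] at this
  have hz : ∀ i, i + 1 < m → ∀ (z : ℤ) x,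
      (s i * (s 3)⁻¹) ((s m ^ z) x) = (s m ^ z) ((s i * (s 3)⁻¹) x) := by
    intro i hi z x
    have c1 : Commute (s i) (s m) := hs.1 i m (by omega) (by omega)
    have c3 : Commute (s 3) (s m) := hs.1 3 m (by omega) (by omega)
    have := (c1.mul_left c3.inv_left).zpow_right z
    exact congrArg (fun p : Perm (Fin r) => p x) this.eq
  have hcomm : Commute (s 0 * (s 3)⁻¹) (s 1 * (s 3)⁻¹) := by
    refine Equiv.ext fun x => ?_
    obtain ⟨a, ha⟩ := same 0 (by omega) x
    obtain ⟨b, hb⟩ := same 1 (by omega) x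
    rw [Perm.mul_apply (s 0 * (s 3)⁻¹), Perm.mul_apply (s 1 * (s 3)⁻¹), ← ha, ← hb,
      hz 0 (by omega), hz 1 (by omega), ← ha, ← hb, ← Perm.mul_apply, ← Perm.mul_apply,
      ← zpow_add, ← zpow_add, add_comm]
  have c03 : Commute (s 0) (s 3) := hs.1 0 3 (by omega) (by omega)
  have c13 : Commute (s 1) (s 3) := hs.1 1 3 (by omega) (by omega)
  have d1 : Commute (s 0 * (s 3)⁻¹) (s 3) := c03.mul_left (Commute.refl _).inv_left
  have d2 : Commute (s 0 * (s 3)⁻¹) (s 1) := by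
    simpa using hcomm.mul_right d1
  have d3 : Commute (s 0) (s 1) := by
    simpa using d2.mul_left c13.symm
  exact eq_of_comm_braid d3.eq (hs.2 0 (by omega))

theorem braidProp_all : ∀ m, 5 ≤ m → BraidProp m
  | 5, _ => braidProp5
  | 6, _ => braidProp6
  | m + 7, _ => braidProp_step (by omega) (braidProp_all (m + 5) (by omega))

theorem braid_hom_gen {n r : ℕ} (hn : 5 ≤ n) (hr : r < n)
    (f : BraidGroup n →* Perm (Fin r)) (i : Fin (n - 1)) :
    f (PresentedGroup.of i) = f (PresentedGroup.of ⟨0, by omega⟩) := by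
  let s : ℕ → Perm (Fin r) := fun k =>
    if hk : k < n - 1 then f (PresentedGroup.of ⟨k, hk⟩) else 1
  have hsk : ∀ k (hk : k < n - 1), s k = f (PresentedGroup.of ⟨k, hk⟩) := fun k hk => by
    simp [s, hk]
  have hs : IsBraid n s := by
    refine ⟨fun a b ha hb => ?_, fun a ha => ?_⟩
    · rw [hsk a (by omega), hsk b (by omega), ← map_mul, ← map_mul]
      congr 1
      have : PresentedGroup.mk (braidRels n) _ = 1 := PresentedGroup.one_of_mem
        (Or.inl ⟨⟨a, by omega⟩, ⟨b, by omega⟩, by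
          simp only []; rw [abs_sub_comm, abs_of_nonneg] <;> omega, rfl⟩)
      simp only [map_mul, map_inv] at this
      rw [mul_inv_eq_one, mul_inv_eq_iff_eq_mul] at this
      exact this
    · rw [hsk a (by omega), hsk (a + 1) (by omega)]
      simp only [← map_mul]
      congr 1
      have : PresentedGroup.mk (braidRels n) _ = 1 := PresentedGroup.one_of_mem
        (Or.inr ⟨⟨a, by omega⟩, ⟨a + 1, by omega⟩, by simp, rfl⟩)
      simp only [map_mul, map_inv] at this
      rw [mul_inv_eq_one, mul_inv_eq_iff_eq_mul, mul_inv_eq_iff_eq_mul] at this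
      exact this
  have h01 := braidProp_all n hn r hr s hs
  have := hs.all_eq h01 i (by omega)
  rwa [hsk i i.2, hsk 0 (by omega)] at this

/-- The homomorphism sending every generator to `g`. -/
def constHom (n : ℕ) {G : Type*} [Group G] (g : G) : BraidGroup n →* G :=
  PresentedGroup.toGroup (f := fun _ => g) (by
    rintro r (⟨i, j, -, rfl⟩ | ⟨i, j, -, rfl⟩) <;> simp)

theorem constHom_of (n : ℕ) {G : Type*} [Group G] (g : G) (i : Fin (n - 1)) :
    constHom n g (PresentedGroup.of i) = g := PresentedGroup.toGroup.of _

/-- For `n ≥ 5` and `r < n`, there are exactly `r!` homomorphisms from the braid group into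
the symmetric group on `r` letters; each factors through the abelianization and has cyclic
image. -/
theorem card_hom_Bn_symm (n r : ℕ) (hn : 5 ≤ n) (hr : r < n) :
    Nat.card (BraidGroup n →* Equiv.Perm (Fin r)) = r.factorial ∧
    ∀ f : BraidGroup n →* Equiv.Perm (Fin r),
      (∃ g : Abelianization (BraidGroup n) →* Equiv.Perm (Fin r),
        f = g.comp Abelianization.of) ∧ IsCyclic ↥f.range := by
  have hconst : ∀ f : BraidGroup n →* Perm (Fin r),
      constHom n (f (PresentedGroup.of ⟨0, by omega⟩)) = f := fun f =>
    PresentedGroup.ext fun i => by rw [constHom_of, braid_hom_gen hn hr f i]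
  refine ⟨?_, fun f => ?_⟩
  · let e : (BraidGroup n →* Perm (Fin r)) ≃ Perm (Fin r) :=
      { toFun := fun f => f (PresentedGroup.of ⟨0, by omega⟩)
        invFun := fun g => constHom n g
        left_inv := hconst
        right_inv := fun g => constHom_of n g _ }
    rw [Nat.card_congr e, Nat.card_eq_fintype_card, Fintype.card_perm, Fintype.card_fin]
  · set g := f (PresentedGroup.of ⟨0, by omega⟩) with hg
    have hf : f = (zpowersHom (Perm (Fin r)) g).comp
        (constHom n (Multiplicative.ofAdd (1 : ℤ))) :=
      PresentedGroup.ext fun i => by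
        rw [braid_hom_gen hn hr f i, MonoidHom.comp_apply, constHom_of]
        simp [hg]
    refine ⟨⟨(zpowersHom (Perm (Fin r)) g).comp
      (Abelianization.lift (constHom n (Multiplicative.ofAdd (1 : ℤ)))), ?_⟩, ?_⟩
    · rw [MonoidHom.comp_assoc]
      convert hf using 2
      ext b
      simp
    · refine ⟨⟨⟨g, _, rfl⟩, ?_⟩⟩
      rintro ⟨y, b, rfl⟩
      refine ⟨Multiplicative.toAdd (constHom n (Multiplicative.ofAdd (1 : ℤ)) b), ?_⟩
      apply Subtype.ext
      have := congrArg (fun φ : BraidGroup n →* Perm (Fin r) => φ b) hf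
      simp only [MonoidHom.comp_apply, zpowersHom_apply] at this
      simpa using this.symm
end
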